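/- There exist absolute constants C1, C2 > 0 such that for all integers n ≥ 2 and all integers k with 1 ≤ k ≤ n/2, one has C1 · k^{-δ} (1 + log k)^{-3/2} ≤ i(n,k) ≤ C2 · k^{-δ} (1 + log k)^{-3/2}, where δ = 1 - (1 + log log 2)/log 2. -/

import Mathlib

open scoped BigOperators

noncomputable section

/-- The set `𝓛(c) = { m₁ + 2m₂ + ⋯ + k·m_k : 0 ≤ m_j ≤ c_j }`. -/
def Lset (k : ℕ) (c : Fin k → ℕ) : Finset ℕ :=
  (Finset.Icc 0 c).image fun m => ∑ j : Fin k, ((j : ℕ) + 1) * m j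

/-- `π` has an invariant set of size `k`. -/
def hasInvariantSet (n k : ℕ) (π : Equiv.Perm (Fin n)) : Prop :=
  ∃ s : Finset (Fin n), s.card = k ∧ ∀ x ∈ s, π x ∈ s

/-- `i(n,k)`: the proportion of permutations of `{1,…,n}` having an invariant set of size `k`. -/
def iProp (n k : ℕ) : ℝ :=
  (Nat.card {π : Equiv.Perm (Fin n) // hasInvariantSet n k π} : ℝ) /
    (Nat.card (Equiv.Perm (Fin n)) : ℝ)

/-- `δ = 1 - (1 + log log 2)/log 2`. -/
def delta : ℝ := 1 - (1 + Real.log (Real.log 2)) / Real.log 2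

/-- Multisets of at most `R` elements of `s`. -/
def MsLe (s : Finset ℕ) (R : ℕ) : Finset (Multiset ℕ) :=
  ((R • s.val).powerset.toFinset).filter (fun m => Multiset.card m ≤ R)

/-- Multisets of exactly `r` elements of `s`. -/
def Ms (s : Finset ℕ) (r : ℕ) : Finset (Multiset ℕ) :=
  (MsLe s r).filter (fun m => Multiset.card m = r)

/-- The weight `∏ x_b ^ c_b / c_b!` of a multiset with multiplicities `c_b`. -/
def wt (x : ℕ → ℝ) (m : Multiset ℕ) : ℝ :=
  (m.map x).prod / ((∏ b ∈ m.toFinset, (m.count b).factorial : ℕ) : ℝ)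

/-- The set of sums of submultisets of `m`. -/
def subsums (m : Multiset ℕ) : Finset ℕ := (m.powerset.map Multiset.sum).toFinset

lemma mem_MsLe {s : Finset ℕ} {R : ℕ} {m : Multiset ℕ} :
    m ∈ MsLe s R ↔ Multiset.card m ≤ R ∧ ∀ b ∈ m, b ∈ s := by
  unfold MsLe
  simp only [Finset.mem_filter, Multiset.mem_toFinset, Multiset.mem_powerset]
  constructor
  · rintro ⟨h, hR⟩
    exact ⟨hR, fun b hb => Multiset.mem_of_mem_nsmul (Multiset.mem_of_le h hb)⟩
  · rintro ⟨hR, h⟩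
    refine ⟨?_, hR⟩
    rw [Multiset.le_iff_count]
    intro b
    rw [Multiset.count_nsmul]
    by_cases hb : b ∈ m
    · rw [Multiset.count_eq_one_of_mem s.nodup (h b hb), mul_one]
      exact (Multiset.count_le_card b m).trans hR
    · rw [Multiset.count_eq_zero_of_notMem hb]; exact Nat.zero_le _

lemma mem_Ms {s : Finset ℕ} {r : ℕ} {m : Multiset ℕ} :
    m ∈ Ms s r ↔ Multiset.card m = r ∧ ∀ b ∈ m, b ∈ s := by
  unfold Ms
  rw [Finset.mem_filter, mem_MsLe]
  constructor
  · rintro ⟨⟨_, h⟩, h'⟩; exact ⟨h', h⟩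
  · rintro ⟨h', h⟩; exact ⟨⟨h'.le, h⟩, h'⟩

lemma mem_subsums {m : Multiset ℕ} {x : ℕ} : x ∈ subsums m ↔ ∃ t ≤ m, t.sum = x := by
  simp [subsums, Multiset.mem_powerset]

lemma sum_MsLe_eq (s : Finset ℕ) (R : ℕ) (F : Multiset ℕ → ℝ) :
    ∑ m ∈ MsLe s R, F m = ∑ r ∈ Finset.range (R + 1), ∑ m ∈ Ms s r, F m := by
  rw [← Finset.sum_fiberwise_of_maps_to (s := MsLe s R) (t := Finset.range (R + 1))
    (g := fun m => Multiset.card m)]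
  · refine Finset.sum_congr rfl fun r hr => Finset.sum_congr ?_ fun _ _ => rfl
    ext m
    simp only [Finset.mem_filter, mem_MsLe, mem_Ms, Finset.mem_range] at *
    constructor
    · rintro ⟨⟨_, h⟩, h'⟩; exact ⟨h', h⟩
    · rintro ⟨h', h⟩; exact ⟨⟨by omega, h⟩, h'⟩
  · intro m hm
    simp only [mem_MsLe, Finset.mem_range] at *
    omega

lemma Ms_zero (s : Finset ℕ) : Ms s 0 = {0} := by
  ext m
  simp only [mem_Ms, Multiset.card_eq_zero, Finset.mem_singleton]
  constructor
  · exact fun h => h.1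
  · rintro rfl; simp

lemma cons_mem_Ms {s : Finset ℕ} {r b : ℕ} (hb : b ∈ s) (m : Multiset ℕ) :
    m ∈ Ms s r ↔ b ::ₘ m ∈ Ms s (r + 1) := by
  simp [mem_Ms, hb]

lemma cons_mem_MsLe {s : Finset ℕ} {R b : ℕ} (hb : b ∈ s) (m : Multiset ℕ) :
    m ∈ MsLe s R ↔ b ::ₘ m ∈ MsLe s (R + 1) := by
  simp [mem_MsLe, hb]

lemma count_prod_eq (m : Multiset ℕ) (s : Finset ℕ) (h : m.toFinset ⊆ s) :
    ∏ b ∈ m.toFinset, (m.count b).factorial = ∏ b ∈ s, (m.count b).factorial := by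
  refine Finset.prod_subset h fun b _ hb => ?_
  rw [Multiset.count_eq_zero_of_notMem (by simpa using hb), Nat.factorial_zero]

lemma count_prod_pos (m : Multiset ℕ) (s : Finset ℕ) : 0 < ∏ b ∈ s, (m.count b).factorial :=
  Finset.prod_pos fun _ _ => Nat.factorial_pos _

lemma wt_zero (x : ℕ → ℝ) : wt x 0 = 1 := by simp [wt]

lemma wt_nonneg {x : ℕ → ℝ} {m : Multiset ℕ} (hx : ∀ b ∈ m, 0 ≤ x b) : 0 ≤ wt x m := by
  unfold wt
  refine div_nonneg (Multiset.prod_nonneg ?_) (Nat.cast_nonneg _)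
  simpa using hx

lemma wt_cons (x : ℕ → ℝ) (b : ℕ) (m : Multiset ℕ) :
    ((b ::ₘ m).count b : ℝ) * wt x (b ::ₘ m) = x b * wt x m := by
  unfold wt
  have h1 : (b ::ₘ m).toFinset = insert b m.toFinset := Multiset.toFinset_cons b m
  rw [count_prod_eq m (insert b m.toFinset) (Finset.subset_insert _ _), h1,
    ← Finset.mul_prod_erase _ _ (Finset.mem_insert_self b m.toFinset),
    ← Finset.mul_prod_erase _ (fun i => (m.count i).factorial)
      (Finset.mem_insert_self b m.toFinset)]
  have h2 : ∏ i ∈ (insert b m.toFinset).erase b, ((b ::ₘ m).count i).factorial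
      = ∏ i ∈ (insert b m.toFinset).erase b, (m.count i).factorial := by
    refine Finset.prod_congr rfl fun i hi => ?_
    rw [Multiset.count_cons_of_ne (Finset.ne_of_mem_erase hi)]
  rw [h2, Multiset.count_cons_self, Nat.factorial_succ, Multiset.map_cons, Multiset.prod_cons]
  have h3 := (count_prod_pos m ((insert b m.toFinset).erase b)).ne'
  have h4 := Nat.factorial_ne_zero (m.count b)
  push_cast
  have h3' : (∏ i ∈ (insert b m.toFinset).erase b, ((m.count i).factorial : ℝ)) ≠ 0 := by
    exact_mod_cast h3
  have h4' : ((m.count b).factorial : ℝ) ≠ 0 := by exact_mod_cast h4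
  have h5 : (m.count b : ℝ) + 1 ≠ 0 := by positivity
  field_simp

lemma wt_singleton (x : ℕ → ℝ) (b : ℕ) : wt x {b} = x b := by simp [wt]

lemma wt_add_le {x : ℕ → ℝ} {m₁ m₂ : Multiset ℕ} (h₁ : ∀ b ∈ m₁, 0 ≤ x b)
    (h₂ : ∀ b ∈ m₂, 0 ≤ x b) : wt x (m₁ + m₂) ≤ wt x m₁ * wt x m₂ := by
  unfold wt
  set s := (m₁ + m₂).toFinset
  rw [count_prod_eq m₁ s (by simp [s]), count_prod_eq m₂ s (by simp [s]), div_mul_div_comm,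
    Multiset.map_add, Multiset.prod_add, ← Nat.cast_mul, ← Finset.prod_mul_distrib]
  refine div_le_div_of_nonneg_left ?_ ?_ ?_
  · refine mul_nonneg (Multiset.prod_nonneg ?_) (Multiset.prod_nonneg ?_)
    · simpa using h₁
    · simpa using h₂
  · exact_mod_cast Finset.prod_pos fun _ _ =>
      Nat.mul_pos (Nat.factorial_pos _) (Nat.factorial_pos _)
  · refine Nat.cast_le.2 (Finset.prod_le_prod' fun b _ => ?_)
    rw [Multiset.count_add]
    exact Nat.le_of_dvd (Nat.factorial_pos _) (Nat.factorial_mul_factorial_dvd_factorial_add _ _)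

lemma wt_add_of_disjoint (x : ℕ → ℝ) {m₁ m₂ : Multiset ℕ} (h : ∀ b ∈ m₁, b ∉ m₂) :
    wt x (m₁ + m₂) = wt x m₁ * wt x m₂ := by
  unfold wt
  set s := (m₁ + m₂).toFinset
  rw [count_prod_eq m₁ s (by simp [s]), count_prod_eq m₂ s (by simp [s]), div_mul_div_comm,
    Multiset.map_add, Multiset.prod_add, ← Nat.cast_mul, ← Finset.prod_mul_distrib]
  congr 2
  refine Finset.prod_congr rfl fun b _ => ?_
  rw [Multiset.count_add]
  by_cases hb : b ∈ m₁
  · rw [Multiset.count_eq_zero_of_notMem (h b hb)]; simp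
  · rw [Multiset.count_eq_zero_of_notMem hb]; simp

lemma sum_count_wt (x : ℕ → ℝ) (S S' : Finset (Multiset ℕ)) (b : ℕ)
    (h : ∀ m, m ∈ S' ↔ b ::ₘ m ∈ S) (G : Multiset ℕ → ℝ) :
    ∑ m ∈ S, (m.count b : ℝ) * wt x m * G m = x b * ∑ m ∈ S', wt x m * G (b ::ₘ m) := by
  have h1 : ∑ m ∈ S, (m.count b : ℝ) * wt x m * G m
      = ∑ m ∈ S.filter (fun m => b ∈ m), (m.count b : ℝ) * wt x m * G m := by
    rw [Finset.sum_filter]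
    refine Finset.sum_congr rfl fun m _ => ?_
    split_ifs with hb
    · rfl
    · rw [Multiset.count_eq_zero_of_notMem hb]; simp
  rw [h1, Finset.mul_sum]
  symm
  refine Finset.sum_bij (fun m _ => b ::ₘ m) ?_ ?_ ?_ ?_
  · intro m hm
    simpa using (h m).1 hm
  · intro m _ m' _ hmm
    exact (Multiset.cons_inj_right b).1 hmm
  · intro m hm
    rw [Finset.mem_filter] at hm
    refine ⟨m.erase b, ?_, Multiset.cons_erase hm.2⟩
    rw [h, Multiset.cons_erase hm.2]
    exact hm.1
  · intro m _
    rw [wt_cons]; ring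

lemma sum_piFinset_succ (s : Finset ℕ) (r : ℕ) (F : (Fin (r + 1) → ℕ) → ℝ) :
    ∑ a ∈ Fintype.piFinset (fun _ : Fin (r + 1) => s), F a
      = ∑ b ∈ s, ∑ a ∈ Fintype.piFinset (fun _ : Fin r => s), F (Fin.cons b a) := by
  rw [← Finset.sum_product']
  symm
  refine Finset.sum_bij' (fun p _ => Fin.cons p.1 p.2) (fun a _ => (a 0, Fin.tail a)) ?_ ?_ ?_ ?_ ?_
  · rintro ⟨b, a⟩ h
    simp only [Finset.mem_product, Fintype.mem_piFinset] at h ⊢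
    intro i
    refine Fin.cases ?_ (fun i => ?_) i
    · simpa using h.1
    · simpa using h.2 i
  · intro a h
    simp only [Finset.mem_product, Fintype.mem_piFinset] at h ⊢
    exact ⟨h 0, fun i => h i.succ⟩
  · rintro ⟨b, a⟩ h; simp
  · intro a h; simp
  · rintro ⟨b, a⟩ h; rfl

/-- Summing over words is the same as summing over multisets with multinomial weights. -/
lemma sum_words (x : ℕ → ℝ) (s : Finset ℕ) (r : ℕ) (G : Multiset ℕ → ℝ) :
    ∑ a ∈ Fintype.piFinset (fun _ : Fin r => s), (∏ t, x (a t)) * G (Finset.univ.val.map a)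
      = r.factorial * ∑ m ∈ Ms s r, wt x m * G m := by
  induction r generalizing G with
  | zero =>
    rw [Ms_zero]
    simp [wt_zero]
  | succ r ih =>
    rw [sum_piFinset_succ]
    have h1 : ∀ b ∈ s, ∑ a ∈ Fintype.piFinset (fun _ : Fin r => s),
        (∏ t, x ((Fin.cons b a : Fin (r + 1) → ℕ) t)) *
          G (Finset.univ.val.map (Fin.cons b a : Fin (r + 1) → ℕ))
        = r.factorial * ∑ m ∈ Ms s (r + 1), (m.count b : ℝ) * wt x m * G m := by
      intro b hb
      rw [sum_count_wt x _ _ b (cons_mem_Ms hb), mul_left_comm, ← ih, Finset.mul_sum]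
      refine Finset.sum_congr rfl fun a _ => ?_
      rw [Fin.prod_univ_succ, Fin.univ_succ]
      simp [mul_assoc, Function.comp_def]
    rw [Finset.sum_congr rfl h1, ← Finset.mul_sum, Finset.sum_comm, Nat.factorial_succ]
    push_cast
    rw [mul_comm ((r : ℝ) + 1), mul_assoc, Finset.mul_sum (a := (r : ℝ) + 1)]
    congr 1
    refine Finset.sum_congr rfl fun m hm => ?_
    rw [mem_Ms] at hm
    rw [← Finset.sum_mul, ← Finset.sum_mul, ← Nat.cast_sum,
      Multiset.sum_count_eq_card (fun b hb => hm.2 b hb), hm.1]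
    push_cast; ring

lemma sum_Ms_union {s t : Finset ℕ} (hst : Disjoint s t) (r : ℕ) (F : Multiset ℕ → ℝ) :
    ∑ m ∈ Ms (s ∪ t) r, F m
      = ∑ y ∈ Finset.range (r + 1), ∑ m₁ ∈ Ms t y, ∑ m₂ ∈ Ms s (r - y), F (m₂ + m₁) := by
  simp_rw [← Finset.sum_product']
  rw [Finset.sum_sigma']
  have hd : ∀ b ∈ s, b ∉ t := fun b hb hb' => Finset.disjoint_left.1 hst hb hb'
  refine Finset.sum_bij' (fun m _ => ⟨Multiset.card (m.filter (· ∈ t)),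
      (m.filter (· ∈ t), m.filter (· ∉ t))⟩) (fun q _ => q.2.2 + q.2.1) ?_ ?_ ?_ ?_ ?_
  · intro m hm
    simp only [mem_Ms, Finset.mem_union, Finset.mem_sigma, Finset.mem_product, Finset.mem_range,
      Multiset.mem_filter] at *
    have h1 := congrArg Multiset.card (Multiset.filter_add_not (· ∈ t) m)
    rw [Multiset.card_add] at h1
    refine ⟨by omega, ⟨trivial, fun b hb => hb.2⟩, by omega, fun b hb => ?_⟩
    exact (hm.2 b hb.1).resolve_right hb.2
  · rintro ⟨y, m₁, m₂⟩ h
    simp only [mem_Ms, Finset.mem_union, Finset.mem_sigma, Finset.mem_product, Finset.mem_range,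
      Multiset.mem_add, Multiset.card_add] at *
    refine ⟨by omega, fun b hb => ?_⟩
    rcases hb with hb | hb
    · exact Or.inl (h.2.2.2 b hb)
    · exact Or.inr (h.2.1.2 b hb)
  · intro m hm
    simp only
    rw [add_comm, Multiset.filter_add_not]
  · rintro ⟨y, m₁, m₂⟩ h
    simp only [mem_Ms, Finset.mem_sigma, Finset.mem_product, Finset.mem_range] at h
    have e1 : (m₂ + m₁).filter (· ∈ t) = m₁ := by
      rw [Multiset.filter_add, Multiset.filter_eq_nil.2 fun b hb => hd b (h.2.2.2 b hb),
        Multiset.filter_eq_self.2 fun b hb => h.2.1.2 b hb, zero_add]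
    have e2 : (m₂ + m₁).filter (· ∉ t) = m₂ := by
      rw [Multiset.filter_add, Multiset.filter_eq_self.2 fun b hb => hd b (h.2.2.2 b hb),
        Multiset.filter_eq_nil.2 fun b hb => not_not.2 (h.2.1.2 b hb), add_zero]
    simp only [e1, e2]
    rw [h.2.1.1]
  · intro m hm
    simp only
    rw [add_comm, Multiset.filter_add_not]

lemma Ms_singleton (v y : ℕ) : Ms {v} y = {Multiset.replicate y v} := by
  ext m
  simp only [mem_Ms, Finset.mem_singleton]
  rw [Multiset.eq_replicate]

lemma wt_replicate (x : ℕ → ℝ) (v y : ℕ) :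
    wt x (Multiset.replicate y v) = x v ^ y / y.factorial := by
  unfold wt
  rw [count_prod_eq _ {v} (by
    intro b hb
    rw [Multiset.mem_toFinset] at hb
    simpa using Multiset.eq_of_mem_replicate hb)]
  simp

lemma sum_Ms_range_succ (x : ℕ → ℝ) (v r : ℕ) (G : Multiset ℕ → ℝ) :
    ∑ m ∈ Ms (Finset.range (v + 1)) r, wt x m * G m
      = ∑ y ∈ Finset.range (r + 1), x v ^ y / y.factorial *
          ∑ m ∈ Ms (Finset.range v) (r - y), wt x m * G (m + Multiset.replicate y v) := by
  rw [Finset.range_add_one, ← Finset.union_singleton, sum_Ms_union (by simp)]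
  refine Finset.sum_congr rfl fun y _ => ?_
  rw [Ms_singleton, Finset.sum_singleton, Finset.mul_sum]
  refine Finset.sum_congr rfl fun m hm => ?_
  rw [wt_add_of_disjoint, wt_replicate]
  · ring
  · intro b hb hb'
    rw [mem_Ms] at hm
    have h1 := hm.2 b hb
    rw [Multiset.eq_of_mem_replicate hb'] at h1
    simp at h1

/-- The number of elements of `p` below `j`. -/
def cumul (p : Multiset ℕ) (j : ℕ) : ℕ := Multiset.card (p.filter (· < j))

/-- The walk with cumulative counts `cumul p` stays below the barrier `j ↦ j + M`. -/
def Below (M v : ℕ) (p : Multiset ℕ) : Prop := ∀ j ≤ v, cumul p j ≤ j + M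

lemma cumul_eq_card {p : Multiset ℕ} {v : ℕ} (h : ∀ b ∈ p, b < v) :
    cumul p v = Multiset.card p := by
  unfold cumul
  rw [Multiset.filter_eq_self.2 h]

lemma cumul_add_replicate {m : Multiset ℕ} {v y j : ℕ} (hj : j ≤ v) :
    cumul (m + Multiset.replicate y v) j = cumul m j := by
  unfold cumul
  have h : (Multiset.replicate y v).filter (· < j) = 0 := by
    refine Multiset.filter_eq_nil.2 fun b hb => ?_
    rw [Multiset.eq_of_mem_replicate hb]
    omega
  rw [Multiset.filter_add, h, add_zero]

lemma below_add_replicate {m : Multiset ℕ} {v y r M : ℕ} (hm : m ∈ Ms (Finset.range v) (r - y))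
    (hy : y ≤ r) : Below M (v + 1) (m + Multiset.replicate y v) ↔ Below M v m ∧ r ≤ v + 1 + M := by
  simp only [mem_Ms, Finset.mem_range] at hm
  have h1 : cumul (m + Multiset.replicate y v) (v + 1) = r := by
    rw [cumul_eq_card, Multiset.card_add, Multiset.card_replicate, hm.1]
    · omega
    · intro b hb
      rcases Multiset.mem_add.1 hb with hb | hb
      · exact (hm.2 b hb).trans (Nat.lt_succ_self v)
      · rw [Multiset.eq_of_mem_replicate hb]; exact Nat.lt_succ_self v
  constructor
  · intro h
    refine ⟨fun j hj => ?_, ?_⟩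
    · rw [← cumul_add_replicate hj]; exact h j (by omega)
    · rw [← h1]; exact h (v + 1) le_rfl
  · rintro ⟨h, hr⟩ j hj
    rcases Nat.lt_or_ge v j with hj' | hj'
    · obtain rfl : j = v + 1 := by omega
      omega
    · rw [cumul_add_replicate hj']; exact h j hj'

/-- Total weight of the walks of `v` steps, with total count `r`, below the barrier at
height `M`. -/
def Zrec : ℕ → ℕ → ℕ → ℝ
  | 0, r, _ => if r = 0 then 1 else 0
  | v + 1, r, M => if r ≤ v + 1 + M then
      ∑ y ∈ Finset.range (r + 1), (1 / (y.factorial : ℝ)) * Zrec v (r - y) M else 0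

lemma Zrec_nonneg (v r M : ℕ) : 0 ≤ Zrec v r M := by
  induction v generalizing r with
  | zero => simp only [Zrec]; split_ifs <;> norm_num
  | succ v ih =>
    simp only [Zrec]
    split_ifs
    · exact Finset.sum_nonneg fun y _ => mul_nonneg (by positivity) (ih _)
    · exact le_rfl

open Classical in
lemma sum_below_eq (v r M : ℕ) :
    ∑ p ∈ Ms (Finset.range v) r, wt (fun _ => 1) p * (if Below M v p then 1 else 0)
      = Zrec v r M := by
  induction v generalizing r with
  | zero =>
    simp only [Zrec]
    rcases Nat.eq_zero_or_pos r with rfl | hr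
    · rw [Ms_zero]
      simp [wt_zero, Below, cumul]
    · rw [if_neg hr.ne']
      refine Finset.sum_eq_zero fun p hp => ?_
      simp only [mem_Ms, Finset.range_zero, Finset.notMem_empty] at hp
      rw [Multiset.eq_zero_of_forall_notMem hp.2] at hp
      simp at hp
      omega
  | succ v ih =>
    rw [sum_Ms_range_succ]
    simp only [Zrec]
    split_ifs with h
    · refine Finset.sum_congr rfl fun y hy => ?_
      rw [one_pow, ← ih]
      congr 1
      refine Finset.sum_congr rfl fun p hp => ?_
      rw [below_add_replicate hp (by simpa [Nat.lt_succ_iff] using hy)]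
      simp [h]
    · refine Finset.sum_eq_zero fun y hy => ?_
      rw [Finset.sum_eq_zero, mul_zero]
      intro p hp
      rw [below_add_replicate hp (by simpa [Nat.lt_succ_iff] using hy)]
      simp [h]

open Classical in
lemma sum_below_cumul_le_aux (j u r s M : ℕ) (hs : s ≤ M + j) :
    ∑ p ∈ Ms (Finset.range (j + u)) r,
        wt (fun _ => 1) p * (if Below M (j + u) p ∧ cumul p j = s then 1 else 0)
      ≤ if s ≤ r then Zrec j s M * Zrec u (r - s) (M + j - s) else 0 := by
  induction u generalizing r with
  | zero =>
    rw [add_zero]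
    by_cases hrs : r = s
    · subst hrs
      rw [if_pos le_rfl, ← sum_below_eq j r M]
      simp only [Zrec, Nat.sub_self, if_true, mul_one]
      refine Finset.sum_le_sum fun p _ => mul_le_mul_of_nonneg_left ?_
        (wt_nonneg fun _ _ => zero_le_one)
      split_ifs with h1 h2 h2
      · exact le_rfl
      · exact absurd h1.1 h2
      · exact zero_le_one
      · exact le_rfl
    · rw [Finset.sum_eq_zero]
      · split_ifs
        · exact mul_nonneg (Zrec_nonneg _ _ _) (Zrec_nonneg _ _ _)
        · exact le_rfl
      · intro p hp
        simp only [mem_Ms, Finset.mem_range] at hp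
        rw [if_neg, mul_zero]
        rintro ⟨_, h⟩
        rw [cumul_eq_card hp.2] at h
        omega
  | succ u ih =>
    rw [← add_assoc, sum_Ms_range_succ]
    by_cases hr : r ≤ j + u + 1 + M
    · have h1 : ∀ y ∈ Finset.range (r + 1), (1 : ℝ) ^ y / y.factorial *
          ∑ p ∈ Ms (Finset.range (j + u)) (r - y), wt (fun _ => 1) p *
            (if Below M (j + u + 1) (p + Multiset.replicate y (j + u)) ∧
              cumul (p + Multiset.replicate y (j + u)) j = s then 1 else 0)
          ≤ (1 / (y.factorial : ℝ)) * if s ≤ r - y then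
              Zrec j s M * Zrec u (r - y - s) (M + j - s) else 0 := by
        intro y hy
        rw [one_pow]
        refine mul_le_mul_of_nonneg_left ?_ (by positivity)
        refine le_trans (le_of_eq ?_) (ih (r - y))
        refine Finset.sum_congr rfl fun p hp => ?_
        rw [below_add_replicate hp (by simpa [Nat.lt_succ_iff] using hy),
          cumul_add_replicate (by omega)]
        simp [hr]
      refine (Finset.sum_le_sum h1).trans ?_
      split_ifs with hsr
      · simp only [Zrec]
        rw [if_pos (by omega), Finset.mul_sum]
        have h2 : Finset.range (r - s + 1) ⊆ Finset.range (r + 1) :=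
          Finset.range_subset_range.2 (by omega)
        rw [← Finset.sum_subset h2]
        · refine le_of_eq (Finset.sum_congr rfl fun y hy => ?_)
          rw [Finset.mem_range] at hy
          rw [if_pos (by omega), show r - y - s = r - s - y by omega]
          ring
        · intro y hy hy'
          rw [Finset.mem_range] at hy hy'
          rw [if_neg (by omega), mul_zero]
      · refine le_of_eq (Finset.sum_eq_zero fun y hy => ?_)
        rw [if_neg (by omega), mul_zero]
    · rw [Finset.sum_eq_zero]
      · split_ifs
        · exact mul_nonneg (Zrec_nonneg _ _ _) (Zrec_nonneg _ _ _)
        · exact le_rfl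
      · intro y hy
        rw [Finset.sum_eq_zero, mul_zero]
        intro p hp
        rw [below_add_replicate hp (by simpa [Nat.lt_succ_iff] using hy)]
        simp [hr]

open Classical in
lemma sum_below_cumul_le {j v r s M : ℕ} (hj : j ≤ v) (hs : s ≤ M + j) :
    ∑ p ∈ Ms (Finset.range v) r,
        wt (fun _ => 1) p * (if Below M v p ∧ cumul p j = s then 1 else 0)
      ≤ Zrec j s M * Zrec (v - j) (r - s) (M + j - s) := by
  obtain ⟨u, rfl⟩ := Nat.exists_eq_add_of_le hj
  refine (sum_below_cumul_le_aux j u r s M hs).trans ?_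
  rw [Nat.add_sub_cancel_left]
  split_ifs
  · exact le_rfl
  · exact mul_nonneg (Zrec_nonneg _ _ _) (Zrec_nonneg _ _ _)

/-- The decay rate `(n + 1)^(-3/2)`. -/
def rho (n : ℕ) : ℝ := ((n : ℝ) + 1) ^ (-(3 / 2) : ℝ)

lemma rho_pos (n : ℕ) : 0 < rho n := by unfold rho; positivity

lemma rpow_neg_three_halves {x : ℝ} (hx : 0 < x) : x ^ (-(3 / 2) : ℝ) = 1 / (x * √x) := by
  rw [Real.rpow_neg hx.le, one_div, show (3 / 2 : ℝ) = 1 + 1 / 2 by norm_num, Real.rpow_add hx,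
    Real.rpow_one, Real.sqrt_eq_rpow]

lemma pow_self_le_factorial {n : ℕ} (hn : n ≠ 0) :
    (n : ℝ) ^ n / n.factorial ≤ Real.exp n / √n := by
  have h := Stirling.le_factorial_stirling n
  have hn' : (0 : ℝ) < n := by positivity
  have h1 : √(n : ℝ) ≤ √(2 * Real.pi * n) := Real.sqrt_le_sqrt (by nlinarith [Real.pi_gt_three])
  have h2 : √(n : ℝ) * (n / Real.exp 1) ^ n ≤ n.factorial :=
    (mul_le_mul_of_nonneg_right h1 (by positivity)).trans h
  rw [div_pow, ← Real.exp_nat_mul, mul_one, mul_div_assoc', div_le_iff₀ (Real.exp_pos _)] at h2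
  rw [div_le_div_iff₀ (by positivity) (by positivity)]
  linarith

lemma factorial_le_pow_self {n : ℕ} (hn : n ≠ 0) :
    Real.exp n / (Real.exp 1 * √n) ≤ (n : ℝ) ^ n / n.factorial := by
  obtain ⟨k, rfl⟩ := Nat.exists_eq_succ_of_ne_zero hn
  have h := Stirling.stirlingSeq'_antitone (Nat.zero_le k)
  simp only [Function.comp_apply, Nat.succ_eq_add_one, zero_add, Stirling.stirlingSeq_one] at h
  unfold Stirling.stirlingSeq at h
  have hn' : (0 : ℝ) < (k + 1 : ℕ) := by positivity
  simp only [Nat.succ_eq_add_one]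
  set n : ℕ := k + 1
  rw [div_le_div_iff₀ (by positivity) (by positivity), Real.sqrt_mul (by norm_num), div_pow,
    ← Real.exp_nat_mul, mul_one] at h
  have h2 : (0 : ℝ) < √2 := by positivity
  have h3 : (n.factorial : ℝ) ≤ Real.exp 1 * (√n * ((n : ℝ) ^ n / Real.exp n)) := by
    nlinarith
  rw [div_le_div_iff₀ (by positivity) (by positivity)]
  have h4 : Real.exp 1 * (√n * ((n : ℝ) ^ n / Real.exp n)) * Real.exp n
      = (n : ℝ) ^ n * (Real.exp 1 * √n) := by
    field_simp
  nlinarith [Real.exp_pos (n : ℝ)]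

lemma sum_choose_mul (n : ℝ) (N : ℕ) :
    (n + 1) * ∑ y ∈ Finset.range (N + 1), (N.choose y : ℝ) * (n - N + y) * n ^ (N - y)
      = n * (n + 1 - N) * (n + 1) ^ N := by
  have h0 : ∀ K : ℕ, ∑ y ∈ Finset.range (K + 1), (K.choose y : ℝ) * n ^ (K - y) = (n + 1) ^ K := by
    intro K
    rw [add_comm n 1, add_pow]
    refine Finset.sum_congr rfl fun y _ => ?_
    ring
  have h1 : (n + 1) * ∑ y ∈ Finset.range (N + 1), (N.choose y : ℝ) * y * n ^ (N - y)
      = N * (n + 1) ^ N := by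
    cases N with
    | zero => simp
    | succ K =>
      rw [Finset.sum_range_succ']
      simp only [Nat.cast_zero, mul_zero, zero_mul, add_zero, Nat.add_sub_add_right]
      have : ∀ y ∈ Finset.range (K + 1), ((K + 1).choose (y + 1) : ℝ) * ((y + 1 : ℕ) : ℝ) * n ^ (K - y)
          = ((K : ℝ) + 1) * ((K.choose y : ℝ) * n ^ (K - y)) := by
        intro y _
        have := Nat.add_one_mul_choose_eq K y
        have h' : ((K : ℝ) + 1) * (K.choose y : ℝ) = ((K + 1).choose (y + 1) : ℝ) * ((y + 1 : ℕ) : ℝ) := by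
          exact_mod_cast this
        rw [← h']; ring
      rw [Finset.sum_congr rfl this, ← Finset.mul_sum, h0]
      push_cast; ring
  have h2 : ∑ y ∈ Finset.range (N + 1), (N.choose y : ℝ) * (n - N + y) * n ^ (N - y)
      = (n - N) * ∑ y ∈ Finset.range (N + 1), (N.choose y : ℝ) * n ^ (N - y)
        + ∑ y ∈ Finset.range (N + 1), (N.choose y : ℝ) * y * n ^ (N - y) := by
    rw [Finset.mul_sum, ← Finset.sum_add_distrib]
    refine Finset.sum_congr rfl fun y _ => ?_
    ring
  rw [h2, mul_add, h1, h0]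
  ring

/-- The Abel-type polynomials `(n - N) n^(N-1) / N!`. -/
def abelPoly (n : ℝ) (N : ℕ) : ℝ := (n - N) * n ^ N / (n * N.factorial)

lemma abelPoly_nonneg {n : ℝ} (hn : 0 ≤ n) {N : ℕ} (h : (N : ℝ) ≤ n) : 0 ≤ abelPoly n N := by
  unfold abelPoly
  have : 0 ≤ n - N := by linarith
  positivity

lemma sum_abelPoly {n : ℝ} (hn : 0 < n) (N : ℕ) :
    ∑ y ∈ Finset.range (N + 1), (1 / (y.factorial : ℝ)) * abelPoly n (N - y)
      = abelPoly (n + 1) N := by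
  have h1 : ∀ y ∈ Finset.range (N + 1), (1 / (y.factorial : ℝ)) * abelPoly n (N - y)
      = (1 / (n * N.factorial)) * ((N.choose y : ℝ) * (n - N + y) * n ^ (N - y)) := by
    intro y hy
    have hy' : y ≤ N := by simpa [Nat.lt_succ_iff] using hy
    unfold abelPoly
    rw [Nat.cast_choose ℝ hy', Nat.cast_sub hy']
    have := Nat.factorial_ne_zero
    field_simp
    ring
  rw [Finset.sum_congr rfl h1, ← Finset.mul_sum]
  have h2 := sum_choose_mul n N
  unfold abelPoly
  have h3 : ∑ y ∈ Finset.range (N + 1), (N.choose y : ℝ) * (n - N + y) * n ^ (N - y)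
      = n * (n + 1 - N) * (n + 1) ^ N / (n + 1) := by
    rw [← h2]; field_simp
  rw [h3]
  field_simp

lemma Zrec_mul_le (M A v r : ℕ) (hr : r ≤ v + M + 1) :
    Zrec v r M * abelPoly ((M + 1 + A : ℕ) : ℝ) A ≤ abelPoly ((v + (M + 1 + A) : ℕ) : ℝ) (r + A) := by
  induction v generalizing r with
  | zero =>
    simp only [Zrec, zero_add]
    split_ifs with h
    · subst h; simp
    · rw [zero_mul]
      exact abelPoly_nonneg (by positivity) (by exact_mod_cast (by omega))
  | succ v ih =>
    simp only [Zrec]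
    split_ifs with h
    · have hpos : (0 : ℝ) < ((v + (M + 1 + A) : ℕ) : ℝ) := by
        exact_mod_cast (by omega : 0 < v + (M + 1 + A))
      have h1 := sum_abelPoly hpos (r + A)
      rw [show ((v + 1 + (M + 1 + A) : ℕ) : ℝ) = ((v + (M + 1 + A) : ℕ) : ℝ) + 1 by
        push_cast; ring, ← h1, Finset.sum_mul]
      have hsub : Finset.range (r + 1) ⊆ Finset.range (r + A + 1) :=
        Finset.range_subset_range.2 (by omega)
      refine le_trans (Finset.sum_le_sum fun y hy => ?_)
        (Finset.sum_le_sum_of_subset_of_nonneg hsub fun y hy hy' => ?_)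
      · rw [Finset.mem_range] at hy
        rw [mul_assoc, show r + A - y = r - y + A by omega]
        exact mul_le_mul_of_nonneg_left (ih (r - y) (by omega)) (by positivity)
      · rw [Finset.mem_range] at hy hy'
        exact mul_nonneg (by positivity)
          (abelPoly_nonneg hpos.le (by exact_mod_cast (by omega)))
    · rw [zero_mul]
      exact abelPoly_nonneg (by positivity) (by exact_mod_cast (by omega))

lemma Zrec_zero_barrier (v r : ℕ) (hr : r ≤ v + 1) : Zrec v r 0 = abelPoly ((v + 1 : ℕ) : ℝ) r := by
  induction v generalizing r with
  | zero =>
    simp only [Zrec, zero_add]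
    split_ifs with h
    · subst h; simp [abelPoly]
    · obtain rfl : r = 1 := by omega
      simp [abelPoly]
  | succ v ih =>
    simp only [Zrec]
    split_ifs with h
    · have hpos : (0 : ℝ) < ((v + 1 : ℕ) : ℝ) := by positivity
      rw [show ((v + 1 + 1 : ℕ) : ℝ) = ((v + 1 : ℕ) : ℝ) + 1 by push_cast; ring,
        ← sum_abelPoly hpos r]
      refine Finset.sum_congr rfl fun y hy => ?_
      rw [ih _ (by omega)]
    · obtain rfl : r = v + 1 + 1 := by omega
      simp [abelPoly]

lemma le_Zrec (v : ℕ) : Real.exp v * rho v ≤ Zrec v v 0 := by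
  rw [Zrec_zero_barrier v v (by omega)]
  have h := factorial_le_pow_self (Nat.succ_ne_zero v)
  have hp : (0 : ℝ) < (v : ℝ) + 1 := by positivity
  unfold abelPoly rho
  rw [rpow_neg_three_halves hp]
  simp only [Nat.succ_eq_add_one] at h
  have e : Real.exp ((v + 1 : ℕ) : ℝ) = Real.exp v * Real.exp 1 := by
    push_cast; rw [Real.exp_add]
  rw [e, Nat.factorial_succ] at h
  push_cast at h ⊢
  have hs : 0 < √((v : ℝ) + 1) := Real.sqrt_pos.2 hp
  calc Real.exp v * (1 / (((v : ℝ) + 1) * √((v : ℝ) + 1)))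
      = (Real.exp v * Real.exp 1 / (Real.exp 1 * √((v : ℝ) + 1))) / ((v : ℝ) + 1) := by
        field_simp
    _ ≤ (((v : ℝ) + 1) ^ (v + 1) / (((v : ℝ) + 1) * (v.factorial : ℝ))) / ((v : ℝ) + 1) := by
        gcongr
    _ = _ := by
        rw [pow_succ]; field_simp; ring

lemma abelPoly_le {n a N : ℕ} (hn : n ≠ 0) (h : N + a = n) :
    abelPoly n N ≤ a * Real.exp n * (n : ℝ) ^ (-(3 / 2) : ℝ) := by
  have hn' : (0 : ℝ) < n := by positivity
  have hs : 0 < √(n : ℝ) := Real.sqrt_pos.2 hn'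
  rw [rpow_neg_three_halves hn']
  have h1 := pow_self_le_factorial hn
  have h2 : (n.factorial : ℝ) * (n : ℝ) ^ N ≤ (n : ℝ) ^ n * N.factorial := by
    have h3 := Nat.factorial_mul_descFactorial (n := n) (k := a) (by omega)
    have h4 := Nat.descFactorial_le_pow n a
    rw [show n - a = N by omega] at h3
    have : n.factorial * n ^ N ≤ n ^ n * N.factorial := by
      calc n.factorial * n ^ N = N.factorial * n.descFactorial a * n ^ N := by rw [h3]
        _ ≤ N.factorial * n ^ a * n ^ N := by gcongr
        _ = n ^ n * N.factorial := by
          conv_rhs => rw [← h, pow_add, h]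
          ring
    exact_mod_cast this
  unfold abelPoly
  have h5 : (n : ℝ) - N = a := by rw [← h]; push_cast; ring
  rw [h5]
  calc (a : ℝ) * (n : ℝ) ^ N / (n * N.factorial)
      ≤ a * ((n : ℝ) ^ n / n.factorial) / n := by
        rw [mul_div_assoc', div_div, div_le_div_iff₀ (by positivity) (by positivity)]
        calc (a : ℝ) * (n : ℝ) ^ N * (n.factorial * n) = a * n * (n.factorial * (n : ℝ) ^ N) := by ring
          _ ≤ a * n * ((n : ℝ) ^ n * N.factorial) := by gcongr
          _ = _ := by ring
    _ ≤ a * (Real.exp n / √n) / n := by gcongr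
    _ = _ := by field_simp

lemma le_abelPoly {a : ℕ} (ha : a ≠ 0) :
    Real.exp ((2 * a ^ 2 : ℕ) : ℝ) / (8 * Real.exp 1 * a ^ 2) ≤
      abelPoly ((2 * a ^ 2 : ℕ) : ℝ) (2 * a ^ 2 - a) := by
  have ha' : (1 : ℝ) ≤ a := by exact_mod_cast Nat.one_le_iff_ne_zero.2 ha
  obtain ⟨m, hm⟩ : ∃ m, m = 2 * a ^ 2 := ⟨_, rfl⟩
  rw [← hm]
  have ham : a ≤ m := by rw [hm]; nlinarith [Nat.one_le_iff_ne_zero.2 ha]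
  have hm0 : m ≠ 0 := by omega
  have hm' : (0 : ℝ) < m := by positivity
  have hmr : (m : ℝ) = 2 * a ^ 2 := by rw [hm]; push_cast; ring
  have h1 := factorial_le_pow_self hm0
  have h2 : (m : ℝ) ^ a ≤ 2 * m.descFactorial a := by
    have h3 : (((m + 1 - a) ^ a : ℕ) : ℝ) ≤ m.descFactorial a :=
      Nat.cast_le.2 (Nat.pow_sub_le_descFactorial m a)
    rw [Nat.cast_pow, Nat.cast_sub (by omega)] at h3
    have h4 := one_add_mul_le_pow (a := -((a : ℝ) - 1) / m) (by
      rw [neg_div, neg_le_neg_iff, div_le_iff₀ hm']; nlinarith) a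
    have h5 : (1 / 2 : ℝ) ≤ 1 + a * (-((a : ℝ) - 1) / m) := by
      rw [hmr]
      have : (a : ℝ) * (-((a : ℝ) - 1) / (2 * a ^ 2)) = -(1 / 2) + 1 / (2 * a) := by
        field_simp; ring
      rw [this]
      have : (0 : ℝ) ≤ 1 / (2 * a) := by positivity
      linarith
    have h6 : ((m : ℝ) + 1 - a) ^ a = m ^ a * (1 + -((a : ℝ) - 1) / m) ^ a := by
      rw [← mul_pow]; congr 1; field_simp; ring
    push_cast at h3
    rw [h6] at h3
    have h7 : (m : ℝ) ^ a * (1 / 2) ≤ m ^ a * (1 + -((a : ℝ) - 1) / m) ^ a :=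
      mul_le_mul_of_nonneg_left (h5.trans h4) (by positivity)
    linarith
  obtain ⟨N, hN⟩ : ∃ N, N = m - a := ⟨_, rfl⟩
  rw [← hN]
  have h8 : (m : ℝ) ^ m * N.factorial ≤ 2 * (m.factorial * (m : ℝ) ^ N) := by
    have h9 : (N.factorial : ℝ) * m.descFactorial a = m.factorial := by
      rw [hN]; exact_mod_cast Nat.factorial_mul_descFactorial ham
    rw [← h9]
    have : (m : ℝ) ^ m = m ^ a * m ^ N := by rw [← pow_add]; congr 1; omega
    rw [this]
    calc (m : ℝ) ^ a * m ^ N * N.factorial ≤ (2 * m.descFactorial a) * m ^ N * N.factorial := by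
          gcongr
      _ = _ := by ring
  unfold abelPoly
  have h10 : (m : ℝ) - N = a := by rw [hN, Nat.cast_sub ham]; ring
  rw [h10]
  have hs : √(m : ℝ) ≤ 2 * a := by
    rw [Real.sqrt_le_iff]
    exact ⟨by positivity, by rw [hmr]; nlinarith⟩
  have hs0 : 0 < √(m : ℝ) := Real.sqrt_pos.2 hm'
  calc Real.exp m / (8 * Real.exp 1 * a ^ 2)
      = a * (Real.exp m / (Real.exp 1 * (2 * a))) / (2 * m) := by
        rw [hmr]; field_simp; ring
    _ ≤ a * (Real.exp m / (Real.exp 1 * √m)) / (2 * m) := by gcongr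
    _ ≤ a * ((m : ℝ) ^ m / m.factorial) / (2 * m) := by gcongr
    _ ≤ _ := by
        rw [mul_div_assoc', div_div, div_le_div_iff₀ (by positivity) (by positivity)]
        calc (a : ℝ) * (m : ℝ) ^ m * (m * N.factorial) = a * m * ((m : ℝ) ^ m * N.factorial) := by ring
          _ ≤ a * m * (2 * (m.factorial * (m : ℝ) ^ N)) := by gcongr
          _ = _ := by ring

lemma Zrec_le {v r M d : ℕ} (h : r + d = v + M) :
    Zrec v r M ≤ 24 * ((M : ℝ) + 1) ^ 2 * (d + 1) * Real.exp v * rho v := by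
  obtain ⟨a, ha⟩ : ∃ a, a = M + 1 := ⟨_, rfl⟩
  have ha0 : a ≠ 0 := by omega
  obtain ⟨m, hm⟩ : ∃ m, m = 2 * a ^ 2 := ⟨_, rfl⟩
  have ham : a ≤ m := by rw [hm]; nlinarith [Nat.one_le_iff_ne_zero.2 ha0]
  have h1 := Zrec_mul_le M (m - a) v r (by omega)
  rw [show M + 1 + (m - a) = m by omega] at h1
  have h2 := le_abelPoly ha0
  rw [← hm] at h2
  have h3 := abelPoly_le (n := v + m) (a := d + 1) (N := r + (m - a)) (by omega) (by omega)
  have h4 : ((v + m : ℕ) : ℝ) ^ (-(3 / 2) : ℝ) ≤ rho v := by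
    unfold rho
    refine Real.rpow_le_rpow_of_nonpos (by positivity) ?_ (by norm_num)
    push_cast
    have : (1 : ℝ) ≤ m := by exact_mod_cast (by omega : 1 ≤ m)
    linarith
  have h5 : Zrec v r M * (Real.exp m / (8 * Real.exp 1 * a ^ 2))
      ≤ (d + 1) * Real.exp (v + m : ℕ) * rho v := by
    calc Zrec v r M * (Real.exp m / (8 * Real.exp 1 * a ^ 2))
        ≤ Zrec v r M * abelPoly m (m - a) := mul_le_mul_of_nonneg_left h2 (Zrec_nonneg _ _ _)
      _ ≤ _ := h1
      _ ≤ _ := h3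
      _ ≤ _ := by push_cast; gcongr; exact_mod_cast h4
  have ha' : (0 : ℝ) < a := by positivity
  have har : (a : ℝ) = M + 1 := by rw [ha]; push_cast; ring
  rw [← har]
  have he : Real.exp 1 ≤ 3 := by linarith [Real.exp_one_lt_d9]
  push_cast at h5
  rw [mul_div_assoc', div_le_iff₀ (by positivity), Real.exp_add] at h5
  have hem := Real.exp_pos (m : ℝ)
  have h6 : Zrec v r M ≤ (d + 1) * Real.exp v * rho v * (8 * Real.exp 1 * a ^ 2) := by
    refine le_of_mul_le_mul_right ?_ hem
    calc _ ≤ _ := h5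
      _ = _ := by ring
  refine h6.trans ?_
  have := rho_pos v
  have h7 : (d + 1) * Real.exp v * rho v * (8 * Real.exp 1 * a ^ 2)
      ≤ (d + 1) * Real.exp v * rho v * (8 * 3 * a ^ 2) := by gcongr
  refine h7.trans (le_of_eq (by ring))

lemma sum_pow_mul_geometric_le (k : ℕ) {t : ℝ} (h0 : 0 < t) (h1 : t < 1) :
    ∃ C : ℝ, 0 < C ∧ ∀ N : ℕ, ∑ n ∈ Finset.range N, ((n : ℝ) + 2) ^ k * t ^ n ≤ C := by
  have hs := summable_pow_mul_geometric_of_norm_lt_one (R := ℝ) k (r := t)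
    (by rwa [Real.norm_of_nonneg h0.le])
  have hs2 := ((summable_nat_add_iff 2).2 hs).mul_left (t ^ 2)⁻¹
  have he : (fun n : ℕ => (t ^ 2)⁻¹ * (((n + 2 : ℕ) : ℝ) ^ k * t ^ (n + 2)))
      = fun n : ℕ => ((n : ℝ) + 2) ^ k * t ^ n := by
    funext n
    push_cast
    rw [pow_add]
    field_simp
  rw [he] at hs2
  refine ⟨(∑' n : ℕ, ((n : ℝ) + 2) ^ k * t ^ n) + 1, ?_, fun N => ?_⟩
  · have : 0 ≤ ∑' n : ℕ, ((n : ℝ) + 2) ^ k * t ^ n := tsum_nonneg fun n => by positivity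
    linarith
  · have := hs2.sum_le_tsum (Finset.range N) fun n _ => by positivity
    linarith

lemma rho_le_rho {m n : ℕ} (h : m ≤ n) : rho n ≤ rho m := by
  unfold rho
  refine Real.rpow_le_rpow_of_nonpos (by positivity) ?_ (by norm_num)
  have : (m : ℝ) ≤ n := by exact_mod_cast h
  linarith

lemma rho_le_mul {m n : ℕ} (h : n ≤ 2 * m + 1) : rho m ≤ 4 * rho n := by
  unfold rho
  have h1 : ((n : ℝ) + 1) / 2 ≤ m + 1 := by
    have : (n : ℝ) ≤ 2 * m + 1 := by exact_mod_cast h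
    linarith
  have h2 := Real.rpow_le_rpow_of_nonpos (z := (-(3 / 2) : ℝ)) (by positivity) h1 (by norm_num)
  refine h2.trans ?_
  rw [Real.div_rpow (by positivity) (by norm_num), div_eq_mul_inv, mul_comm]
  refine mul_le_mul_of_nonneg_right ?_ (by positivity)
  rw [← Real.rpow_neg (by norm_num), neg_neg]
  calc (2 : ℝ) ^ (3 / 2 : ℝ) ≤ 2 ^ (2 : ℝ) :=
        Real.rpow_le_rpow_of_exponent_le (by norm_num) (by norm_num)
    _ = 4 := by norm_num

lemma sum_rho_mul_rho_le : ∃ C : ℝ, 0 < C ∧ ∀ v : ℕ,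
    ∑ j ∈ Finset.range (v + 1), rho j * rho (v - j) ≤ C * rho v := by
  have hs : Summable rho := by
    have h := (summable_nat_add_iff 1).2
      ((Real.summable_nat_rpow (p := (-(3 / 2) : ℝ))).2 (by norm_num))
    refine h.congr fun n => ?_
    unfold rho
    push_cast
    rfl
  refine ⟨8 * (∑' n, rho n + 1), ?_, fun v => ?_⟩
  · have : 0 ≤ ∑' n, rho n := tsum_nonneg fun n => (rho_pos n).le
    positivity
  · have h1 : ∀ j ∈ Finset.range (v + 1),
        rho j * rho (v - j) ≤ 4 * rho v * rho j + 4 * rho v * rho (v - j) := by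
      intro j hj
      rw [Finset.mem_range] at hj
      have p1 := rho_pos j
      have p2 := rho_pos (v - j)
      have p3 := rho_pos v
      rcases le_total (2 * j) v with h | h
      · have : rho (v - j) ≤ 4 * rho v := rho_le_mul (by omega)
        nlinarith [mul_pos p3 p2]
      · have : rho j ≤ 4 * rho v := rho_le_mul (by omega)
        nlinarith [mul_pos p3 p1]
    refine (Finset.sum_le_sum h1).trans ?_
    rw [Finset.sum_add_distrib, ← Finset.mul_sum, ← Finset.mul_sum]
    have h2 : ∑ j ∈ Finset.range (v + 1), rho (v - j) = ∑ j ∈ Finset.range (v + 1), rho j := by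
      rw [← Finset.sum_range_reflect]
      refine Finset.sum_congr rfl fun j hj => ?_
      rw [Finset.mem_range] at hj
      congr 1
      omega
    rw [h2]
    have h3 := hs.sum_le_tsum (Finset.range (v + 1)) fun n _ => (rho_pos n).le
    have p3 := rho_pos v
    nlinarith

lemma cumul_cons_of_lt {b j : ℕ} (h : b < j) (p : Multiset ℕ) :
    cumul (b ::ₘ p) j = cumul p j + 1 := by
  unfold cumul
  rw [Multiset.filter_cons_of_pos (p := (· < j)) _ h, Multiset.card_cons]

lemma cumul_le_cumul_cons (b j : ℕ) (p : Multiset ℕ) : cumul p j ≤ cumul (b ::ₘ p) j :=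
  Multiset.card_le_card (Multiset.filter_le_filter _ (Multiset.le_cons_self p b))

lemma cumul_le_card (p : Multiset ℕ) (j : ℕ) : cumul p j ≤ Multiset.card p :=
  Multiset.card_le_card (Multiset.filter_le _ p)

lemma Below.of_cons {M v b : ℕ} {p : Multiset ℕ} (h : Below M v (b ::ₘ p)) : Below M v p :=
  fun j hj => (cumul_le_cumul_cons b j p).trans (h j hj)

lemma Below.card_le {M v r : ℕ} {p : Multiset ℕ} (h : Below M v p)
    (hp : p ∈ Ms (Finset.range v) r) :
    r ≤ v + M := by
  simp only [mem_Ms, Finset.mem_range] at hp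
  rw [← hp.1, ← cumul_eq_card hp.2]
  exact h v le_rfl

lemma exists_below (v : ℕ) (p : Multiset ℕ) :
    ∃ j ≤ v, ∃ M, Below M v p ∧ cumul p j = j + M := by
  obtain ⟨j, hj, hmax⟩ := Finset.exists_max_image (Finset.range (v + 1))
    (fun j => (cumul p j : ℤ) - j) ⟨0, by simp⟩
  simp only [Finset.mem_range, Nat.lt_succ_iff] at hj hmax
  have h0 := hmax 0 (Nat.zero_le _)
  have hc : cumul p 0 = 0 := by simp [cumul]
  rw [hc] at h0
  refine ⟨j, hj, cumul p j - j, fun i hi => ?_, by omega⟩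
  have := hmax i hi
  omega

/-- A bound for the number of subset sums in terms of the profile `p`, truncating at block `j`. -/
def cost (p : Multiset ℕ) (j : ℕ) : ℝ :=
  2 ^ Multiset.card p / 2 ^ cumul p j * (1 + ∑ b ∈ Finset.range j, (p.count b : ℝ) * 2 ^ (b + 1))

lemma cost_nonneg (p : Multiset ℕ) (j : ℕ) : 0 ≤ cost p j := by
  unfold cost; positivity

open Classical in
lemma sum_wt_hit_le {v j M r D : ℕ} (hj : j ≤ v) (hr : r + D = v + M) (hjr : j + M ≤ r) :
    ∑ p ∈ Ms (Finset.range v) r, wt (fun _ => 1) p *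
      (if Below M v p ∧ cumul p j = j + M then 1 else 0)
      ≤ 576 * (((M : ℝ) + 1) ^ 2 * (D + 2) * Real.exp v * (rho j * rho (v - j))) := by
  refine (sum_below_cumul_le hj (by omega)).trans ?_
  rw [show M + j - (j + M) = 0 by omega]
  have h1 := Zrec_le (v := j) (r := j + M) (M := M) (d := 0) (by omega)
  have h2 := Zrec_le (v := v - j) (r := r - (j + M)) (M := 0) (d := D) (by omega)
  refine (mul_le_mul h1 h2 (Zrec_nonneg _ _ _) ((Zrec_nonneg _ _ _).trans h1)).trans ?_
  have e : Real.exp v = Real.exp j * Real.exp ((v - j : ℕ) : ℝ) := by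
    rw [← Real.exp_add, ← Nat.cast_add]; congr 2; omega
  rw [e]
  have p1 := rho_pos j
  have p2 := rho_pos (v - j)
  have p3 := Real.exp_pos (j : ℝ)
  have p4 := Real.exp_pos ((v - j : ℕ) : ℝ)
  have key : 0 ≤ ((M : ℝ) + 1) ^ 2 * (Real.exp j * Real.exp ((v - j : ℕ) : ℝ)) * (rho j * rho (v - j)) := by
    positivity
  push_cast
  nlinarith [key]

open Classical in
lemma sum_count_wt_hit_le {v j M r D b : ℕ} (hb : b < j) (hj : j ≤ v) (hr : r + D = v + M)
    (hjr : j + M ≤ r) :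
    ∑ p ∈ Ms (Finset.range v) r, (p.count b : ℝ) * wt (fun _ => 1) p *
      (if Below M v p ∧ cumul p j = j + M then 1 else 0)
      ≤ 4608 * (((M : ℝ) + 1) ^ 2 * (D + 2) * Real.exp v * (rho j * rho (v - j))) := by
  obtain ⟨r, rfl⟩ : ∃ k, r = k + 1 := ⟨r - 1, by omega⟩
  rw [sum_count_wt (fun _ => 1) _ _ b (cons_mem_Ms (by simpa using hb.trans_le hj)), one_mul]
  have h0 : ∑ p ∈ Ms (Finset.range v) r, wt (fun _ => 1) p *
      (if Below M v (b ::ₘ p) ∧ cumul (b ::ₘ p) j = j + M then (1 : ℝ) else 0)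
      ≤ ∑ p ∈ Ms (Finset.range v) r, wt (fun _ => 1) p *
      (if Below M v p ∧ cumul p j = j + M - 1 then 1 else 0) := by
    refine Finset.sum_le_sum fun p _ => mul_le_mul_of_nonneg_left ?_
      (wt_nonneg fun _ _ => zero_le_one)
    rw [cumul_cons_of_lt hb]
    split_ifs with h1 h2 h2
    · exact le_rfl
    · exact absurd ⟨h1.1.of_cons, by omega⟩ h2
    · exact zero_le_one
    · exact le_rfl
  refine h0.trans ((sum_below_cumul_le hj (by omega)).trans ?_)
  rw [show M + j - (j + M - 1) = 1 by omega]
  have h1 := Zrec_le (v := j) (r := j + M - 1) (M := M) (d := 1) (by omega)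
  have h2 := Zrec_le (v := v - j) (r := r - (j + M - 1)) (M := 1) (d := D + 1) (by omega)
  refine (mul_le_mul h1 h2 (Zrec_nonneg _ _ _) ((Zrec_nonneg _ _ _).trans h1)).trans (le_of_eq ?_)
  have e : Real.exp v = Real.exp j * Real.exp ((v - j : ℕ) : ℝ) := by
    rw [← Real.exp_add, ← Nat.cast_add]; congr 2; omega
  rw [e]
  push_cast
  ring

open Classical in
lemma sum_wt_cost_le {v j M r D : ℕ} (hj : j ≤ v) (hr : r + D = v + M) :
    ∑ p ∈ Ms (Finset.range v) r, wt (fun _ => 1) p *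
      ((if Below M v p ∧ cumul p j = j + M then 1 else 0) * cost p j)
      ≤ 10000 * (2 ^ r * (1 / 2) ^ M *
        (((M : ℝ) + 1) ^ 2 * (D + 2) * Real.exp v * (rho j * rho (v - j)))) := by
  have p1 := rho_pos j
  have p2 := rho_pos (v - j)
  set K := ((M : ℝ) + 1) ^ 2 * (D + 2) * Real.exp v * (rho j * rho (v - j)) with hK
  have hK0 : 0 ≤ K := by positivity
  by_cases hjr : j + M ≤ r
  · have h1 : ∀ p ∈ Ms (Finset.range v) r, wt (fun _ => 1) p *
        ((if Below M v p ∧ cumul p j = j + M then 1 else 0) * cost p j)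
        = 2 ^ r / 2 ^ (j + M) * (wt (fun _ => 1) p *
          (if Below M v p ∧ cumul p j = j + M then 1 else 0) +
          ∑ b ∈ Finset.range j, 2 ^ (b + 1) * ((p.count b : ℝ) * wt (fun _ => 1) p *
          (if Below M v p ∧ cumul p j = j + M then 1 else 0))) := by
      intro p hp
      rw [mem_Ms] at hp
      split_ifs with h
      · unfold cost
        rw [h.2, hp.1, one_mul]
        have e : ∑ b ∈ Finset.range j, 2 ^ (b + 1) * ((p.count b : ℝ) * wt (fun _ => 1) p * 1)
            = wt (fun _ => 1) p * ∑ b ∈ Finset.range j, (p.count b : ℝ) * 2 ^ (b + 1) := by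
          rw [Finset.mul_sum]
          refine Finset.sum_congr rfl fun b _ => ?_
          ring
        rw [e]
        ring
      · simp
    rw [Finset.sum_congr rfl h1, ← Finset.mul_sum, Finset.sum_add_distrib, Finset.sum_comm]
    simp_rw [← Finset.mul_sum]
    have h2 := sum_wt_hit_le hj hr hjr
    have h3 : ∑ b ∈ Finset.range j, (2 : ℝ) ^ (b + 1) * ∑ p ∈ Ms (Finset.range v) r,
        (p.count b : ℝ) * wt (fun _ => 1) p *
          (if Below M v p ∧ cumul p j = j + M then 1 else 0)
        ≤ ∑ b ∈ Finset.range j, (2 : ℝ) ^ (b + 1) * (4608 * K) := by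
      refine Finset.sum_le_sum fun b hb => mul_le_mul_of_nonneg_left ?_ (by positivity)
      exact sum_count_wt_hit_le (Finset.mem_range.1 hb) hj hr hjr
    rw [← Finset.sum_mul] at h3
    have h4 : ∑ b ∈ Finset.range j, (2 : ℝ) ^ (b + 1) ≤ 2 * 2 ^ j := by
      have := geom_sum_eq (x := (2 : ℝ)) (by norm_num) j
      simp_rw [pow_succ]
      rw [← Finset.sum_mul, this]
      have : (0 : ℝ) < 2 ^ j := by positivity
      linarith
    have h5 : (1 : ℝ) ≤ 2 ^ j := one_le_pow₀ (by norm_num)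
    calc _ ≤ (2 : ℝ) ^ r / 2 ^ (j + M) * (576 * K + 2 * 2 ^ j * (4608 * K)) := by
          refine mul_le_mul_of_nonneg_left (add_le_add h2 (h3.trans ?_)) (by positivity)
          exact mul_le_mul_of_nonneg_right h4 (by positivity)
      _ ≤ (2 : ℝ) ^ r / 2 ^ (j + M) * (2 ^ j * (10000 * K)) := by
          refine mul_le_mul_of_nonneg_left ?_ (by positivity)
          nlinarith
      _ = _ := by
          rw [pow_add, one_div, inv_pow]
          field_simp
  · rw [Finset.sum_eq_zero]
    · positivity
    · intro p hp
      rw [if_neg, zero_mul, mul_zero]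
      rintro ⟨_, h⟩
      have := cumul_le_card p j
      rw [mem_Ms] at hp
      omega

lemma log_two_bounds : (0.69 : ℝ) < Real.log 2 ∧ Real.log 2 < 0.7 :=
  ⟨by linarith [Real.log_two_gt_d9], by linarith [Real.log_two_lt_d9]⟩

/-- Upper bound for the total cost over all profiles. -/
theorem sum_profile_le : ∃ C : ℝ, 0 < C ∧ ∀ (v R : ℕ) (U : Multiset ℕ → ℝ),
    (∀ p, ∀ j ≤ v, U p ≤ cost p j) →
    ∑ r ∈ Finset.range (R + 1), Real.log 2 ^ r *
      ∑ p ∈ Ms (Finset.range v) r, wt (fun _ => 1) p * U p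
      ≤ C * ((2 * (Real.exp 1 * Real.log 2)) ^ v * rho v) := by
  classical
  obtain ⟨hl1, hl2⟩ := log_two_bounds
  have hl0 : 0 < Real.log 2 := by linarith
  obtain ⟨C₁, hC₁, h₁⟩ := sum_pow_mul_geometric_le 1 (t := 1 / (2 * Real.log 2)) (by positivity)
    (by rw [div_lt_one (by positivity)]; linarith)
  obtain ⟨C₂, hC₂, h₂⟩ := sum_pow_mul_geometric_le 2 (t := Real.log 2) hl0 (by linarith)
  obtain ⟨C₃, hC₃, h₃⟩ := sum_rho_mul_rho_le
  refine ⟨10000 * C₁ * C₂ * C₃, by positivity, fun v R U hU => ?_⟩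
  have step1 : ∀ r ∈ Finset.range (R + 1), ∑ p ∈ Ms (Finset.range v) r, wt (fun _ => 1) p * U p
      ≤ ∑ j ∈ Finset.range (v + 1), ∑ M ∈ Finset.range (R + 1), ∑ p ∈ Ms (Finset.range v) r,
        wt (fun _ => 1) p * ((if Below M v p ∧ cumul p j = j + M then 1 else 0) * cost p j) := by
    intro r hr
    rw [Finset.mem_range] at hr
    simp_rw [fun j => Finset.sum_comm (s := Finset.range (R + 1)) (t := Ms (Finset.range v) r)
      (f := fun M p => wt (fun _ => 1) p *
        ((if Below M v p ∧ cumul p j = j + M then (1 : ℝ) else 0) * cost p j))]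
    rw [Finset.sum_comm]
    refine Finset.sum_le_sum fun p hp => ?_
    simp_rw [← Finset.mul_sum]
    refine mul_le_mul_of_nonneg_left ?_ (wt_nonneg fun _ _ => zero_le_one)
    obtain ⟨j, hj, M, hM, hjM⟩ := exists_below v p
    have hnn : ∀ j M, 0 ≤ (if Below M v p ∧ cumul p j = j + M then (1 : ℝ) else 0) * cost p j :=
      fun j M => mul_nonneg (by split_ifs <;> norm_num) (cost_nonneg _ _)
    have hMR : M < R + 1 := by
      have := cumul_le_card p j
      rw [mem_Ms] at hp
      omega
    calc U p ≤ cost p j := hU p j hj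
      _ = (if Below M v p ∧ cumul p j = j + M then (1 : ℝ) else 0) * cost p j := by
          rw [if_pos ⟨hM, hjM⟩, one_mul]
      _ ≤ ∑ M ∈ Finset.range (R + 1),
          (if Below M v p ∧ cumul p j = j + M then (1 : ℝ) else 0) * cost p j :=
          Finset.single_le_sum (f := fun M =>
            (if Below M v p ∧ cumul p j = j + M then (1 : ℝ) else 0) * cost p j)
            (fun M _ => hnn j M) (Finset.mem_range.2 hMR)
      _ ≤ _ := Finset.single_le_sum (f := fun j => ∑ M ∈ Finset.range (R + 1),
          (if Below M v p ∧ cumul p j = j + M then (1 : ℝ) else 0) * cost p j)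
          (fun j _ => Finset.sum_nonneg fun M _ => hnn j M) (Finset.mem_range.2 (by omega))
  have step2 : ∀ j ∈ Finset.range (v + 1), ∀ M ∈ Finset.range (R + 1),
      ∑ r ∈ Finset.range (R + 1), Real.log 2 ^ r * ∑ p ∈ Ms (Finset.range v) r,
        wt (fun _ => 1) p * ((if Below M v p ∧ cumul p j = j + M then 1 else 0) * cost p j)
      ≤ 10000 * C₁ * (2 * Real.log 2) ^ v * Real.exp v *
        (((M : ℝ) + 2) ^ 2 * Real.log 2 ^ M) * (rho j * rho (v - j)) := by
    intro j hj M _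
    have p1 := rho_pos j
    have p2 := rho_pos (v - j)
    rw [Finset.mem_range] at hj
    set f : ℕ → ℝ := fun r => Real.log 2 ^ r * ∑ p ∈ Ms (Finset.range v) r,
        wt (fun _ => 1) p * ((if Below M v p ∧ cumul p j = j + M then 1 else 0) * cost p j) with hf
    have hf0 : ∀ r, 0 ≤ f r := fun r => mul_nonneg (by positivity) <| Finset.sum_nonneg fun p _ =>
      mul_nonneg (wt_nonneg fun _ _ => zero_le_one)
        (mul_nonneg (by split_ifs <;> norm_num) (cost_nonneg _ _))
    have hf1 : ∀ r, v + M < r → f r = 0 := by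
      intro r hr
      simp only [hf]
      rw [Finset.sum_eq_zero, mul_zero]
      intro p hp
      rw [if_neg, zero_mul, mul_zero]
      rintro ⟨h, _⟩
      have := h.card_le hp
      omega
    have h4 : ∑ r ∈ Finset.range (R + 1), f r ≤ ∑ r ∈ Finset.range (v + M + 1), f r := by
      rw [← Finset.sum_filter_ne_zero]
      refine Finset.sum_le_sum_of_subset_of_nonneg (fun r hr => ?_) fun r _ _ => hf0 r
      rw [Finset.mem_filter] at hr
      rw [Finset.mem_range]
      by_contra h
      exact hr.2 (hf1 r (by omega))
    refine h4.trans ?_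
    rw [← Finset.sum_range_reflect]
    have h5 : ∀ D ∈ Finset.range (v + M + 1), f (v + M + 1 - 1 - D)
        ≤ (10000 * (2 * Real.log 2) ^ v * Real.exp v *
        (((M : ℝ) + 2) ^ 2 * Real.log 2 ^ M) * (rho j * rho (v - j))) *
          (((D : ℝ) + 2) ^ 1 * (1 / (2 * Real.log 2)) ^ D) := by
      intro D hD
      rw [Finset.mem_range] at hD
      obtain ⟨r, hr⟩ : ∃ r, r = v + M - D := ⟨_, rfl⟩
      rw [show v + M + 1 - 1 - D = r by omega]
      have hrD : r + D = v + M := by omega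
      have h6 := sum_wt_cost_le (j := j) (by omega) hrD
      calc f r ≤ Real.log 2 ^ r * (10000 * (2 ^ r * (1 / 2) ^ M *
            (((M : ℝ) + 1) ^ 2 * (D + 2) * Real.exp v * (rho j * rho (v - j))))) :=
            mul_le_mul_of_nonneg_left h6 (by positivity)
        _ ≤ Real.log 2 ^ r * (10000 * (2 ^ r * (1 / 2) ^ M *
            (((M : ℝ) + 2) ^ 2 * (D + 2) * Real.exp v * (rho j * rho (v - j))))) := by
            gcongr; norm_num
        _ = _ := by
            have e : (2 * Real.log 2) ^ r * (2 * Real.log 2) ^ D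
                = (2 * Real.log 2) ^ v * (2 * Real.log 2) ^ M := by
              rw [← pow_add, ← pow_add, hrD]
            have e2 : (2 * Real.log 2) ^ r
                = (2 * Real.log 2) ^ v * (2 * Real.log 2) ^ M * (1 / (2 * Real.log 2)) ^ D := by
              rw [← e, one_div, inv_pow]
              field_simp
            have e3 : (2 * Real.log 2) ^ M * (1 / 2) ^ M = Real.log 2 ^ M := by
              rw [← mul_pow]; congr 1; ring
            calc _ = (2 * Real.log 2) ^ r * (10000 * ((1 / 2) ^ M *
                (((M : ℝ) + 2) ^ 2 * (D + 2) * Real.exp v * (rho j * rho (v - j))))) := by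
                  rw [mul_pow]; ring
              _ = _ := by
                  rw [e2, ← e3]; ring
    refine (Finset.sum_le_sum h5).trans ?_
    rw [← Finset.mul_sum]
    refine (mul_le_mul_of_nonneg_left (h₁ _) (by positivity)).trans (le_of_eq ?_)
    ring
  calc _ ≤ ∑ r ∈ Finset.range (R + 1), Real.log 2 ^ r *
        ∑ j ∈ Finset.range (v + 1), ∑ M ∈ Finset.range (R + 1), ∑ p ∈ Ms (Finset.range v) r,
        wt (fun _ => 1) p * ((if Below M v p ∧ cumul p j = j + M then 1 else 0) * cost p j) :=
        Finset.sum_le_sum fun r hr => mul_le_mul_of_nonneg_left (step1 r hr) (by positivity)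
    _ = ∑ j ∈ Finset.range (v + 1), ∑ M ∈ Finset.range (R + 1), ∑ r ∈ Finset.range (R + 1),
        Real.log 2 ^ r * ∑ p ∈ Ms (Finset.range v) r,
        wt (fun _ => 1) p * ((if Below M v p ∧ cumul p j = j + M then 1 else 0) * cost p j) := by
        simp_rw [Finset.mul_sum (Finset.range (v + 1)), Finset.mul_sum (Finset.range (R + 1))]
        rw [Finset.sum_comm]
        refine Finset.sum_congr rfl fun j _ => ?_
        rw [Finset.sum_comm]
    _ ≤ ∑ j ∈ Finset.range (v + 1), ∑ M ∈ Finset.range (R + 1),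
        10000 * C₁ * (2 * Real.log 2) ^ v * Real.exp v *
        (((M : ℝ) + 2) ^ 2 * Real.log 2 ^ M) * (rho j * rho (v - j)) :=
        Finset.sum_le_sum fun j hj => Finset.sum_le_sum fun M hM => step2 j hj M hM
    _ = (10000 * C₁ * (2 * Real.log 2) ^ v * Real.exp v) *
        (∑ M ∈ Finset.range (R + 1), ((M : ℝ) + 2) ^ 2 * Real.log 2 ^ M) *
        ∑ j ∈ Finset.range (v + 1), rho j * rho (v - j) := by
        rw [Finset.mul_sum]
        refine Finset.sum_congr rfl fun j _ => ?_
        rw [Finset.mul_sum, Finset.sum_mul]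
    _ ≤ (10000 * C₁ * (2 * Real.log 2) ^ v * Real.exp v) * C₂ * (C₃ * rho v) := by
        have := rho_pos v
        refine mul_le_mul (mul_le_mul_of_nonneg_left (h₂ _) (by positivity)) (h₃ v)
          (Finset.sum_nonneg fun j _ => (mul_pos (rho_pos _) (rho_pos _)).le) (by positivity)
    _ = _ := by
        rw [show 2 * (Real.exp 1 * Real.log 2) = 2 * Real.log 2 * Real.exp 1 by ring,
          mul_pow _ (Real.exp 1), ← Real.exp_nat_mul, mul_one]
        ring

open Classical in
lemma sum_count_below_le {v b : ℕ} (hb : b < v) {C : ℝ}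
    (hC : ∀ N : ℕ, ∑ n ∈ Finset.range N, ((n : ℝ) + 2) ^ 3 * (1 / 2) ^ n ≤ C) :
    ∑ p ∈ Ms (Finset.range v) v, (p.count b : ℝ) * wt (fun _ => 1) p *
      (if Below 0 v p then (2 : ℝ) ^ cumul p (b + 1) / 2 ^ (b + 1) else 0)
      ≤ 1152 * C * Real.exp v * (rho (b + 1) * rho (v - (b + 1))) := by
  obtain ⟨r, hr⟩ : ∃ r, v = r + 1 := ⟨v - 1, by omega⟩
  have hcons := sum_count_wt (fun _ => 1) (Ms (Finset.range v) (r + 1)) (Ms (Finset.range v) r) b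
    (cons_mem_Ms (by simpa using hb))
    (fun p => if Below 0 v p then (2 : ℝ) ^ cumul p (b + 1) / 2 ^ (b + 1) else 0)
  rw [← hr, one_mul] at hcons
  rw [hcons]
  set j := b + 1 with hj
  have p1 := rho_pos j
  have p2 := rho_pos (v - j)
  have h0 : ∀ p ∈ Ms (Finset.range v) r, wt (fun _ => 1) p *
      (if Below 0 v (b ::ₘ p) then (2 : ℝ) ^ cumul (b ::ₘ p) j / 2 ^ j else 0)
      ≤ ∑ s ∈ Finset.range j, (2 : ℝ) ^ (s + 1) / 2 ^ j * (wt (fun _ => 1) p *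
        (if Below 0 v p ∧ cumul p j = s then 1 else 0)) := by
    intro p _
    have hw : 0 ≤ wt (fun _ => 1) p := wt_nonneg fun _ _ => zero_le_one
    have hnn : ∀ s, 0 ≤ (2 : ℝ) ^ (s + 1) / 2 ^ j * (wt (fun _ => 1) p *
        (if Below 0 v p ∧ cumul p j = s then 1 else 0)) := fun s => by
      split_ifs <;> positivity
    split_ifs with h
    · have h2 := h j (by omega)
      rw [cumul_cons_of_lt (by omega)] at h2 ⊢
      refine le_trans (le_of_eq ?_) (Finset.single_le_sum (f := fun s =>
        (2 : ℝ) ^ (s + 1) / 2 ^ j * (wt (fun _ => 1) p *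
        (if Below 0 v p ∧ cumul p j = s then 1 else 0))) (fun s _ => hnn s)
        (Finset.mem_range.2 (show cumul p j < j by omega)))
      simp only [h.of_cons, and_self, if_true]
      ring
    · rw [mul_zero]
      exact Finset.sum_nonneg fun s _ => hnn s
  refine (Finset.sum_le_sum h0).trans ?_
  rw [Finset.sum_comm]
  simp_rw [← Finset.mul_sum]
  rw [← Finset.sum_range_reflect]
  have h1 : ∀ i ∈ Finset.range j, (2 : ℝ) ^ (j - 1 - i + 1) / 2 ^ j *
      ∑ p ∈ Ms (Finset.range v) r, wt (fun _ => 1) p *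
        (if Below 0 v p ∧ cumul p j = j - 1 - i then 1 else 0)
      ≤ 1152 * Real.exp v * (rho j * rho (v - j)) * (((i : ℝ) + 2) ^ 3 * (1 / 2) ^ i) := by
    intro i hi
    rw [Finset.mem_range] at hi
    have h2 := sum_below_cumul_le (M := 0) (v := v) (j := j) (s := j - 1 - i) (r := r)
      (by omega) (by omega)
    have h3 := Zrec_le (v := j) (r := j - 1 - i) (M := 0) (d := i + 1) (by omega)
    have h4 := Zrec_le (v := v - j) (r := r - (j - 1 - i)) (M := 0 + j - (j - 1 - i)) (d := 1)
      (by omega)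
    have h5 := h2.trans (mul_le_mul h3 h4 (Zrec_nonneg _ _ _) ((Zrec_nonneg _ _ _).trans h3))
    have e : Real.exp v = Real.exp j * Real.exp ((v - j : ℕ) : ℝ) := by
      rw [← Real.exp_add, ← Nat.cast_add]; congr 2; omega
    have e2 : (2 : ℝ) ^ (j - 1 - i + 1) / 2 ^ j = (1 / 2) ^ i := by
      rw [one_div, inv_pow, div_eq_iff (by positivity), eq_comm, inv_mul_eq_iff_eq_mul₀
        (by positivity), ← pow_add]
      congr 1; omega
    have e3 : 0 + j - (j - 1 - i) = i + 1 := by omega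
    rw [e2]
    rw [e3] at h5
    refine (mul_le_mul_of_nonneg_left h5 (by positivity)).trans (le_of_eq ?_)
    rw [e]
    push_cast
    ring
  refine (Finset.sum_le_sum h1).trans ?_
  rw [← Finset.mul_sum]
  refine (mul_le_mul_of_nonneg_left (hC j) (by positivity)).trans (le_of_eq ?_)
  ring

open Classical in
/-- The average energy of the profiles staying below the diagonal. -/
theorem sum_below_energy_le : ∃ C : ℝ, 0 < C ∧ ∀ v : ℕ,
    ∑ p ∈ Ms (Finset.range v) v, wt (fun _ => 1) p * (if Below 0 v p then
      ∑ b ∈ Finset.range v, (p.count b : ℝ) * (2 ^ cumul p (b + 1) / 2 ^ (b + 1)) else 0)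
      ≤ C * (Real.exp v * rho v) := by
  obtain ⟨C₁, hC₁, h₁⟩ := sum_pow_mul_geometric_le 3 (t := 1 / 2) (by norm_num) (by norm_num)
  obtain ⟨C₂, hC₂, h₂⟩ := sum_rho_mul_rho_le
  refine ⟨1152 * C₁ * C₂, by positivity, fun v => ?_⟩
  have h : ∀ p ∈ Ms (Finset.range v) v, wt (fun _ => 1) p * (if Below 0 v p then
      ∑ b ∈ Finset.range v, (p.count b : ℝ) * (2 ^ cumul p (b + 1) / 2 ^ (b + 1)) else 0)
      = ∑ b ∈ Finset.range v, (p.count b : ℝ) * wt (fun _ => 1) p *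
      (if Below 0 v p then (2 : ℝ) ^ cumul p (b + 1) / 2 ^ (b + 1) else 0) := by
    intro p _
    split_ifs
    · rw [Finset.mul_sum]
      refine Finset.sum_congr rfl fun b _ => ?_
      ring
    · simp
  rw [Finset.sum_congr rfl h, Finset.sum_comm]
  refine (Finset.sum_le_sum fun b hb =>
    sum_count_below_le (Finset.mem_range.1 hb) h₁).trans ?_
  rw [← Finset.mul_sum]
  have h3 : ∑ b ∈ Finset.range v, rho (b + 1) * rho (v - (b + 1)) ≤ C₂ * rho v := by
    refine le_trans ?_ (h₂ v)
    rw [Finset.sum_range_succ']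
    have := mul_pos (rho_pos 0) (rho_pos (v - 0))
    linarith
  refine (mul_le_mul_of_nonneg_left h3 (by positivity)).trans (le_of_eq ?_)
  ring

/-- Grouping the elements of a multiset into blocks. -/
theorem sum_wt_map (x : ℕ → ℝ) (β : ℕ → ℕ) {s t : Finset ℕ} (h : ∀ b ∈ s, β b ∈ t) (r : ℕ)
    (G : Multiset ℕ → ℝ) :
    ∑ m ∈ Ms s r, wt x m * G (m.map β)
      = ∑ p ∈ Ms t r, wt (fun c => ∑ b ∈ s with β b = c, x b) p * G p := by
  have h0 : (r.factorial : ℝ) ≠ 0 := by exact_mod_cast r.factorial_ne_zero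
  refine mul_left_cancel₀ h0 ?_
  rw [← sum_words x s r (fun m => G (m.map β)), ← sum_words _ t r G]
  rw [← Finset.sum_fiberwise_of_maps_to (t := Fintype.piFinset (fun _ : Fin r => t))
    (g := fun a : Fin r → ℕ => fun i => β (a i))
    (fun a ha => by
      rw [Fintype.mem_piFinset] at ha ⊢
      exact fun i => h _ (ha i))]
  refine Finset.sum_congr rfl fun f _ => ?_
  rw [Finset.prod_univ_sum, Finset.sum_mul]
  refine Finset.sum_congr ?_ fun a ha => ?_
  · ext a
    simp only [Finset.mem_filter, Fintype.mem_piFinset, funext_iff]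
    exact forall_and.symm
  · simp only [Fintype.mem_piFinset, Finset.mem_filter] at ha
    congr 2
    rw [Multiset.map_map]
    exact Multiset.map_congr rfl fun i _ => (ha i).2

lemma wt_le_wt {x y : ℕ → ℝ} {m : Multiset ℕ} (h0 : ∀ b ∈ m, 0 ≤ x b) (h : ∀ b ∈ m, x b ≤ y b) :
    wt x m ≤ wt y m := by
  unfold wt
  refine div_le_div_of_nonneg_right ?_ (Nat.cast_nonneg _)
  exact Multiset.prod_map_le_prod_map₀ _ _ h0 h

lemma wt_const (c : ℝ) (m : Multiset ℕ) :
    wt (fun _ => c) m = c ^ Multiset.card m * wt (fun _ => 1) m := by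
  unfold wt
  simp [div_eq_mul_inv]

lemma card_subsums_add_le (m₁ m₂ : Multiset ℕ) :
    (subsums (m₁ + m₂)).card ≤ (subsums m₁).card * (subsums m₂).card := by
  rw [← Finset.card_product]
  refine (Finset.card_le_card (t := (subsums m₁ ×ˢ subsums m₂).image fun z => z.1 + z.2) ?_).trans
    Finset.card_image_le
  intro x hx
  rw [mem_subsums] at hx
  obtain ⟨t, ht, rfl⟩ := hx
  simp only [Finset.mem_image, Finset.mem_product, mem_subsums, Prod.exists]
  refine ⟨(t ∩ m₁).sum, (t - m₁).sum, ⟨⟨_, Multiset.inter_le_right, rfl⟩, _, ?_, rfl⟩, ?_⟩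
  · rw [tsub_le_iff_left]; exact ht
  · rw [← Multiset.sum_add, add_comm, Multiset.sub_add_inter]

lemma card_subsums_le_two_pow (m : Multiset ℕ) : (subsums m).card ≤ 2 ^ Multiset.card m := by
  refine (Multiset.toFinset_card_le _).trans ?_
  rw [Multiset.card_map, Multiset.card_powerset]

lemma le_sum_of_mem_subsums {m : Multiset ℕ} {x : ℕ} (h : x ∈ subsums m) : x ≤ m.sum := by
  rw [mem_subsums] at h
  obtain ⟨t, ht, rfl⟩ := h
  obtain ⟨u, rfl⟩ := Multiset.le_iff_exists_add.1 ht
  rw [Multiset.sum_add]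
  exact Nat.le_add_right _ _

lemma card_subsums_le_sum (m : Multiset ℕ) : (subsums m).card ≤ m.sum + 1 := by
  rw [← Finset.card_range (m.sum + 1)]
  refine Finset.card_le_card fun x hx => ?_
  rw [Finset.mem_range, Nat.lt_succ_iff]
  exact le_sum_of_mem_subsums hx

lemma card_subsums_le_cost {m : Multiset ℕ} {β : ℕ → ℕ} (h : ∀ b ∈ m, b ≤ 2 ^ (β b + 1)) (j : ℕ) :
    ((subsums m).card : ℝ) ≤ cost (m.map β) j := by
  set m₁ := m.filter (fun b => β b < j) with hm₁
  set m₂ := m.filter (fun b => ¬ β b < j) with hm₂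
  have hm : m₁ + m₂ = m := Multiset.filter_add_not _ m
  have hc : cumul (m.map β) j = Multiset.card m₁ := by
    unfold cumul
    rw [Multiset.filter_map, Multiset.card_map]
    rfl
  have hcard : Multiset.card m₁ + Multiset.card m₂ = Multiset.card m := by
    rw [← Multiset.card_add, hm]
  have hsum : (m₁.sum : ℝ) ≤ ∑ b ∈ Finset.range j, ((m.map β).count b : ℝ) * 2 ^ (b + 1) := by
    have h1 : m₁.sum ≤ (m₁.map (fun b => 2 ^ (β b + 1))).sum := by
      conv_lhs => rw [← Multiset.map_id m₁]
      exact Multiset.sum_map_le_sum_map _ _ fun b hb => h b (Multiset.mem_of_mem_filter hb)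
    have h2 : (m₁.map (fun b => 2 ^ (β b + 1))).sum
        = ∑ b ∈ Finset.range j, (m.map β).count b * 2 ^ (b + 1) := by
      have e : m₁.map (fun b => 2 ^ (β b + 1))
          = ((m.map β).filter (· < j)).map (fun b => 2 ^ (b + 1)) := by
        rw [Multiset.filter_map, Multiset.map_map]
        rfl
      rw [e, Finset.sum_multiset_map_count]
      have hsub : ((m.map β).filter (· < j)).toFinset ⊆ Finset.range j := by
        intro b hb
        rw [Multiset.mem_toFinset, Multiset.mem_filter] at hb
        exact Finset.mem_range.2 hb.2
      rw [Finset.sum_subset hsub]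
      · refine Finset.sum_congr rfl fun b hb => ?_
        rw [Multiset.count_filter_of_pos (p := (· < j)) (Finset.mem_range.1 hb), smul_eq_mul]
      · intro b _ hb
        rw [Multiset.mem_toFinset] at hb
        rw [Multiset.count_eq_zero_of_notMem hb, zero_smul]
    have h3 := h1.trans_eq h2
    exact_mod_cast h3
  have h4 : (subsums m).card ≤ (m₁.sum + 1) * 2 ^ Multiset.card m₂ := by
    conv_lhs => rw [← hm]
    exact (card_subsums_add_le _ _).trans
      (Nat.mul_le_mul (card_subsums_le_sum _) (card_subsums_le_two_pow _))
  have h5 : ((subsums m).card : ℝ) ≤ (m₁.sum + 1) * 2 ^ Multiset.card m₂ := by exact_mod_cast h4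
  refine h5.trans ?_
  unfold cost
  rw [hc, Multiset.card_map, ← hcard, pow_add, mul_div_assoc, mul_comm ((2 : ℝ) ^ _),
    div_mul_cancel₀ _ (by positivity), mul_comm]
  refine mul_le_mul_of_nonneg_left ?_ (by positivity)
  linarith

/-- The reciprocal weight, `∏ 1 / (b ^ c_b * c_b!)`. -/
def rwt (m : Multiset ℕ) : ℝ := wt (fun b => (b : ℝ)⁻¹) m

lemma rwt_nonneg (m : Multiset ℕ) : 0 ≤ rwt m := wt_nonneg fun _ _ => by positivity

/-- The weighted number of subset sums over multisets of at most `R` elements of `[1, J]`. -/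
def subsumMass (J R : ℕ) : ℝ := ∑ m ∈ MsLe (Finset.Icc 1 J) R, rwt m * (subsums m).card

lemma sum_inv_Ioc_le {a b : ℕ} (ha : 0 < a) (hab : a ≤ b) :
    ∑ i ∈ Finset.Ioc a b, (i : ℝ)⁻¹ ≤ Real.log b - Real.log a := by
  induction b, hab using Nat.le_induction with
  | base => simp
  | succ b hb ih =>
    rw [← Finset.insert_Ioc_right_eq_Ioc_add_one (by omega), Finset.sum_insert (by simp)]
    have hb0 : (0 : ℝ) < b := by exact_mod_cast ha.trans_le hb
    have h := Real.one_sub_inv_le_log_of_pos (x := ((b + 1 : ℕ) : ℝ) / b) (by positivity)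
    rw [Real.log_div (by positivity) (by positivity)] at h
    have e : 1 - (((b + 1 : ℕ) : ℝ) / b)⁻¹ = ((b + 1 : ℕ) : ℝ)⁻¹ := by
      push_cast
      field_simp
      ring
    rw [e] at h
    linarith

lemma sum_inv_block_le (v c : ℕ) :
    ∑ b ∈ Finset.Icc 2 (2 ^ v) with Nat.log 2 (b - 1) = c, (b : ℝ)⁻¹ ≤ Real.log 2 := by
  have h1 : (Finset.Icc 2 (2 ^ v)).filter (fun b => Nat.log 2 (b - 1) = c)
      ⊆ Finset.Ioc (2 ^ c) (2 ^ (c + 1)) := by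
    intro b hb
    simp only [Finset.mem_filter, Finset.mem_Icc] at hb
    obtain ⟨⟨h2, _⟩, rfl⟩ := hb
    have h3 := Nat.pow_log_le_self 2 (show b - 1 ≠ 0 by omega)
    have h4 := Nat.lt_pow_succ_log_self (b := 2) one_lt_two (b - 1)
    rw [Finset.mem_Ioc]
    omega
  refine (Finset.sum_le_sum_of_subset_of_nonneg h1 fun _ _ _ => by positivity).trans ?_
  refine (sum_inv_Ioc_le (by positivity) (Nat.pow_le_pow_right two_pos (by omega))).trans ?_
  push_cast
  rw [pow_succ, Real.log_mul (by positivity) (by positivity)]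
  linarith

lemma sum_MsLe_insert_le {a : ℕ} {s : Finset ℕ} {R : ℕ} {F : Multiset ℕ → ℝ}
    (hF : ∀ m, 0 ≤ F m) :
    ∑ m ∈ MsLe (insert a s) R, F m
      ≤ ∑ c ∈ Finset.range (R + 1), ∑ m ∈ MsLe s R, F (Multiset.replicate c a + m) := by
  have he : ∀ m : Multiset ℕ, Multiset.replicate (m.count a) a + m.filter (¬ a = ·) = m := by
    intro m
    rw [← Multiset.filter_eq]
    exact Multiset.filter_add_not _ m
  rw [← Finset.sum_product']
  have h1 : ∑ m ∈ MsLe (insert a s) R, F m = ∑ z ∈ (MsLe (insert a s) R).image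
      (fun m => (m.count a, m.filter (¬ a = ·))), F (Multiset.replicate z.1 a + z.2) := by
    rw [Finset.sum_image]
    · exact Finset.sum_congr rfl fun m _ => by rw [he]
    · intro m _ m' _ hmm
      simp only [Prod.mk.injEq] at hmm
      rw [← he m, ← he m', hmm.1, hmm.2]
  rw [h1]
  refine Finset.sum_le_sum_of_subset_of_nonneg ?_ fun _ _ _ => hF _
  intro z hz
  rw [Finset.mem_image] at hz
  obtain ⟨m, hm, rfl⟩ := hz
  rw [mem_MsLe] at hm
  simp only [Finset.mem_product, Finset.mem_range, mem_MsLe, Multiset.mem_filter]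
  refine ⟨?_, ?_, fun b hb => ?_⟩
  · have := Multiset.count_le_card a m
    omega
  · exact (Multiset.card_le_card (Multiset.filter_le _ _)).trans hm.1
  · exact Finset.mem_of_mem_insert_of_ne (hm.2 b hb.1) (Ne.symm hb.2)

lemma sum_Icc_two_le : ∃ C : ℝ, 0 < C ∧ ∀ v R : ℕ,
    ∑ m ∈ MsLe (Finset.Icc 2 (2 ^ v)) R, rwt m * (subsums m).card
      ≤ C * ((2 * (Real.exp 1 * Real.log 2)) ^ v * rho v) := by
  obtain ⟨C, hC, h⟩ := sum_profile_le
  refine ⟨C, hC, fun v R => ?_⟩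
  set U : Multiset ℕ → ℝ := fun p =>
    (Finset.range (v + 1)).inf' ⟨0, by simp⟩ (fun j => cost p j) with hU
  have hU0 : ∀ p, 0 ≤ U p := fun p => Finset.le_inf' _ _ fun j _ => cost_nonneg p j
  refine le_trans ?_ (h v R U fun p j hj => Finset.inf'_le _ (Finset.mem_range.2 (by omega)))
  rw [sum_MsLe_eq]
  refine Finset.sum_le_sum fun r _ => ?_
  set β : ℕ → ℕ := fun b => Nat.log 2 (b - 1) with hβ
  have h1 : ∑ m ∈ Ms (Finset.Icc 2 (2 ^ v)) r, rwt m * (subsums m).card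
      ≤ ∑ m ∈ Ms (Finset.Icc 2 (2 ^ v)) r, wt (fun b => (b : ℝ)⁻¹) m * U (m.map β) := by
    refine Finset.sum_le_sum fun m hm => mul_le_mul_of_nonneg_left ?_ (rwt_nonneg m)
    rw [mem_Ms] at hm
    refine Finset.le_inf' _ _ fun j _ => card_subsums_le_cost (fun b hb => ?_) j
    have := Nat.lt_pow_succ_log_self (b := 2) one_lt_two (b - 1)
    simp only [hβ]
    omega
  refine h1.trans ?_
  rw [sum_wt_map _ β (t := Finset.range v), Finset.mul_sum]
  · refine Finset.sum_le_sum fun p hp => ?_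
    rw [mem_Ms] at hp
    rw [← mul_assoc, ← hp.1, ← wt_const]
    refine mul_le_mul_of_nonneg_right (wt_le_wt (fun b _ => ?_) fun b _ => ?_) (hU0 p)
    · exact Finset.sum_nonneg fun _ _ => by positivity
    · exact sum_inv_block_le v b
  · intro b hb
    rw [Finset.mem_Icc] at hb
    rw [Finset.mem_range]
    exact Nat.log_lt_of_lt_pow (by omega) (by omega)

theorem subsumMass_le : ∃ C : ℝ, 0 < C ∧ ∀ v R : ℕ,
    subsumMass (2 ^ v) R ≤ C * ((2 * (Real.exp 1 * Real.log 2)) ^ v * rho v) := by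
  obtain ⟨C, hC, h⟩ := sum_Icc_two_le
  refine ⟨Real.exp 2 * C, by positivity, fun v R => ?_⟩
  unfold subsumMass
  have hI : Finset.Icc 1 (2 ^ v) = insert 1 (Finset.Icc 2 (2 ^ v)) := by
    ext b
    have := Nat.one_le_two_pow (n := v)
    simp only [Finset.mem_Icc, Finset.mem_insert]
    omega
  rw [hI]
  refine (sum_MsLe_insert_le fun m => mul_nonneg (rwt_nonneg m) (Nat.cast_nonneg _)).trans ?_
  have h1 : ∀ c ∈ Finset.range (R + 1), ∑ m ∈ MsLe (Finset.Icc 2 (2 ^ v)) R,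
      rwt (Multiset.replicate c 1 + m) * (subsums (Multiset.replicate c 1 + m)).card
      ≤ 2 ^ c / c.factorial * (C * ((2 * (Real.exp 1 * Real.log 2)) ^ v * rho v)) := by
    intro c _
    refine le_trans ?_ (mul_le_mul_of_nonneg_left (h v R) (by positivity))
    rw [Finset.mul_sum]
    refine Finset.sum_le_sum fun m _ => ?_
    have h2 : rwt (Multiset.replicate c 1 + m) ≤ 1 / c.factorial * rwt m := by
      refine (wt_add_le (fun _ _ => by positivity) fun _ _ => by positivity).trans ?_
      rw [wt_replicate]
      simp [rwt]
    have h3 : (subsums (Multiset.replicate c 1 + m)).card ≤ 2 ^ c * (subsums m).card := by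
      refine (card_subsums_add_le _ _).trans (Nat.mul_le_mul_right _ ?_)
      simpa using card_subsums_le_two_pow (Multiset.replicate c 1)
    have h4 : ((subsums (Multiset.replicate c 1 + m)).card : ℝ) ≤ 2 ^ c * (subsums m).card := by
      exact_mod_cast h3
    refine (mul_le_mul h2 h4 (Nat.cast_nonneg _) ?_).trans (le_of_eq ?_)
    · have := rwt_nonneg m
      positivity
    · ring
  refine (Finset.sum_le_sum h1).trans ?_
  rw [← Finset.sum_mul, mul_assoc]
  have hl : 0 < Real.log 2 := Real.log_pos one_lt_two
  have := rho_pos v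
  exact mul_le_mul_of_nonneg_right (Real.sum_le_exp_of_nonneg (by norm_num) _) (by positivity)

/-- The dyadic block `[2^c, 2^(c+1))`. -/
def block (c : ℕ) : Finset ℕ := Finset.Ico (2 ^ c) (2 ^ (c + 1))

/-- The harmonic mass of a dyadic block. -/
def blockMass (c : ℕ) : ℝ := ∑ b ∈ block c, (b : ℝ)⁻¹

lemma log_sub_log_le_sum_inv_Ico {a b : ℕ} (ha : 0 < a) (hab : a ≤ b) :
    Real.log b - Real.log a ≤ ∑ i ∈ Finset.Ico a b, (i : ℝ)⁻¹ := by
  induction b, hab using Nat.le_induction with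
  | base => simp
  | succ b hb ih =>
    rw [Finset.sum_Ico_succ_top hb]
    have hb0 : (0 : ℝ) < b := by exact_mod_cast ha.trans_le hb
    have h := Real.log_le_sub_one_of_pos (x := ((b + 1 : ℕ) : ℝ) / b) (by positivity)
    rw [Real.log_div (by positivity) (by positivity)] at h
    have e : ((b + 1 : ℕ) : ℝ) / b - 1 = (b : ℝ)⁻¹ := by
      push_cast
      field_simp
      ring
    rw [e] at h
    linarith

lemma log_two_le_blockMass (c : ℕ) : Real.log 2 ≤ blockMass c := by
  refine le_trans ?_ (log_sub_log_le_sum_inv_Ico (by positivity)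
    (Nat.pow_le_pow_right two_pos (by omega)))
  push_cast
  rw [pow_succ, Real.log_mul (by positivity) (by positivity)]
  linarith

lemma half_le_blockMass (c : ℕ) : 1 / 2 ≤ blockMass c := by
  linarith [log_two_le_blockMass c, log_two_bounds.1]

lemma blockMass_pos (c : ℕ) : 0 < blockMass c := by linarith [half_le_blockMass c]

lemma sum_prod_inv_block {ι : Type*} [Fintype ι] [DecidableEq ι] (f : ι → ℕ) :
    ∑ a ∈ Fintype.piFinset (fun i => block (f i)), ∏ i, (a i : ℝ)⁻¹ = ∏ i, blockMass (f i) := by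
  unfold blockMass
  rw [Finset.prod_univ_sum]

lemma sum_prod_inv_linear_eq_le {ι : Type*} [Fintype ι] [DecidableEq ι] (f : ι → ℕ) (ε : ι → ℤ)
    {t : ι} (ht : ε t ≠ 0) :
    ∑ a ∈ Fintype.piFinset (fun i => block (f i)) with ∑ i, ε i * (a i : ℤ) = 0,
      ∏ i, (a i : ℝ)⁻¹ ≤ 2 / 2 ^ f t * ∏ i, blockMass (f i) := by
  set A := (Fintype.piFinset (fun i => block (f i))).filter
    (fun a => ∑ i, ε i * (a i : ℤ) = 0) with hA
  set g : (ι → ℕ) → (ι → ℕ) := fun a => Function.update a t (2 ^ f t) with hg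
  have hmem : ∀ a ∈ A, ∀ i, 2 ^ f i ≤ a i ∧ a i < 2 ^ (f i + 1) := by
    intro a ha i
    rw [hA, Finset.mem_filter, Fintype.mem_piFinset] at ha
    simpa [block] using ha.1 i
  have h1 : ∀ a ∈ A, ∏ i, (a i : ℝ)⁻¹ ≤ ∏ i, (g a i : ℝ)⁻¹ := by
    intro a ha
    refine Finset.prod_le_prod (fun i _ => by positivity) fun i _ => ?_
    have h2 := (hmem a ha i).1
    have h3 : g a i ≤ a i ∧ 0 < g a i := by
      simp only [hg]
      by_cases hi : i = t
      · subst hi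
        simp [h2]
      · rw [Function.update_of_ne hi]
        exact ⟨le_rfl, (Nat.two_pow_pos _).trans_le h2⟩
    have h4 : (0 : ℝ) < g a i := by exact_mod_cast h3.2
    have h5 : (g a i : ℝ) ≤ a i := by exact_mod_cast h3.1
    exact inv_anti₀ h4 h5
  refine (Finset.sum_le_sum h1).trans ?_
  have hinj : Set.InjOn g A := by
    intro a ha a' ha' haa
    have hne : ∀ i, i ≠ t → a i = a' i := by
      intro i hi
      have := congrFun haa i
      simpa [hg, Function.update_of_ne hi] using this
    have e1 := (Finset.mem_filter.1 ha).2
    have e2 := (Finset.mem_filter.1 ha').2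
    have e3 : ∑ i, ε i * ((a i : ℤ) - a' i) = 0 := by
      simp only [mul_sub, Finset.sum_sub_distrib, e1, e2, sub_zero]
    rw [Finset.sum_eq_single t (fun i _ hi => by rw [hne i hi, sub_self, mul_zero])
      (fun h => absurd (Finset.mem_univ t) h)] at e3
    have e4 : a t = a' t := by
      rcases mul_eq_zero.1 e3 with h | h
      · exact absurd h ht
      · omega
    funext i
    by_cases hi : i = t
    · rw [hi, e4]
    · exact hne i hi
  rw [← Finset.sum_image (f := fun a : ι → ℕ => ∏ i, (a i : ℝ)⁻¹) hinj]
  have hsub : A.image g ⊆ Fintype.piFinset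
      (Function.update (fun i => block (f i)) t {2 ^ f t}) := by
    intro b hb
    rw [Finset.mem_image] at hb
    obtain ⟨a, ha, rfl⟩ := hb
    rw [Fintype.mem_piFinset]
    intro i
    by_cases hi : i = t
    · subst hi
      simp [hg]
    · simp only [hg, Function.update_of_ne hi]
      simpa [block] using hmem a ha i
  refine (Finset.sum_le_sum_of_subset_of_nonneg hsub fun _ _ _ =>
    Finset.prod_nonneg fun _ _ => by positivity).trans ?_
  rw [← Finset.prod_univ_sum (fun i => Function.update (fun i => block (f i)) t {2 ^ f t} i)
    (fun _ b => (b : ℝ)⁻¹)]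
  rw [← Finset.mul_prod_erase _ _ (Finset.mem_univ t), ← Finset.mul_prod_erase _ (fun i =>
    blockMass (f i)) (Finset.mem_univ t), Function.update_self, Finset.sum_singleton]
  have h6 : ∏ i ∈ Finset.univ.erase t,
      ∑ b ∈ Function.update (fun i => block (f i)) t {2 ^ f t} i, (b : ℝ)⁻¹
      = ∏ i ∈ Finset.univ.erase t, blockMass (f i) := by
    refine Finset.prod_congr rfl fun i hi => ?_
    rw [Function.update_of_ne (Finset.ne_of_mem_erase hi)]
    rfl
  rw [h6]
  have h7 : 0 ≤ ∏ i ∈ Finset.univ.erase t, blockMass (f i) :=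
    Finset.prod_nonneg fun i _ => (blockMass_pos _).le
  have h8 := half_le_blockMass (f t)
  rw [← mul_assoc]
  refine mul_le_mul_of_nonneg_right ?_ h7
  push_cast
  rw [div_mul_eq_mul_div, inv_eq_one_div]
  refine div_le_div_of_nonneg_right ?_ (by positivity)
  linarith

/-- The number of subsets with the same sum as `S`. -/
def repCount {ι : Type*} [Fintype ι] (a : ι → ℕ) (S : Finset ι) : ℝ :=
  ∑ S' : Finset ι, if ∑ i ∈ S', a i = ∑ i ∈ S, a i then 1 else 0

lemma sum_repCount_le {ι : Type*} [Fintype ι] [DecidableEq ι] (f : ι → ℕ) :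
    ∑ a ∈ Fintype.piFinset (fun i => block (f i)), ∑ S : Finset ι,
      (∏ i, (a i : ℝ)⁻¹) * repCount a S
      ≤ (∏ i, blockMass (f i)) * 2 ^ Fintype.card ι *
        (1 + 4 * ∑ t, (2 : ℝ) ^ (Finset.univ.filter fun i => f i ≤ f t).card / 2 ^ (f t + 1)) := by
  set Λ := ∏ i, blockMass (f i) with hΛ
  have hΛ0 : 0 ≤ Λ := Finset.prod_nonneg fun i _ => (blockMass_pos _).le
  have hrep : ∀ (a : ι → ℕ) (S : Finset ι), repCount a S
      = ∑ D : Finset ι, if ∑ i ∈ symmDiff S D, a i = ∑ i ∈ S, a i then (1 : ℝ) else 0 := by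
    intro a S
    unfold repCount
    exact (Equiv.sum_comp (symmDiff_right_involutive S).toPerm
      (fun S' => if ∑ i ∈ S', a i = ∑ i ∈ S, a i then (1 : ℝ) else 0)).symm
  have hcol : ∀ S D : Finset ι, ∑ a ∈ Fintype.piFinset (fun i => block (f i)),
      (∏ i, (a i : ℝ)⁻¹) * (if ∑ i ∈ symmDiff S D, a i = ∑ i ∈ S, a i then (1 : ℝ) else 0)
      ≤ Λ * ((if D = ∅ then 1 else 0) +
        ∑ t, if D ∈ (Finset.univ.filter fun i => f i ≤ f t).powerset
          then (2 : ℝ) / 2 ^ f t else 0) := by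
    intro S D
    have hnn : ∀ t, 0 ≤ (if D ∈ (Finset.univ.filter fun i => f i ≤ f t).powerset
          then (2 : ℝ) / 2 ^ f t else 0) := fun t => by split_ifs <;> positivity
    rcases D.eq_empty_or_nonempty with hD | hD
    · rw [if_pos hD]
      have h1 : ∑ a ∈ Fintype.piFinset (fun i => block (f i)),
          (∏ i, (a i : ℝ)⁻¹) * (if ∑ i ∈ symmDiff S D, a i = ∑ i ∈ S, a i then (1 : ℝ) else 0)
          ≤ Λ := by
        rw [hΛ, ← sum_prod_inv_block]
        refine Finset.sum_le_sum fun a _ => ?_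
        have : 0 ≤ ∏ i, (a i : ℝ)⁻¹ := Finset.prod_nonneg fun _ _ => by positivity
        split_ifs <;> linarith
      refine h1.trans (le_mul_of_one_le_right hΛ0 ?_)
      have := Finset.sum_nonneg fun t (_ : t ∈ Finset.univ) => hnn t
      linarith
    · obtain ⟨t, htD, htmax⟩ := Finset.exists_max_image D f hD
      have hD' : D ∈ (Finset.univ.filter fun i => f i ≤ f t).powerset := by
        rw [Finset.mem_powerset]
        intro i hi
        simpa using htmax i hi
      have h1 := Finset.single_le_sum (fun t (_ : t ∈ Finset.univ) => hnn t) (Finset.mem_univ t)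
      simp only [if_pos hD'] at h1
      rw [if_neg hD.ne_empty, zero_add]
      refine le_trans ?_ (mul_le_mul_of_nonneg_left h1 hΛ0)
      rw [mul_comm Λ]
      refine le_trans (le_of_eq ?_) (sum_prod_inv_linear_eq_le f
        (fun i => (if i ∈ symmDiff S D then 1 else 0) - (if i ∈ S then 1 else 0)) (t := t) ?_)
      · rw [Finset.sum_filter]
        refine Finset.sum_congr rfl fun a _ => ?_
        rw [mul_ite, mul_one, mul_zero]
        refine if_congr ?_ rfl rfl
        simp only [sub_mul, ite_mul, one_mul, zero_mul, Finset.sum_sub_distrib,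
          Finset.sum_ite_mem, Finset.univ_inter, sub_eq_zero]
        norm_cast
      · by_cases hS : t ∈ S
        · simp [Finset.mem_symmDiff, htD, hS]
        · simp [Finset.mem_symmDiff, htD, hS]
  simp_rw [hrep, Finset.mul_sum]
  rw [Finset.sum_comm]
  have hS : ∀ S ∈ (Finset.univ : Finset (Finset ι)),
      ∑ a ∈ Fintype.piFinset (fun i => block (f i)), ∑ D : Finset ι,
      (∏ i, (a i : ℝ)⁻¹) * (if ∑ i ∈ symmDiff S D, a i = ∑ i ∈ S, a i then (1 : ℝ) else 0)
      ≤ Λ * (1 + 4 * ∑ t, (2 : ℝ) ^ (Finset.univ.filter fun i => f i ≤ f t).card /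
        2 ^ (f t + 1)) := by
    intro S _
    rw [Finset.sum_comm]
    refine (Finset.sum_le_sum fun D _ => hcol S D).trans ?_
    rw [← Finset.mul_sum, Finset.sum_add_distrib, Finset.sum_comm]
    refine mul_le_mul_of_nonneg_left (le_of_eq ?_) hΛ0
    congr 1
    · simp
    · rw [Finset.mul_sum]
      refine Finset.sum_congr rfl fun t _ => ?_
      rw [Finset.sum_ite_mem, Finset.univ_inter, Finset.sum_const, Finset.card_powerset,
        nsmul_eq_mul]
      push_cast
      rw [pow_succ]
      field_simp
      norm_num
  refine (Finset.sum_le_sum hS).trans (le_of_eq ?_)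
  rw [Finset.sum_const, Finset.card_univ, Fintype.card_finset, nsmul_eq_mul]
  push_cast
  rw [← mul_assoc, mul_comm ((2 : ℝ) ^ Fintype.card ι), Finset.mul_sum]

lemma sum_inv_repCount_le {ι : Type*} [Fintype ι] (a : ι → ℕ) :
    ∑ S : Finset ι, (repCount a S)⁻¹ ≤ (subsums (Finset.univ.val.map a)).card := by
  have h1 : ∀ S : Finset ι, ∑ i ∈ S, a i ∈ subsums (Finset.univ.val.map a) := by
    intro S
    rw [mem_subsums]
    exact ⟨S.val.map a, Multiset.map_le_map (Finset.val_le_iff.2 (Finset.subset_univ S)), rfl⟩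
  rw [← Finset.sum_fiberwise_of_maps_to (fun S _ => h1 S), Finset.card_eq_sum_ones]
  push_cast
  refine Finset.sum_le_sum fun y _ => ?_
  have h2 : ∀ S ∈ Finset.univ.filter (fun S : Finset ι => ∑ i ∈ S, a i = y),
      (repCount a S)⁻¹ = ((Finset.univ.filter (fun S : Finset ι => ∑ i ∈ S, a i = y)).card : ℝ)⁻¹ := by
    intro S hS
    rw [Finset.mem_filter] at hS
    unfold repCount
    rw [hS.2, Finset.sum_boole]
  rw [Finset.sum_congr rfl h2, Finset.sum_const, nsmul_eq_mul]
  exact mul_inv_le_one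

lemma repCount_pos {ι : Type*} [Fintype ι] (a : ι → ℕ) (S : Finset ι) : 0 < repCount a S := by
  classical
  unfold repCount
  refine Finset.sum_pos' (fun S' _ => by split_ifs <;> norm_num) ⟨S, Finset.mem_univ _, ?_⟩
  simp

lemma le_sum_card_subsums {ι : Type*} [Fintype ι] [DecidableEq ι] (f : ι → ℕ) :
    (2 * Real.log 2) ^ Fintype.card ι /
      (1 + 4 * ∑ t, (2 : ℝ) ^ (Finset.univ.filter fun i => f i ≤ f t).card / 2 ^ (f t + 1))
    ≤ ∑ a ∈ Fintype.piFinset (fun i => block (f i)),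
      (∏ i, (a i : ℝ)⁻¹) * (subsums (Finset.univ.val.map a)).card := by
  set K := 1 + 4 * ∑ t, (2 : ℝ) ^ (Finset.univ.filter fun i => f i ≤ f t).card / 2 ^ (f t + 1)
    with hK
  have hK0 : 0 < K := by positivity
  set Λ := ∏ i, blockMass (f i) with hΛ
  have hΛ0 : 0 < Λ := Finset.prod_pos fun i _ => (blockMass_pos _)
  set A := Fintype.piFinset (fun i => block (f i)) ×ˢ (Finset.univ : Finset (Finset ι)) with hA
  have hw : ∀ a : ι → ℕ, 0 ≤ ∏ i, (a i : ℝ)⁻¹ := fun a =>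
    Finset.prod_nonneg fun _ _ => by positivity
  have cs := Finset.sum_sq_le_sum_mul_sum_of_sq_le_mul A
    (r := fun z => ∏ i, (z.1 i : ℝ)⁻¹)
    (f := fun z => (∏ i, (z.1 i : ℝ)⁻¹) * (repCount z.1 z.2)⁻¹)
    (g := fun z => (∏ i, (z.1 i : ℝ)⁻¹) * repCount z.1 z.2)
    (fun z _ => mul_nonneg (hw _) (inv_nonneg.2 (repCount_pos _ _).le))
    (fun z _ => mul_nonneg (hw _) (repCount_pos _ _).le)
    (fun z _ => by
      have := (repCount_pos z.1 z.2).ne'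
      exact le_of_eq (by field_simp))
  rw [hA, Finset.sum_product, Finset.sum_product, Finset.sum_product] at cs
  have e1 : ∑ a ∈ Fintype.piFinset (fun i => block (f i)), ∑ _S : Finset ι, ∏ i, (a i : ℝ)⁻¹
      = 2 ^ Fintype.card ι * Λ := by
    simp only [Finset.sum_const, Finset.card_univ, Fintype.card_finset, nsmul_eq_mul]
    rw [← Finset.mul_sum, sum_prod_inv_block]
    push_cast
    rfl
  rw [e1] at cs
  have h1 : ∑ a ∈ Fintype.piFinset (fun i => block (f i)), ∑ S : Finset ι,
      (∏ i, (a i : ℝ)⁻¹) * (repCount a S)⁻¹ ≤ ∑ a ∈ Fintype.piFinset (fun i => block (f i)),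
      (∏ i, (a i : ℝ)⁻¹) * (subsums (Finset.univ.val.map a)).card := by
    refine Finset.sum_le_sum fun a _ => ?_
    rw [← Finset.mul_sum]
    exact mul_le_mul_of_nonneg_left (sum_inv_repCount_le a) (hw a)
  set Y := ∑ a ∈ Fintype.piFinset (fun i => block (f i)),
      (∏ i, (a i : ℝ)⁻¹) * ((subsums (Finset.univ.val.map a)).card : ℝ) with hY
  have hY0 : 0 ≤ Y := Finset.sum_nonneg fun a _ => mul_nonneg (hw a) (Nat.cast_nonneg _)
  have h2 := cs.trans (mul_le_mul h1 (sum_repCount_le f)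
    (Finset.sum_nonneg fun a _ => Finset.sum_nonneg fun S _ =>
      mul_nonneg (hw a) (repCount_pos a S).le) hY0)
  have hP : (0 : ℝ) < 2 ^ Fintype.card ι := by positivity
  have h3 : 2 ^ Fintype.card ι * Λ ≤ Y * K := by
    have h4 : (2 ^ Fintype.card ι * Λ) * (2 ^ Fintype.card ι * Λ)
        ≤ (2 ^ Fintype.card ι * Λ) * (Y * K) := by
      calc _ = (2 ^ Fintype.card ι * Λ) ^ 2 := (sq _).symm
        _ ≤ _ := h2
        _ = _ := by ring
    exact le_of_mul_le_mul_left h4 (by positivity)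
  have h5 : Real.log 2 ^ Fintype.card ι ≤ Λ := by
    rw [hΛ, ← Finset.card_univ, ← Finset.prod_const]
    exact Finset.prod_le_prod (fun _ _ => (Real.log_pos one_lt_two).le)
      fun i _ => log_two_le_blockMass _
  rw [div_le_iff₀ hK0, mul_pow]
  exact (mul_le_mul_of_nonneg_left h5 hP.le).trans h3

/-- The energy of a profile. -/
def energy (v : ℕ) (p : Multiset ℕ) : ℝ :=
  ∑ b ∈ Finset.range v, (p.count b : ℝ) * (2 ^ cumul p (b + 1) / 2 ^ (b + 1))

lemma energy_nonneg (v : ℕ) (p : Multiset ℕ) : 0 ≤ energy v p := by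
  unfold energy; positivity

lemma energy_map {ι : Type*} [Fintype ι] {v : ℕ} {f : ι → ℕ} (hf : ∀ i, f i < v) :
    ∑ t, (2 : ℝ) ^ (Finset.univ.filter fun i => f i ≤ f t).card / 2 ^ (f t + 1)
      = energy v (Finset.univ.val.map f) := by
  set p := Finset.univ.val.map f with hp
  have h1 : ∀ t, (Finset.univ.filter fun i => f i ≤ f t).card = cumul p (f t + 1) := by
    intro t
    unfold cumul
    rw [hp, Multiset.filter_map, Multiset.card_map]
    simp only [Function.comp_def, Nat.lt_succ_iff]
    rfl
  simp_rw [h1]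
  have h2 : ∑ t, (2 : ℝ) ^ cumul p (f t + 1) / 2 ^ (f t + 1)
      = (p.map fun b => (2 : ℝ) ^ cumul p (b + 1) / 2 ^ (b + 1)).sum := by
    rw [hp, Multiset.map_map]
    rfl
  rw [h2, Finset.sum_multiset_map_count]
  unfold energy
  have hsub : p.toFinset ⊆ Finset.range v := by
    intro b hb
    rw [Multiset.mem_toFinset, hp, Multiset.mem_map] at hb
    obtain ⟨t, _, rfl⟩ := hb
    exact Finset.mem_range.2 (hf t)
  rw [Finset.sum_subset hsub]
  · exact Finset.sum_congr rfl fun b _ => by rw [nsmul_eq_mul]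
  · intro b _ hb
    rw [Multiset.mem_toFinset] at hb
    rw [Multiset.count_eq_zero_of_notMem hb, zero_smul]

open Classical in
lemma le_sum_inv_energy : ∃ c : ℝ, 0 < c ∧ ∀ v : ℕ, c * (Real.exp v * rho v)
    ≤ ∑ p ∈ Ms (Finset.range v) v, wt (fun _ => 1) p * (1 + 4 * energy v p)⁻¹ := by
  obtain ⟨C, hC, h⟩ := sum_below_energy_le
  refine ⟨(1 + 4 * C)⁻¹, by positivity, fun v => ?_⟩
  set S := (Ms (Finset.range v) v).filter (fun p => Below 0 v p) with hS
  have hw : ∀ p, 0 ≤ wt (fun _ => 1) p := fun p => wt_nonneg fun _ _ => zero_le_one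
  have hK : ∀ p, 0 < 1 + 4 * energy v p := fun p => by
    have := energy_nonneg v p
    positivity
  have cs := Finset.sum_sq_le_sum_mul_sum_of_sq_le_mul S
    (r := fun p => wt (fun _ => 1) p)
    (f := fun p => wt (fun _ => 1) p * (1 + 4 * energy v p)⁻¹)
    (g := fun p => wt (fun _ => 1) p * (1 + 4 * energy v p))
    (fun p _ => mul_nonneg (hw _) (inv_nonneg.2 (hK p).le))
    (fun p _ => mul_nonneg (hw _) (hK p).le)
    (fun p _ => by
      have := (hK p).ne'
      exact le_of_eq (by field_simp))
  have e1 : ∑ p ∈ S, wt (fun _ => 1) p = Zrec v v 0 := by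
    rw [← sum_below_eq, hS, Finset.sum_filter]
    exact Finset.sum_congr rfl fun p _ => by rw [mul_ite, mul_one, mul_zero]
  have e2 : ∑ p ∈ S, wt (fun _ => 1) p * (1 + 4 * energy v p)
      ≤ Zrec v v 0 + 4 * (C * (Real.exp v * rho v)) := by
    simp_rw [mul_add, Finset.sum_add_distrib, mul_one]
    rw [e1]
    have h1 : ∑ p ∈ S, wt (fun _ => 1) p * (4 * energy v p)
        = 4 * ∑ p ∈ Ms (Finset.range v) v, wt (fun _ => 1) p * (if Below 0 v p then
      ∑ b ∈ Finset.range v, (p.count b : ℝ) * (2 ^ cumul p (b + 1) / 2 ^ (b + 1)) else 0) := by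
      rw [hS, Finset.sum_filter, Finset.mul_sum]
      refine Finset.sum_congr rfl fun p _ => ?_
      unfold energy
      split_ifs
      · ring
      · ring
    rw [h1]
    have := h v
    linarith
  have e3 : ∑ p ∈ S, wt (fun _ => 1) p * (1 + 4 * energy v p)⁻¹
      ≤ ∑ p ∈ Ms (Finset.range v) v, wt (fun _ => 1) p * (1 + 4 * energy v p)⁻¹ :=
    Finset.sum_le_sum_of_subset_of_nonneg (Finset.filter_subset _ _)
      fun p _ _ => mul_nonneg (hw _) (inv_nonneg.2 (hK p).le)
  refine le_trans ?_ e3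
  have e4 : 0 ≤ ∑ p ∈ S, wt (fun _ => 1) p * (1 + 4 * energy v p)⁻¹ :=
    Finset.sum_nonneg fun p _ => mul_nonneg (hw _) (inv_nonneg.2 (hK p).le)
  rw [e1] at cs
  have e5 := cs.trans (mul_le_mul_of_nonneg_left e2 e4)
  have e6 := le_Zrec v
  set y := Real.exp v * rho v with hy
  have hy0 : 0 < y := mul_pos (Real.exp_pos _) (rho_pos v)
  set Y := ∑ p ∈ S, wt (fun _ => 1) p * (1 + 4 * energy v p)⁻¹
  set Z := Zrec v v 0
  have hZ : 0 < Z := hy0.trans_le e6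
  have e7 : Z * Z ≤ Z * (Y * (1 + 4 * C)) := by
    nlinarith [mul_nonneg e4 hC.le, mul_le_mul_of_nonneg_left e6 (mul_nonneg e4 hC.le)]
  have e8 := le_of_mul_le_mul_left e7 hZ
  rw [inv_mul_le_iff₀ (by positivity)]
  linarith

theorem le_subsumMass : ∃ c : ℝ, 0 < c ∧ ∀ v q R : ℕ, 2 ^ v ≤ q + 1 → v ≤ R →
    c * ((2 * (Real.exp 1 * Real.log 2)) ^ v * rho v) ≤ subsumMass q R := by
  obtain ⟨c, hc, h⟩ := le_sum_inv_energy
  refine ⟨c, hc, fun v q R hq hR => ?_⟩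
  set s := Finset.Ico 1 (2 ^ v) with hs
  have h1 : ∑ m ∈ Ms s v, rwt m * (subsums m).card ≤ subsumMass q R := by
    refine Finset.sum_le_sum_of_subset_of_nonneg (fun m hm => ?_) fun m _ _ =>
      mul_nonneg (rwt_nonneg m) (Nat.cast_nonneg _)
    rw [mem_Ms] at hm
    rw [mem_MsLe]
    refine ⟨by omega, fun b hb => ?_⟩
    have := hm.2 b hb
    simp only [hs, Finset.mem_Ico, Finset.mem_Icc] at this ⊢
    omega
  refine le_trans ?_ h1
  have hfac : (0 : ℝ) < v.factorial := by exact_mod_cast v.factorial_pos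
  have hl : 0 < Real.log 2 := Real.log_pos one_lt_two
  have e1 : (2 * Real.log 2) ^ v * (c * (Real.exp v * rho v))
      = c * ((2 * (Real.exp 1 * Real.log 2)) ^ v * rho v) := by
    rw [show 2 * (Real.exp 1 * Real.log 2) = 2 * Real.log 2 * Real.exp 1 by ring,
      mul_pow _ (Real.exp 1), ← Real.exp_nat_mul, mul_one]
    ring
  rw [← e1]
  refine (mul_le_mul_of_nonneg_left (h v) (by positivity)).trans ?_
  refine le_of_mul_le_mul_left ?_ hfac
  have w1 := sum_words (fun _ => 1) (Finset.range v) v (fun p => (1 + 4 * energy v p)⁻¹)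
  have w2 := sum_words (fun b => (b : ℝ)⁻¹) s v (fun m => ((subsums m).card : ℝ))
  rw [show ∑ m ∈ Ms s v, rwt m * ((subsums m).card : ℝ)
    = ∑ m ∈ Ms s v, wt (fun b => (b : ℝ)⁻¹) m * ((subsums m).card : ℝ) from rfl, ← w2,
    mul_left_comm, ← w1, Finset.mul_sum]
  have hβ : ∀ a ∈ Fintype.piFinset (fun _ : Fin v => s),
      (fun i => Nat.log 2 (a i)) ∈ Fintype.piFinset (fun _ : Fin v => Finset.range v) := by
    intro a ha
    rw [Fintype.mem_piFinset] at ha ⊢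
    intro i
    have := ha i
    rw [hs, Finset.mem_Ico] at this
    rw [Finset.mem_range]
    exact Nat.log_lt_of_lt_pow (by omega) this.2
  rw [← Finset.sum_fiberwise_of_maps_to hβ]
  refine Finset.sum_le_sum fun f hf => ?_
  rw [Fintype.mem_piFinset] at hf
  have hf' : ∀ i, f i < v := fun i => Finset.mem_range.1 (hf i)
  have h2 := le_sum_card_subsums f
  rw [energy_map hf', Fintype.card_fin, div_eq_mul_inv] at h2
  rw [Finset.prod_const_one, one_mul]
  refine h2.trans (Finset.sum_le_sum_of_subset_of_nonneg ?_ fun a _ _ =>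
    mul_nonneg (Finset.prod_nonneg fun _ _ => by positivity) (Nat.cast_nonneg _))
  intro a ha
  rw [Fintype.mem_piFinset] at ha
  have ha' : ∀ i, 2 ^ f i ≤ a i ∧ a i < 2 ^ (f i + 1) := by simpa [block] using ha
  rw [Finset.mem_filter, Fintype.mem_piFinset]
  constructor
  · intro i
    rw [hs, Finset.mem_Ico]
    have h3 := Nat.one_le_two_pow (n := f i)
    have h4 : 2 ^ (f i + 1) ≤ 2 ^ v := Nat.pow_le_pow_right two_pos (hf' i)
    have := ha' i
    omega
  · funext i
    exact Nat.log_eq_of_pow_le_of_lt_pow (ha' i).1 (ha' i).2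

lemma exists_le_map_eq {α β : Type*} [DecidableEq β] (f : α → β) (m : Multiset α) :
    ∀ t : Multiset β, t ≤ m.map f → ∃ u ≤ m, u.map f = t := by
  induction m using Multiset.induction with
  | empty =>
    intro t ht
    rw [Multiset.map_zero, Multiset.le_zero] at ht
    exact ⟨0, le_rfl, by rw [ht, Multiset.map_zero]⟩
  | cons a m ih =>
    intro t ht
    rw [Multiset.map_cons] at ht
    by_cases h : f a ∈ t
    · obtain ⟨t', rfl⟩ := Multiset.exists_cons_of_mem h
      obtain ⟨u, hu, rfl⟩ := ih t' ((Multiset.cons_le_cons_iff _).1 ht)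
      exact ⟨a ::ₘ u, Multiset.cons_le_cons _ hu, Multiset.map_cons _ _ _⟩
    · obtain ⟨u, hu, rfl⟩ := ih t ((Multiset.le_cons_of_notMem h).1 ht)
      exact ⟨u, hu.trans (Multiset.le_cons_self _ _), rfl⟩

lemma exists_add_eq_of_le_add {α : Type*} [DecidableEq α] {t m₁ m₂ : Multiset α}
    (h : t ≤ m₁ + m₂) : ∃ t₁ ≤ m₁, ∃ t₂ ≤ m₂, t₁ + t₂ = t := by
  refine ⟨t ∩ m₁, Multiset.inter_le_right, t - m₁, ?_, ?_⟩
  · rw [tsub_le_iff_left]; exact h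
  · rw [add_comm, Multiset.sub_add_inter]

lemma mem_subsums_of_invariant {n : ℕ} {π : Equiv.Perm (Fin n)} {s : Finset (Fin n)}
    (h : ∀ x ∈ s, π x ∈ s) : s.card ∈ subsums π.partition.parts := by
  have hmap : s.map π.toEmbedding = s := by
    refine Finset.eq_of_subset_of_card_le (fun y hy => ?_) (by rw [Finset.card_map])
    rw [Finset.mem_map] at hy
    obtain ⟨x, hx, rfl⟩ := hy
    exact h x hx
  have hiff : ∀ x, π x ∈ s ↔ x ∈ s := by
    intro x
    refine ⟨fun hx => ?_, h x⟩
    rw [← hmap, Finset.mem_map] at hx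
    obtain ⟨y, hy, hyx⟩ := hx
    rwa [← π.injective hyx]
  set a := π.subtypePerm (p := (· ∈ s)) hiff with ha
  set b := π.subtypePerm (p := (· ∉ s)) (fun x => not_congr (hiff x)) with hb
  have hprod : π = Equiv.Perm.ofSubtype a * Equiv.Perm.ofSubtype b := by
    ext x
    congr 1
    rw [Equiv.Perm.mul_apply]
    by_cases hx : x ∈ s
    · rw [Equiv.Perm.ofSubtype_apply_of_not_mem b (not_not.2 hx),
        Equiv.Perm.ofSubtype_apply_of_mem a hx]
      rfl
    · rw [Equiv.Perm.ofSubtype_apply_of_mem b hx, Equiv.Perm.ofSubtype_apply_of_not_mem]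
      · rfl
      · exact (not_congr (hiff x)).2 hx
  have hdis : (Equiv.Perm.ofSubtype a).Disjoint (Equiv.Perm.ofSubtype b) := by
    intro x
    by_cases hx : x ∈ s
    · exact Or.inr (Equiv.Perm.ofSubtype_apply_of_not_mem b (not_not.2 hx))
    · exact Or.inl (Equiv.Perm.ofSubtype_apply_of_not_mem a hx)
  have hct : π.cycleType = a.cycleType + b.cycleType := by
    conv_lhs => rw [hprod]
    rw [hdis.cycleType_mul, Equiv.Perm.cycleType_ofSubtype, Equiv.Perm.cycleType_ofSubtype]
  have h1 := Equiv.Perm.sum_cycleType_le a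
  have h2 := Equiv.Perm.sum_cycleType_le b
  have h3 : Fintype.card {x // x ∈ s} = s.card := by simp
  have h4 : Fintype.card {x // x ∉ s} = n - s.card := by
    rw [Fintype.card_subtype_compl, h3, Fintype.card_fin]
  have h5 := s.card_le_univ
  rw [Fintype.card_fin] at h5
  rw [mem_subsums]
  refine ⟨a.cycleType + Multiset.replicate (s.card - a.cycleType.sum) 1, ?_, ?_⟩
  · rw [Equiv.Perm.parts_partition, ← Equiv.Perm.sum_cycleType, hct, add_assoc]
    refine add_le_add le_rfl (le_trans ?_ (Multiset.le_add_left _ _))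
    rw [Multiset.replicate_le_replicate, Multiset.sum_add, Fintype.card_fin]
    omega
  · rw [Multiset.sum_add, Multiset.sum_replicate]
    simp only [smul_eq_mul, mul_one]
    omega

lemma exists_invariant_of_mem_subsums {n k : ℕ} {π : Equiv.Perm (Fin n)}
    (h : k ∈ subsums π.partition.parts) : hasInvariantSet n k π := by
  rw [mem_subsums] at h
  obtain ⟨t, ht, rfl⟩ := h
  rw [Equiv.Perm.parts_partition] at ht
  obtain ⟨t₁, ht₁, t₂, ht₂, rfl⟩ := exists_add_eq_of_le_add ht
  obtain ⟨u, hu, rfl⟩ := exists_le_map_eq _ _ t₁ ht₁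
  have hnd : u.Nodup := Multiset.nodup_of_le hu (Finset.nodup _)
  obtain ⟨C, rfl⟩ : ∃ C : Finset (Equiv.Perm (Fin n)), C.val = u := ⟨⟨u, hnd⟩, rfl⟩
  have hC : C ⊆ π.cycleFactorsFinset := Finset.val_le_iff.1 hu
  obtain ⟨e, he, rfl⟩ := (Multiset.le_replicate_iff).1 ht₂
  rw [← Finset.card_compl] at he
  obtain ⟨F, hF, rfl⟩ := Finset.exists_subset_card_eq he
  have hdis : Disjoint (C.biUnion Equiv.Perm.support) F := by
    rw [Finset.disjoint_biUnion_left]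
    intro c hc
    rw [Finset.disjoint_left]
    intro x hx hxF
    have := Equiv.Perm.mem_cycleFactorsFinset_support_le (hC hc) hx
    exact (Finset.mem_compl.1 (hF hxF)) this
  refine ⟨C.biUnion Equiv.Perm.support ∪ F, ?_, ?_⟩
  · rw [Finset.card_union_of_disjoint hdis, Finset.card_biUnion, Multiset.sum_add,
      Multiset.sum_replicate, smul_eq_mul, mul_one]
    · rfl
    · intro c hc d hd hcd
      exact (Equiv.Perm.cycleFactorsFinset_pairwise_disjoint π (hC hc) (hC hd) hcd).disjoint_support
  · intro x hx
    rw [Finset.mem_union] at hx ⊢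
    rcases hx with hx | hx
    · left
      rw [Finset.mem_biUnion] at hx ⊢
      obtain ⟨c, hc, hxc⟩ := hx
      refine ⟨c, hc, ?_⟩
      rw [← (Equiv.Perm.mem_cycleFactorsFinset_iff.1 (hC hc)).2 x hxc]
      exact Equiv.Perm.apply_mem_support.2 hxc
    · right
      have := Finset.mem_compl.1 (hF hx)
      rw [Equiv.Perm.notMem_support] at this
      rwa [this]

lemma hasInvariantSet_iff {n k : ℕ} (π : Equiv.Perm (Fin n)) :
    hasInvariantSet n k π ↔ k ∈ subsums π.partition.parts := by
  refine ⟨?_, exists_invariant_of_mem_subsums⟩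
  rintro ⟨s, rfl, hs⟩
  exact mem_subsums_of_invariant hs

/-- The partitions of `n`, as multisets of positive integers. -/
def parts (n : ℕ) : Finset (Multiset ℕ) := (MsLe (Finset.Icc 1 n) n).filter fun m => m.sum = n

lemma card_le_sum {m : Multiset ℕ} (h : ∀ b ∈ m, 1 ≤ b) : Multiset.card m ≤ m.sum := by
  simpa using Multiset.card_nsmul_le_sum h

lemma mem_parts {n : ℕ} {m : Multiset ℕ} : m ∈ parts n ↔ (∀ b ∈ m, 1 ≤ b) ∧ m.sum = n := by
  unfold parts
  simp only [Finset.mem_filter, mem_MsLe, Finset.mem_Icc]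
  constructor
  · rintro ⟨⟨_, h⟩, hs⟩
    exact ⟨fun b hb => (h b hb).1, hs⟩
  · rintro ⟨h, rfl⟩
    exact ⟨⟨card_le_sum h, fun b hb => ⟨h b hb, Multiset.le_sum_of_mem hb⟩⟩, rfl⟩

lemma card_partition_eq {n : ℕ} {c : Multiset ℕ} (hc : c ∈ parts n) :
    ((Finset.univ.filter fun π : Equiv.Perm (Fin n) => π.partition.parts = c).card : ℝ)
      = n.factorial * rwt c := by
  rw [mem_parts] at hc
  obtain ⟨hpos, hsum⟩ := hc
  set d := c.filter (2 ≤ ·) with hd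
  have hc1 : d + Multiset.replicate (c.count 1) 1 = c := by
    rw [← Multiset.filter_eq']
    have : c.filter (· = 1) = c.filter (¬ 2 ≤ ·) := Multiset.filter_congr fun b hb => by
      have := hpos b hb
      omega
    rw [this]
    exact Multiset.filter_add_not _ c
  have hds : d.sum + c.count 1 = n := by
    rw [← hsum]
    conv_rhs => rw [← hc1]
    rw [Multiset.sum_add, Multiset.sum_replicate, smul_eq_mul, mul_one]
  have hset : (Finset.univ.filter fun π : Equiv.Perm (Fin n) => π.partition.parts = c)
      = Finset.univ.filter fun π : Equiv.Perm (Fin n) => π.cycleType = d := by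
    ext π
    simp only [Finset.mem_filter, Finset.mem_univ, true_and]
    constructor
    · intro h
      rw [← Equiv.Perm.filter_parts_partition_eq_cycleType, h]
    · intro h
      rw [Equiv.Perm.parts_partition, ← Equiv.Perm.sum_cycleType, h, Fintype.card_fin,
        show n - d.sum = c.count 1 by omega, hc1]
  rw [hset]
  have h := Equiv.Perm.card_of_cycleType_mul_eq (Fin n) d
  rw [if_pos ⟨by rw [Fintype.card_fin]; omega, fun a ha => (Multiset.mem_filter.1 ha).2⟩,
    Fintype.card_fin, show n - d.sum = c.count 1 by omega] at h
  have hw : rwt c = (d.prod : ℝ)⁻¹ / ((∏ b ∈ d.toFinset, (d.count b).factorial : ℕ) : ℝ) *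
      (1 / (c.count 1).factorial) := by
    unfold rwt
    conv_lhs => rw [← hc1]
    rw [wt_add_of_disjoint, wt_replicate]
    · congr 1
      · unfold wt
        congr 1
        rw [Multiset.prod_map_inv, Nat.cast_multiset_prod]
      · simp
    · intro b hb hb'
      have h1 := (Multiset.mem_filter.1 hb).2
      have h2 := Multiset.eq_of_mem_replicate hb'
      omega
  rw [hw, ← h]
  have hp : (d.prod : ℝ) ≠ 0 := by
    have : 0 < d.prod := Multiset.prod_pos fun a ha => by
      have := (Multiset.mem_filter.1 ha).2
      omega
    exact_mod_cast this.ne'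
  have hq : ((∏ b ∈ d.toFinset, (d.count b).factorial : ℕ) : ℝ) ≠ 0 := by
    exact_mod_cast (count_prod_pos d _).ne'
  have hr : ((c.count 1).factorial : ℝ) ≠ 0 := by exact_mod_cast Nat.factorial_ne_zero _
  simp only [Nat.cast_mul]
  field_simp

lemma partition_mem_parts {n : ℕ} (π : Equiv.Perm (Fin n)) : π.partition.parts ∈ parts n := by
  rw [mem_parts]
  refine ⟨fun b hb => π.partition.parts_pos hb, ?_⟩
  rw [π.partition.parts_sum, Fintype.card_fin]

theorem iProp_eq (n k : ℕ) :
    iProp n k = ∑ c ∈ (parts n).filter (fun c => k ∈ subsums c), rwt c := by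
  classical
  unfold iProp
  rw [Nat.card_eq_fintype_card, Nat.card_eq_fintype_card, Fintype.card_perm, Fintype.card_fin,
    Fintype.card_subtype]
  have h0 : (n.factorial : ℝ) ≠ 0 := by exact_mod_cast n.factorial_ne_zero
  rw [div_eq_iff h0, Finset.sum_mul]
  rw [Finset.card_eq_sum_card_fiberwise (f := fun π : Equiv.Perm (Fin n) => π.partition.parts)
    (t := (parts n).filter (fun c => k ∈ subsums c))]
  · push_cast
    refine Finset.sum_congr rfl fun c hc => ?_
    rw [Finset.mem_filter] at hc
    rw [mul_comm, ← card_partition_eq hc.1, Finset.filter_filter]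
    congr 2
    ext π
    simp only [Finset.mem_filter, Finset.mem_univ, true_and, hasInvariantSet_iff]
    constructor
    · exact fun h => h.2
    · rintro rfl
      exact ⟨hc.2, rfl⟩
  · intro π hπ
    simp only [Finset.coe_filter, Finset.mem_univ, true_and, hasInvariantSet_iff,
      Set.mem_ofPred_eq] at hπ ⊢
    exact ⟨partition_mem_parts π, hπ⟩

/-- The partitions of `N` into parts that are at least `j`. -/
def partsGe (j N : ℕ) : Finset (Multiset ℕ) := (parts N).filter fun m => ∀ b ∈ m, j ≤ b

lemma mem_partsGe {j N : ℕ} (hj : 1 ≤ j) {m : Multiset ℕ} :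
    m ∈ partsGe j N ↔ (∀ b ∈ m, j ≤ b) ∧ m.sum = N := by
  unfold partsGe
  rw [Finset.mem_filter, mem_parts]
  exact ⟨fun h => ⟨h.2, h.1.2⟩, fun h => ⟨⟨fun b hb => hj.trans (h.1 b hb), h.2⟩, h.1⟩⟩

lemma sum_sum_mul (S : Finset (Multiset ℕ)) (s : Finset ℕ) (hS : ∀ m ∈ S, ∀ b ∈ m, b ∈ s)
    (F : Multiset ℕ → ℝ) :
    ∑ m ∈ S, (m.sum : ℝ) * F m = ∑ b ∈ s, (b : ℝ) * ∑ m ∈ S, (m.count b : ℝ) * F m := by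
  simp only [Finset.mul_sum]
  rw [Finset.sum_comm]
  refine Finset.sum_congr rfl fun m hm => ?_
  rw [Finset.sum_multiset_count_of_subset m s fun b hb => hS m hm b (Multiset.mem_toFinset.1 hb)]
  push_cast
  rw [Finset.sum_mul]
  refine Finset.sum_congr rfl fun b _ => ?_
  rw [smul_eq_mul]
  push_cast
  ring

lemma mul_sum_partsGe {j : ℕ} (hj : 1 ≤ j) (N : ℕ) :
    (N : ℝ) * ∑ m ∈ partsGe j N, rwt m
      = ∑ b ∈ Finset.Icc j N, ∑ m ∈ partsGe j (N - b), rwt m := by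
  have h1 : (N : ℝ) * ∑ m ∈ partsGe j N, rwt m = ∑ m ∈ partsGe j N, (m.sum : ℝ) * rwt m := by
    rw [Finset.mul_sum]
    refine Finset.sum_congr rfl fun m hm => ?_
    rw [((mem_partsGe hj).1 hm).2]
  rw [h1, sum_sum_mul _ (Finset.Icc j N)]
  · refine Finset.sum_congr rfl fun b hb => ?_
    rw [Finset.mem_Icc] at hb
    have h2 := sum_count_wt (fun b => (b : ℝ)⁻¹) (partsGe j N) (partsGe j (N - b)) b
      (fun m => by
        rw [mem_partsGe hj, mem_partsGe hj, Multiset.sum_cons]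
        simp only [Multiset.mem_cons, forall_eq_or_imp]
        constructor
        · rintro ⟨h, h'⟩
          exact ⟨⟨hb.1, h⟩, by omega⟩
        · rintro ⟨⟨_, h⟩, h'⟩
          exact ⟨h, by omega⟩) (fun _ => 1)
    simp only [mul_one] at h2
    have hb0 : (b : ℝ) ≠ 0 := by
      have : b ≠ 0 := by omega
      exact_mod_cast this
    unfold rwt
    rw [h2, mul_inv_cancel_left₀ hb0]
  · intro m hm b hb
    obtain ⟨h, rfl⟩ := (mem_partsGe hj).1 hm
    exact Finset.mem_Icc.2 ⟨h b hb, Multiset.le_sum_of_mem hb⟩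

lemma partsGe_zero {j : ℕ} (hj : 1 ≤ j) : partsGe j 0 = {0} := by
  ext m
  rw [mem_partsGe hj, Finset.mem_singleton]
  constructor
  · rintro ⟨h, h'⟩
    have := card_le_sum fun b hb => hj.trans (h b hb)
    rw [h', Nat.le_zero, Multiset.card_eq_zero] at this
    exact this
  · rintro rfl
    simp

lemma sum_partsGe_zero {j : ℕ} (hj : 1 ≤ j) : ∑ m ∈ partsGe j 0, rwt m = 1 := by
  rw [partsGe_zero hj, Finset.sum_singleton]
  exact wt_zero _

lemma sum_Icc_tsub {j N : ℕ} (h : j ≤ N) (f : ℕ → ℝ) :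
    ∑ b ∈ Finset.Icc j N, f (N - b) = f 0 + ∑ i ∈ Finset.Icc 1 (N - j), f i := by
  have h1 : ∑ b ∈ Finset.Icc j N, f (N - b) = ∑ i ∈ Finset.Icc 0 (N - j), f i := by
    refine Finset.sum_bij' (fun b _ => N - b) (fun i _ => N - i) ?_ ?_ ?_ ?_ ?_ <;>
    · intro a ha
      simp only [Finset.mem_Icc] at ha ⊢
      try omega
  rw [h1, ← Finset.insert_Icc_add_one_left_eq_Icc (Nat.zero_le _), Finset.sum_insert (by simp),
    zero_add]

lemma sum_partsGe_le {j : ℕ} (hj : 1 ≤ j) {N : ℕ} (hN : 1 ≤ N) :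
    ∑ m ∈ partsGe j N, rwt m ≤ (j : ℝ)⁻¹ := by
  induction N using Nat.strong_induction_on with
  | _ N ih =>
    have hN0 : (0 : ℝ) < N := by exact_mod_cast hN
    have hj0 : (0 : ℝ) < j := by exact_mod_cast hj
    refine le_of_mul_le_mul_left ?_ hN0
    rw [mul_sum_partsGe hj]
    by_cases h : j ≤ N
    · rw [sum_Icc_tsub h fun i => ∑ m ∈ partsGe j i, rwt m, sum_partsGe_zero hj]
      have h1 : ∑ i ∈ Finset.Icc 1 (N - j), ∑ m ∈ partsGe j i, rwt m
          ≤ ∑ i ∈ Finset.Icc 1 (N - j), (j : ℝ)⁻¹ := by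
        refine Finset.sum_le_sum fun i hi => ?_
        rw [Finset.mem_Icc] at hi
        exact ih i (by omega) hi.1
      rw [Finset.sum_const, Nat.card_Icc, Nat.add_sub_cancel, nsmul_eq_mul, Nat.cast_sub h,
        sub_mul, mul_inv_cancel₀ hj0.ne'] at h1
      linarith
    · rw [Finset.Icc_eq_empty h, Finset.sum_empty]
      positivity

lemma le_sum_partsGe {j : ℕ} (hj : 1 ≤ j) {N : ℕ} (hN : j ≤ N) :
    (2 * (j : ℝ))⁻¹ ≤ ∑ m ∈ partsGe j N, rwt m := by
  induction N using Nat.strong_induction_on with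
  | _ N ih =>
    have hN0 : (0 : ℝ) < N := by exact_mod_cast hj.trans hN
    have hj0 : (0 : ℝ) < j := by exact_mod_cast hj
    refine le_of_mul_le_mul_left ?_ hN0
    rw [mul_sum_partsGe hj, sum_Icc_tsub hN fun i => ∑ m ∈ partsGe j i, rwt m,
      sum_partsGe_zero hj]
    have h1 : ∑ i ∈ Finset.Icc j (N - j), (2 * (j : ℝ))⁻¹
        ≤ ∑ i ∈ Finset.Icc 1 (N - j), ∑ m ∈ partsGe j i, rwt m := by
      refine (Finset.sum_le_sum fun i hi => ?_).trans (Finset.sum_le_sum_of_subset_of_nonneg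
        (Finset.Icc_subset_Icc_left hj) fun i _ _ => Finset.sum_nonneg fun m _ => rwt_nonneg m)
      rw [Finset.mem_Icc] at hi
      exact ih i (by omega) hi.1
    rw [Finset.sum_const, Nat.card_Icc, nsmul_eq_mul] at h1
    have h2 : (N : ℝ) - 2 * j ≤ ((N - j + 1 - j : ℕ) : ℝ) := by
      have : N ≤ (N - j + 1 - j) + 2 * j := by omega
      have : (N : ℝ) ≤ ((N - j + 1 - j : ℕ) : ℝ) + 2 * j := by exact_mod_cast this
      linarith
    have h3 := mul_le_mul_of_nonneg_right h2 (show 0 ≤ (2 * (j : ℝ))⁻¹ by positivity)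
    rw [sub_mul, mul_inv_cancel₀ (by positivity)] at h3
    linarith

lemma rwt_cons_of_notMem {b : ℕ} {m : Multiset ℕ} (h : b ∉ m) :
    rwt (b ::ₘ m) = (b : ℝ)⁻¹ * rwt m := by
  have := wt_cons (fun b => (b : ℝ)⁻¹) b m
  rwa [Multiset.count_cons_self, Multiset.count_eq_zero_of_notMem h, zero_add, Nat.cast_one,
    one_mul] at this

lemma rwt_cons_le (b : ℕ) (m : Multiset ℕ) : rwt (b ::ₘ m) ≤ (b : ℝ)⁻¹ * rwt m := by
  have := wt_add_le (x := fun b => (b : ℝ)⁻¹) (m₁ := {b}) (m₂ := m)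
    (fun _ _ => by positivity) (fun _ _ => by positivity)
  rwa [wt_singleton, Multiset.singleton_add] at this

/-- Partitions with smallest part `j` carry a weight of order `j⁻²`. -/
lemma le_sum_partsGe_mem {j M : ℕ} (hj : 1 ≤ j) (hM : 2 * j ≤ M) :
    ((j : ℝ) * (2 * j + 2))⁻¹ ≤ ∑ m ∈ (partsGe j M).filter (j ∈ ·), rwt m := by
  have hj0 : (0 : ℝ) < j := by exact_mod_cast hj
  rcases hM.eq_or_lt with rfl | hM
  · have h1 : ({j, j} : Multiset ℕ) ∈ (partsGe j (2 * j)).filter (j ∈ ·) := by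
      rw [Finset.mem_filter, mem_partsGe hj]
      simp [two_mul]
    refine le_trans ?_ (Finset.single_le_sum (fun m _ => rwt_nonneg m) h1)
    have h2 : rwt {j, j} = (j : ℝ)⁻¹ ^ 2 / 2 := by
      have := wt_replicate (fun b => (b : ℝ)⁻¹) j 2
      simpa [rwt, Multiset.replicate_succ] using this
    rw [h2, mul_inv, inv_pow, sq, mul_inv, mul_div_assoc]
    refine mul_le_mul_of_nonneg_left ?_ (by positivity)
    rw [div_eq_mul_inv, ← mul_inv]
    exact inv_anti₀ (by positivity) (by linarith)
  · have h1 := le_sum_partsGe (j := j + 1) (by omega) (N := M - j) (by omega)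
    have h2 : (j : ℝ)⁻¹ * ∑ m ∈ partsGe (j + 1) (M - j), rwt m
        = ∑ m ∈ (partsGe (j + 1) (M - j)).image (j ::ₘ ·), rwt m := by
      rw [Finset.sum_image fun m _ m' _ h => (Multiset.cons_inj_right j).1 h, Finset.mul_sum]
      refine Finset.sum_congr rfl fun m hm => ?_
      rw [rwt_cons_of_notMem]
      intro hmem
      have := ((mem_partsGe (by omega)).1 hm).1 j hmem
      omega
    refine le_trans ?_ (h2.le.trans (Finset.sum_le_sum_of_subset_of_nonneg ?_
      fun m _ _ => rwt_nonneg m))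
    · rw [mul_inv]
      push_cast at h1
      rw [mul_add, mul_one] at h1
      exact mul_le_mul_of_nonneg_left h1 (by positivity)
    · intro m hm
      rw [Finset.mem_image] at hm
      obtain ⟨m, hm, rfl⟩ := hm
      rw [mem_partsGe (by omega)] at hm
      rw [Finset.mem_filter, mem_partsGe hj, Multiset.sum_cons]
      simp only [Multiset.mem_cons, forall_eq_or_imp]
      exact ⟨⟨⟨le_rfl, fun b hb => (Nat.le_succ j).trans (hm.1 b hb)⟩, by omega⟩, by simp⟩

lemma card_subsums_cons_le (b : ℕ) (m : Multiset ℕ) :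
    (subsums (b ::ₘ m)).card ≤ 2 * (subsums m).card := by
  have h := card_subsums_add_le {b} m
  rw [Multiset.singleton_add] at h
  refine h.trans (Nat.mul_le_mul_right _ ?_)
  simpa using card_subsums_le_two_pow {b}

lemma subsumMass_mono (J : ℕ) {R R' : ℕ} (h : R ≤ R') : subsumMass J R ≤ subsumMass J R' := by
  refine Finset.sum_le_sum_of_subset_of_nonneg (fun m hm => ?_) fun m _ _ =>
    mul_nonneg (rwt_nonneg m) (Nat.cast_nonneg _)
  rw [mem_MsLe] at hm ⊢
  exact ⟨hm.1.trans h, hm.2⟩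

lemma subsumMass_nonneg (J R : ℕ) : 0 ≤ subsumMass J R :=
  Finset.sum_nonneg fun m _ => mul_nonneg (rwt_nonneg m) (Nat.cast_nonneg _)

/-- The first moment of the sum, weighted by the number of subset sums. -/
lemma sum_sum_mul_card_le (J R : ℕ) :
    ∑ m ∈ MsLe (Finset.Icc 1 J) R, (m.sum : ℝ) * (rwt m * (subsums m).card)
      ≤ 2 * J * subsumMass J R := by
  rw [sum_sum_mul _ (Finset.Icc 1 J) fun m hm => (mem_MsLe.1 hm).2]
  cases R with
  | zero =>
    refine le_trans (Finset.sum_nonpos fun b _ => ?_)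
      (mul_nonneg (by positivity) (subsumMass_nonneg _ _))
    refine mul_nonpos_of_nonneg_of_nonpos (Nat.cast_nonneg _) (Finset.sum_nonpos fun m hm => ?_)
    have := (mem_MsLe.1 hm).1
    rw [Nat.le_zero, Multiset.card_eq_zero] at this
    simp [this]
  | succ R =>
    have h1 : ∀ b ∈ Finset.Icc 1 J, (b : ℝ) * ∑ m ∈ MsLe (Finset.Icc 1 J) (R + 1),
        (m.count b : ℝ) * (rwt m * (subsums m).card) ≤ 2 * subsumMass J (R + 1) := by
      intro b hb
      have h2 := sum_count_wt (fun b => (b : ℝ)⁻¹) (MsLe (Finset.Icc 1 J) (R + 1))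
        (MsLe (Finset.Icc 1 J) R) b (cons_mem_MsLe hb) fun m => ((subsums m).card : ℝ)
      have hb0 : (b : ℝ) ≠ 0 := by
        have := (Finset.mem_Icc.1 hb).1
        have : b ≠ 0 := by omega
        exact_mod_cast this
      simp only [← mul_assoc]
      unfold rwt
      rw [h2, mul_inv_cancel_left₀ hb0]
      refine le_trans ?_ (mul_le_mul_of_nonneg_left (subsumMass_mono J (Nat.le_succ R)) two_pos.le)
      unfold subsumMass
      rw [Finset.mul_sum]
      refine Finset.sum_le_sum fun m _ => ?_
      have h3 : ((subsums (b ::ₘ m)).card : ℝ) ≤ 2 * (subsums m).card := by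
        exact_mod_cast card_subsums_cons_le b m
      refine (mul_le_mul_of_nonneg_left h3 (rwt_nonneg m)).trans (le_of_eq ?_)
      unfold rwt
      ring
    refine (Finset.sum_le_sum h1).trans (le_of_eq ?_)
    rw [Finset.sum_const, Nat.card_Icc, Nat.add_sub_cancel, nsmul_eq_mul]
    ring

lemma sum_sub_mem_subsums {m : Multiset ℕ} {x : ℕ} (h : x ∈ subsums m) :
    m.sum - x ∈ subsums m := by
  rw [mem_subsums] at h ⊢
  obtain ⟨t, ht, rfl⟩ := h
  obtain ⟨u, rfl⟩ := Multiset.le_iff_exists_add.1 ht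
  exact ⟨u, Multiset.le_add_left _ _, by rw [Multiset.sum_add]; omega⟩

/-- At least half of the subset sums are at least half of the total. -/
lemma card_subsums_le_filter (m : Multiset ℕ) :
    (subsums m).card ≤ 2 * ((subsums m).filter fun x => m.sum ≤ 2 * x).card := by
  have h1 := Finset.card_filter_add_card_filter_not (s := subsums m) (fun x => m.sum ≤ 2 * x)
  have h2 : ((subsums m).filter fun x => ¬ m.sum ≤ 2 * x).card
      ≤ ((subsums m).filter fun x => m.sum ≤ 2 * x).card := by
    refine Finset.card_le_card_of_injOn (fun x => m.sum - x) (fun x hx => ?_) fun x hx y hy h => ?_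
    · simp only [Finset.coe_filter, Set.mem_ofPred_eq] at hx ⊢
      exact ⟨sum_sub_mem_subsums hx.1, by omega⟩
    · simp only [Finset.coe_filter, Set.mem_ofPred_eq] at hx hy h
      have := le_sum_of_mem_subsums hx.1
      have := le_sum_of_mem_subsums hy.1
      omega
  omega

/-- Most of the mass comes from multisets with small sum. -/
lemma subsumMass_le_filter {k q : ℕ} (R : ℕ) (hk : 1 ≤ k) (hq : 8 * q ≤ k) :
    subsumMass q R ≤ 2 * ∑ m ∈ (MsLe (Finset.Icc 1 q) R).filter (fun m => 2 * m.sum ≤ k),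
      rwt m * (subsums m).card := by
  have hk0 : (0 : ℝ) < k := by exact_mod_cast hk
  have h1 := Finset.sum_filter_add_sum_filter_not (MsLe (Finset.Icc 1 q) R)
    (fun m => 2 * m.sum ≤ k) fun m => rwt m * ((subsums m).card : ℝ)
  have h2 : (k : ℝ) * ∑ m ∈ (MsLe (Finset.Icc 1 q) R).filter (fun m => ¬ 2 * m.sum ≤ k),
      rwt m * (subsums m).card ≤ 2 * (2 * q * subsumMass q R) := by
    refine le_trans ?_ (mul_le_mul_of_nonneg_left (sum_sum_mul_card_le q R) two_pos.le)
    rw [Finset.mul_sum, Finset.mul_sum]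
    refine (Finset.sum_le_sum fun m hm => ?_).trans (Finset.sum_le_sum_of_subset_of_nonneg
      (Finset.filter_subset _ _) fun m _ _ => ?_)
    · have h3 : (k : ℝ) ≤ 2 * m.sum := by
        have := (Finset.mem_filter.1 hm).2
        exact_mod_cast (not_le.1 this).le
      rw [← mul_assoc (2 : ℝ)]
      exact mul_le_mul_of_nonneg_right h3 (mul_nonneg (rwt_nonneg m) (Nat.cast_nonneg _))
    · have := rwt_nonneg m
      positivity
  have h3 : 8 * (q : ℝ) ≤ k := by exact_mod_cast hq
  have h4 := mul_le_mul_of_nonneg_right h3 (subsumMass_nonneg q R)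
  have h5 : ∑ m ∈ (MsLe (Finset.Icc 1 q) R).filter (fun m => ¬ 2 * m.sum ≤ k),
      rwt m * (subsums m).card ≤ subsumMass q R / 2 := by
    refine le_of_mul_le_mul_left ?_ hk0
    linarith
  unfold subsumMass at h5 ⊢
  linarith

lemma sum_le_sum_of_injOn {ι κ : Type*} {s : Finset ι} {t : Finset κ}
    {f : ι → ℝ} {g : κ → ℝ} (e : ι → κ) (he : ∀ i ∈ s, e i ∈ t)
    (hinj : ∀ i ∈ s, ∀ j ∈ s, e i = e j → i = j) (hfg : ∀ i ∈ s, f i ≤ g (e i))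
    (hg : ∀ j ∈ t, 0 ≤ g j) : ∑ i ∈ s, f i ≤ ∑ j ∈ t, g j := by
  classical
  refine (Finset.sum_le_sum hfg).trans ?_
  rw [← Finset.sum_image (f := g) (g := e) hinj]
  exact Finset.sum_le_sum_of_subset_of_nonneg (Finset.image_subset_iff.2 he) fun j hj _ => hg j hj

/-- Lower bound for `i(n,k)` through the number of subset sums of the small cycle lengths. -/
theorem subsumMass_le_iProp {n k q : ℕ} (R : ℕ) (hk : 1 ≤ k) (hn : 2 * k ≤ n) (hq : 8 * q ≤ k) :
    subsumMass q R ≤ 8 * k * (k + 1) * iProp n k := by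
  have hk0 : (0 : ℝ) < k := by exact_mod_cast hk
  set A := (MsLe (Finset.Icc 1 q) R).filter (fun m => 2 * m.sum ≤ k) with hA
  have hmain : ∑ m ∈ A, ∑ x ∈ (subsums m).filter (fun x => m.sum ≤ 2 * x),
      ∑ c ∈ (partsGe (k - x) (n - m.sum)).filter (k - x ∈ ·), rwt m * rwt c ≤ iProp n k := by
    rw [iProp_eq, Finset.sum_sigma', Finset.sum_sigma']
    have hmem : ∀ p ∈ (A.sigma fun m => (subsums m).filter fun x => m.sum ≤ 2 * x).sigma
        (fun p => (partsGe (k - p.2) (n - p.1.sum)).filter (k - p.2 ∈ ·)),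
        (∀ b ∈ p.1.1, 1 ≤ b ∧ b ≤ q) ∧ p.1.2 ∈ subsums p.1.1 ∧ p.1.2 < k ∧ q < k - p.1.2 ∧
        (∀ b ∈ p.2, k - p.1.2 ≤ b) ∧ p.2.sum = n - p.1.1.sum ∧ p.1.1.sum ≤ n ∧
        k - p.1.2 ∈ p.2 := by
      rintro ⟨⟨m, x⟩, c⟩ hp
      simp only [hA, Finset.mem_sigma, Finset.mem_filter, mem_MsLe, Finset.mem_Icc] at hp ⊢
      obtain ⟨⟨⟨⟨_, hm⟩, hmk⟩, hx, hx2⟩, hc, hxc⟩ := hp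
      have hxm := le_sum_of_mem_subsums hx
      rw [mem_partsGe (by omega)] at hc
      exact ⟨hm, hx, by omega, by omega, hc.1, hc.2, by omega, hxc⟩
    have hfil : ∀ p ∈ (A.sigma fun m => (subsums m).filter fun x => m.sum ≤ 2 * x).sigma
        (fun p => (partsGe (k - p.2) (n - p.1.sum)).filter (k - p.2 ∈ ·)),
        (p.1.1 + p.2).filter (· ≤ q) = p.1.1 := by
      intro p hp
      obtain ⟨h1, -, -, h4, h5, -⟩ := hmem p hp
      rw [Multiset.filter_add, Multiset.filter_eq_self.2 fun b hb => (h1 b hb).2,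
        Multiset.filter_eq_nil.2, add_zero]
      intro b hb
      have := h5 b hb
      omega
    refine sum_le_sum_of_injOn (fun p => p.1.1 + p.2) ?_ ?_ ?_ fun m _ => rwt_nonneg m
    · intro p hp
      obtain ⟨h1, h2, h3, h4, h5, h6, h7, h8⟩ := hmem p hp
      rw [Finset.mem_filter, mem_parts, Multiset.sum_add]
      refine ⟨⟨fun b hb => ?_, by omega⟩, ?_⟩
      · rw [Multiset.mem_add] at hb
        rcases hb with hb | hb
        · exact (h1 b hb).1
        · have := h5 b hb
          omega
      · rw [mem_subsums] at h2 ⊢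
        obtain ⟨t, ht, hts⟩ := h2
        refine ⟨t + {k - p.1.2}, add_le_add ht (Multiset.singleton_le.2 h8), ?_⟩
        rw [Multiset.sum_add, Multiset.sum_singleton]
        omega
    · intro p hp p' hp' h
      have e1 : p.1.1 = p'.1.1 := by rw [← hfil p hp, ← hfil p' hp', h]
      have e2 : p.2 = p'.2 := by
        rw [e1] at h
        exact add_left_cancel h
      obtain ⟨-, -, h3, -, h5, -, -, h8⟩ := hmem p hp
      obtain ⟨-, -, h3', -, h5', -, -, h8'⟩ := hmem p' hp'
      have e3 : p.1.2 = p'.1.2 := by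
        have := h5 _ (e2 ▸ h8')
        have := h5' _ (e2 ▸ h8)
        omega
      obtain ⟨⟨m, x⟩, c⟩ := p
      obtain ⟨⟨m', x'⟩, c'⟩ := p'
      simp only at e1 e2 e3
      subst e1 e2 e3
      rfl
    · intro p hp
      obtain ⟨h1, -, -, h4, h5, -⟩ := hmem p hp
      unfold rwt
      rw [wt_add_of_disjoint]
      intro b hb hb'
      have := (h1 b hb).2
      have := h5 b hb'
      omega
  have h1 : ∀ m ∈ A, rwt m * (subsums m).card ≤ 4 * k * (k + 1) *
      ∑ x ∈ (subsums m).filter (fun x => m.sum ≤ 2 * x),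
        ∑ c ∈ (partsGe (k - x) (n - m.sum)).filter (k - x ∈ ·), rwt m * rwt c := by
    intro m hm
    simp only [hA, Finset.mem_filter] at hm
    have h2 : ∀ x ∈ (subsums m).filter (fun x => m.sum ≤ 2 * x), rwt m * ((k : ℝ) * (2 * k + 2))⁻¹
        ≤ ∑ c ∈ (partsGe (k - x) (n - m.sum)).filter (k - x ∈ ·), rwt m * rwt c := by
      intro x hx
      rw [Finset.mem_filter] at hx
      have hxm := le_sum_of_mem_subsums hx.1
      rw [← Finset.mul_sum]
      refine mul_le_mul_of_nonneg_left ?_ (rwt_nonneg m)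
      refine le_trans ?_ (le_sum_partsGe_mem (by omega) (by omega))
      have h3 : ((k - x : ℕ) : ℝ) ≤ k := by exact_mod_cast Nat.sub_le k x
      have h4 : (0 : ℝ) < ((k - x : ℕ) : ℝ) := by
        have : 0 < k - x := by omega
        exact_mod_cast this
      gcongr
    have h3 := Finset.sum_le_sum h2
    rw [Finset.sum_const, nsmul_eq_mul] at h3
    have h4 : ((subsums m).card : ℝ) ≤ 2 * ((subsums m).filter fun x => m.sum ≤ 2 * x).card := by
      exact_mod_cast card_subsums_le_filter m
    refine (mul_le_mul_of_nonneg_left h4 (rwt_nonneg m)).trans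
      (le_trans (le_of_eq ?_) (mul_le_mul_of_nonneg_left h3 (by positivity)))
    field_simp
    ring
  refine (subsumMass_le_filter R hk hq).trans ?_
  have h2 := (Finset.sum_le_sum h1)
  rw [← Finset.mul_sum] at h2
  have h3 := mul_le_mul_of_nonneg_left hmain (show 0 ≤ 4 * (k : ℝ) * (k + 1) by positivity)
  linarith

lemma sum_le_sum_of_cover {ι κ : Type*} [DecidableEq ι] {s : Finset ι} {t : Finset κ} {f : ι → ℝ}
    {g : κ → ℝ} (e : κ → ι) (he : ∀ i ∈ s, ∃ j ∈ t, e j = i) (hfg : ∀ j ∈ t, f (e j) ≤ g j)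
    (hg : ∀ j ∈ t, 0 ≤ g j) : ∑ i ∈ s, f i ≤ ∑ j ∈ t, g j := by
  refine le_trans (Finset.sum_le_sum fun i hi => ?_)
    (Finset.sum_fiberwise_le_sum_of_sum_fiber_nonneg (s := t) (t := s) (g := e) (f := g)
      fun i _ => Finset.sum_nonneg fun j hj => hg j (Finset.mem_filter.1 hj).1)
  obtain ⟨j, hj, rfl⟩ := he i hi
  exact (hfg j hj).trans (Finset.single_le_sum (f := g)
    (fun x hx => hg x (Finset.mem_filter.1 hx).1) (Finset.mem_filter.2 ⟨hj, rfl⟩))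

/-- If `j`, the largest part of `c₁`, does not exceed the largest part of `c₂`, then `c₁ + c₂` is
built from `j`, parts up to `j`, and a nonempty collection of parts from `j` on. -/
lemma exists_decomposition {c₁ c₂ : Multiset ℕ} {j b : ℕ} (h₁ : j ∈ c₁) (hmax : ∀ x ∈ c₁, x ≤ j)
    (h₂ : b ∈ c₂) (hjb : j ≤ b) :
    ∃ α β : Multiset ℕ, j ::ₘ (α + β) = c₁ + c₂ ∧ (∀ x ∈ α, x ≤ j) ∧ (∀ x ∈ β, j ≤ x) ∧
      b ∈ β ∧ c₁.sum - j ∈ subsums α := by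
  obtain ⟨u, rfl⟩ := Multiset.exists_cons_of_mem h₁
  refine ⟨u + c₂.filter (¬ j ≤ ·), c₂.filter (j ≤ ·), ?_, ?_, ?_, ?_, ?_⟩
  · rw [Multiset.cons_add, add_assoc, add_comm (c₂.filter _), Multiset.filter_add_not]
  · intro x hx
    rw [Multiset.mem_add, Multiset.mem_filter] at hx
    rcases hx with hx | hx
    · exact hmax x (Multiset.mem_cons_of_mem hx)
    · omega
  · exact fun x hx => (Multiset.mem_filter.1 hx).2
  · exact Multiset.mem_filter.2 ⟨h₂, hjb⟩
  · rw [mem_subsums, Multiset.sum_cons, Nat.add_sub_cancel_left]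
    exact ⟨u, Multiset.le_add_right _ _, rfl⟩

lemma exists_max_mem {c : Multiset ℕ} (h : c ≠ 0) : ∃ j ∈ c, ∀ x ∈ c, x ≤ j := by
  obtain ⟨j, hj, hmax⟩ := Finset.exists_max_image c.toFinset id
    (by rwa [Multiset.toFinset_nonempty])
  exact ⟨j, Multiset.mem_toFinset.1 hj, fun x hx => hmax x (Multiset.mem_toFinset.2 hx)⟩

/-- The multisets on `[1, j]` having `N - j` as a subset sum. -/
def hitting (n N j : ℕ) : Finset (Multiset ℕ) :=
  (MsLe (Finset.Icc 1 j) n).filter fun α => j ≤ N ∧ N - j ∈ subsums α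

theorem iProp_le_sum_hitting {n k : ℕ} (hk : 1 ≤ k) (hn : 2 * k ≤ n) :
    iProp n k ≤ ∑ N ∈ ({k, n - k} : Finset ℕ), ∑ j ∈ Finset.Icc 1 k,
      ((j : ℝ) ^ 2)⁻¹ * ∑ α ∈ hitting n N j, rwt α := by
  have h1 : iProp n k ≤ ∑ N ∈ ({k, n - k} : Finset ℕ), ∑ j ∈ Finset.Icc 1 k,
      ∑ α ∈ (hitting n N j).filter (fun α => j + α.sum < n),
        ∑ β ∈ partsGe j (n - (j + α.sum)), (j : ℝ)⁻¹ * rwt α * rwt β := by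
    rw [iProp_eq, Finset.sum_sigma', Finset.sum_sigma', Finset.sum_sigma']
    refine sum_le_sum_of_cover (fun p => p.1.1.2 ::ₘ (p.1.2 + p.2)) ?_ ?_ ?_
    · intro c hc
      rw [Finset.mem_filter, mem_parts, mem_subsums] at hc
      obtain ⟨⟨hpos, hsum⟩, t, ht, hts⟩ := hc
      obtain ⟨u, rfl⟩ := Multiset.le_iff_exists_add.1 ht
      rw [Multiset.sum_add] at hsum
      have key : ∀ c₁ c₂ : Multiset ℕ, c₁ + c₂ = t + u → c₁.sum = k ∨ c₁.sum = n - k →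
          ∀ j b, j ∈ c₁ → (∀ x ∈ c₁, x ≤ j) → b ∈ c₂ → j ≤ b → j ≤ k →
          ∃ p ∈ ((({k, n - k} : Finset ℕ).sigma fun _ => Finset.Icc 1 k).sigma
            fun p => (hitting n p.1 p.2).filter (fun α => p.2 + α.sum < n)).sigma
            fun p => partsGe p.1.2 (n - (p.1.2 + p.2.sum)), p.1.1.2 ::ₘ (p.1.2 + p.2) = t + u := by
        intro c₁ c₂ hc hcs j b hj hmax hb hjb hjk
        obtain ⟨α, β, he, hα, hβ, hbβ, hs⟩ := exists_decomposition hj hmax hb hjb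
        rw [hc] at he
        have hj1 : 1 ≤ j := hpos j (by rw [← hc]; exact Multiset.mem_add.2 (Or.inl hj))
        have hα1 : ∀ x ∈ α, 1 ≤ x := fun x hx => hpos x (by
          rw [← he]
          exact Multiset.mem_cons_of_mem (Multiset.mem_add.2 (Or.inl hx)))
        have hes : j + (α.sum + β.sum) = n := by
          rw [← Multiset.sum_add, ← Multiset.sum_cons, he, Multiset.sum_add, hsum]
        have hbs := Multiset.le_sum_of_mem hbβ
        have hjs := Multiset.le_sum_of_mem hj
        have hcard := card_le_sum hα1
        refine ⟨⟨⟨⟨c₁.sum, j⟩, α⟩, β⟩, ?_, he⟩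
        simp only [hitting, Finset.mem_sigma, Finset.mem_insert, Finset.mem_singleton,
          Finset.mem_Icc, Finset.mem_filter, mem_MsLe, mem_partsGe hj1]
        exact ⟨⟨⟨hcs, hj1, hjk⟩, ⟨⟨by omega, fun x hx => ⟨hα1 x hx, hα x hx⟩⟩, hjs, hs⟩,
          by omega⟩, hβ, by omega⟩
      have ht0 : t ≠ 0 := by
        rintro rfl
        rw [Multiset.sum_zero] at hts
        omega
      have hu0 : u ≠ 0 := by
        rintro rfl
        rw [Multiset.sum_zero] at hsum
        omega
      obtain ⟨a, ha, hamax⟩ := exists_max_mem ht0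
      obtain ⟨b, hb, hbmax⟩ := exists_max_mem hu0
      have hak := Multiset.le_sum_of_mem ha
      rcases le_total a b with hab | hab
      · exact key t u rfl (Or.inl hts) a b ha hamax hb hab (by omega)
      · exact key u t (add_comm _ _) (Or.inr (by omega)) b a hb hbmax ha hab (by omega)
    · intro p _
      rw [mul_assoc]
      refine (rwt_cons_le _ _).trans (mul_le_mul_of_nonneg_left ?_ (by positivity))
      exact wt_add_le (fun _ _ => by positivity) (fun _ _ => by positivity)
    · intro p _
      exact mul_nonneg (mul_nonneg (by positivity) (rwt_nonneg _)) (rwt_nonneg _)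
  refine h1.trans (Finset.sum_le_sum fun N _ => Finset.sum_le_sum fun j hj => ?_)
  rw [Finset.mem_Icc] at hj
  rw [Finset.mul_sum]
  refine (Finset.sum_le_sum fun α hα => ?_).trans (Finset.sum_le_sum_of_subset_of_nonneg
    (Finset.filter_subset _ _) fun α _ _ => mul_nonneg (by positivity) (rwt_nonneg α))
  have h2 := sum_partsGe_le hj.1 (N := n - (j + α.sum)) (by
    have := (Finset.mem_filter.1 hα).2
    omega)
  rw [← Finset.mul_sum]
  refine (mul_le_mul_of_nonneg_left h2 (mul_nonneg (by positivity) (rwt_nonneg α))).trans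
    (le_of_eq ?_)
  rw [sq, mul_inv]
  ring

lemma card_filter_hitting_mul_le (N J : ℕ) (s : Finset ℕ) (hs : ∀ j ∈ s, j ≤ J) (α : Multiset ℕ) :
    (s.filter fun j => j ≤ N ∧ N - j ∈ subsums α).card * N ≤ (subsums α).card * (α.sum + J) := by
  set S := s.filter fun j => j ≤ N ∧ N - j ∈ subsums α with hS
  have h1 : S.card ≤ (subsums α).card := by
    refine Finset.card_le_card_of_injOn (fun j => N - j) (fun j hj => ?_) fun i hi j hj h => ?_
    · exact (Finset.mem_filter.1 hj).2.2
    · have := (Finset.mem_filter.1 hi).2.1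
      have := (Finset.mem_filter.1 hj).2.1
      simp only at h
      omega
  rcases S.eq_empty_or_nonempty with h0 | ⟨j, hj⟩
  · rw [h0, Finset.card_empty, zero_mul]
    exact Nat.zero_le _
  · rw [hS, Finset.mem_filter] at hj
    have h2 := le_sum_of_mem_subsums hj.2.2
    have h3 := hs j hj.1
    exact Nat.mul_le_mul h1 (by omega)

lemma sum_hitting_dyadic_le {k N : ℕ} (n t : ℕ) (hN : k ≤ N) :
    (k : ℝ) * ∑ j ∈ (Finset.Ico (2 ^ t) (2 ^ (t + 1)) : Finset ℕ),
        ((j : ℝ) ^ 2)⁻¹ * ∑ α ∈ hitting n N j, rwt α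
      ≤ 6 * ((2 : ℝ) ^ t)⁻¹ * subsumMass (2 ^ (t + 1)) n := by
  set J := 2 ^ (t + 1) with hJ
  set s := Finset.Ico (2 ^ t) J with hs
  set A := MsLe (Finset.Icc 1 J) n with hA
  have h1 : ∀ j ∈ s, ((j : ℝ) ^ 2)⁻¹ * ∑ α ∈ hitting n N j, rwt α
      ≤ ((4 : ℝ) ^ t)⁻¹ * ∑ α ∈ A, if j ≤ N ∧ N - j ∈ subsums α then rwt α else 0 := by
    intro j hj
    rw [hs, Finset.mem_Ico] at hj
    refine mul_le_mul ?_ ?_ (Finset.sum_nonneg fun α _ => rwt_nonneg α) (by positivity)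
    · have h2 : (2 : ℝ) ^ t ≤ j := by exact_mod_cast hj.1
      refine inv_anti₀ (by positivity) ?_
      rw [show (4 : ℝ) = 2 ^ 2 by norm_num, pow_right_comm]
      exact pow_le_pow_left₀ (by positivity) h2 2
    · unfold hitting
      rw [← Finset.sum_filter]
      refine Finset.sum_le_sum_of_subset_of_nonneg ?_ fun α _ _ => rwt_nonneg α
      refine Finset.filter_subset_filter _ fun α hα => ?_
      rw [mem_MsLe] at hα
      rw [hA, mem_MsLe]
      exact ⟨hα.1, fun b hb => Finset.Icc_subset_Icc_right hj.2.le (hα.2 b hb)⟩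
  have h2 := Finset.sum_le_sum h1
  rw [← Finset.mul_sum, Finset.sum_comm] at h2
  have h3 : ∀ α ∈ A, (k : ℝ) * ∑ j ∈ s, (if j ≤ N ∧ N - j ∈ subsums α then rwt α else 0)
      ≤ (α.sum : ℝ) * (rwt α * (subsums α).card) + J * (rwt α * (subsums α).card) := by
    intro α _
    rw [← Finset.sum_filter, Finset.sum_const, nsmul_eq_mul]
    have h4 := card_filter_hitting_mul_le N J s (fun j hj => (Finset.mem_Ico.1 hj).2.le) α
    have h5 := (Nat.mul_le_mul_left (s.filter fun j => j ≤ N ∧ N - j ∈ subsums α).card hN).trans h4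
    have h6 : ((s.filter fun j => j ≤ N ∧ N - j ∈ subsums α).card : ℝ) * k
        ≤ (subsums α).card * (α.sum + J) := by exact_mod_cast h5
    have h7 := mul_le_mul_of_nonneg_right h6 (rwt_nonneg α)
    linarith
  have h4 := Finset.sum_le_sum h3
  rw [← Finset.mul_sum, Finset.sum_add_distrib, ← Finset.mul_sum] at h4
  have h5 := sum_sum_mul_card_le J n
  have h6 : (k : ℝ) * ∑ α ∈ A, ∑ j ∈ s, (if j ≤ N ∧ N - j ∈ subsums α then rwt α else 0)
      ≤ 3 * J * subsumMass J n := by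
    unfold subsumMass at h5 ⊢
    linarith
  refine (mul_le_mul_of_nonneg_left h2 (Nat.cast_nonneg k)).trans ?_
  rw [mul_left_comm]
  refine (mul_le_mul_of_nonneg_left h6 (by positivity)).trans (le_of_eq ?_)
  rw [hJ, show (4 : ℝ) = 2 * 2 by norm_num, mul_pow]
  push_cast
  field_simp
  ring

/-- Upper bound for `i(n,k)` through numbers of subset sums, one dyadic scale at a time. -/
theorem mul_iProp_le {n k : ℕ} (hk : 1 ≤ k) (hn : 2 * k ≤ n) :
    (k : ℝ) * iProp n k ≤ 12 * ∑ t ∈ Finset.range (Nat.log 2 k + 1),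
      ((2 : ℝ) ^ t)⁻¹ * subsumMass (2 ^ (t + 1)) n := by
  have hg : ∀ N j : ℕ, 0 ≤ ((j : ℝ) ^ 2)⁻¹ * ∑ α ∈ hitting n N j, rwt α := fun N j =>
    mul_nonneg (by positivity) (Finset.sum_nonneg fun α _ => rwt_nonneg α)
  have h1 : ∀ N, k ≤ N → (k : ℝ) * ∑ j ∈ Finset.Icc 1 k,
      ((j : ℝ) ^ 2)⁻¹ * ∑ α ∈ hitting n N j, rwt α
      ≤ 6 * ∑ t ∈ Finset.range (Nat.log 2 k + 1), ((2 : ℝ) ^ t)⁻¹ * subsumMass (2 ^ (t + 1)) n := by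
    intro N hN
    have h2 : ∑ j ∈ Finset.Icc 1 k, ((j : ℝ) ^ 2)⁻¹ * ∑ α ∈ hitting n N j, rwt α
        ≤ ∑ t ∈ Finset.range (Nat.log 2 k + 1), ∑ j ∈ (Finset.Ico (2 ^ t) (2 ^ (t + 1)) : Finset ℕ),
          ((j : ℝ) ^ 2)⁻¹ * ∑ α ∈ hitting n N j, rwt α := by
      rw [Finset.sum_sigma']
      refine sum_le_sum_of_cover (fun p => p.2) (fun j hj => ?_) (fun _ _ => le_rfl)
        fun p _ => hg N p.2
      rw [Finset.mem_Icc] at hj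
      refine ⟨⟨Nat.log 2 j, j⟩, ?_, rfl⟩
      rw [Finset.mem_sigma, Finset.mem_range, Finset.mem_Ico]
      exact ⟨Nat.lt_succ_of_le (Nat.log_mono_right (b := 2) hj.2), Nat.pow_log_le_self 2 (by omega),
        Nat.lt_pow_succ_log_self one_lt_two j⟩
    refine (mul_le_mul_of_nonneg_left h2 (Nat.cast_nonneg k)).trans ?_
    rw [Finset.mul_sum, Finset.mul_sum]
    refine Finset.sum_le_sum fun t _ => (sum_hitting_dyadic_le n t hN).trans (le_of_eq ?_)
    ring
  refine (mul_le_mul_of_nonneg_left (iProp_le_sum_hitting hk hn) (Nat.cast_nonneg k)).trans ?_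
  rw [Finset.mul_sum]
  refine (Finset.sum_le_card_nsmul _ _ _ fun N hN => h1 N ?_).trans ?_
  · rw [Finset.mem_insert, Finset.mem_singleton] at hN
    omega
  · rw [nsmul_eq_mul]
    have h3 : ((({k, n - k} : Finset ℕ).card : ℕ) : ℝ) ≤ 2 := by exact_mod_cast Finset.card_le_two
    have h4 : 0 ≤ ∑ t ∈ Finset.range (Nat.log 2 k + 1),
        ((2 : ℝ) ^ t)⁻¹ * subsumMass (2 ^ (t + 1)) n :=
      Finset.sum_nonneg fun t _ => mul_nonneg (by positivity) (subsumMass_nonneg _ _)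
    nlinarith

lemma one_lt_exp_mul_log_two : 1 < Real.exp 1 * Real.log 2 := by
  have h1 := Real.exp_one_gt_d9
  have h2 := log_two_bounds.1
  nlinarith

lemma exp_mul_log_two_lt : Real.exp 1 * Real.log 2 < 2 := by
  have h1 := Real.exp_one_lt_d9
  have h2 := log_two_bounds
  nlinarith [Real.exp_pos 1]

lemma exp_neg_delta : Real.exp (-delta * Real.log 2) = Real.exp 1 * Real.log 2 / 2 := by
  have h0 : 0 < Real.log 2 := Real.log_pos one_lt_two
  have h1 : -delta * Real.log 2 = 1 + Real.log (Real.log 2) - Real.log 2 := by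
    unfold delta
    field_simp
    ring
  rw [h1, Real.exp_sub, Real.exp_add, Real.exp_log h0, Real.exp_log two_pos]

lemma delta_pos : 0 < delta := by
  have h0 : 0 < Real.log 2 := Real.log_pos one_lt_two
  have h1 : Real.exp (-delta * Real.log 2) < 1 := by
    rw [exp_neg_delta]
    linarith [exp_mul_log_two_lt]
  rw [Real.exp_lt_one_iff] at h1
  nlinarith

lemma log_mul_log_two_le {k : ℕ} (hk : 1 ≤ k) : (Nat.log 2 k : ℝ) * Real.log 2 ≤ Real.log k := by
  have h : (2 : ℝ) ^ Nat.log 2 k ≤ k := by exact_mod_cast Nat.pow_log_le_self 2 (by omega)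
  rw [← Real.log_pow]
  exact Real.log_le_log (by positivity) h

lemma log_le_log_succ_mul_log_two {k : ℕ} (hk : 1 ≤ k) :
    Real.log k ≤ (Nat.log 2 k + 1 : ℝ) * Real.log 2 := by
  have h : (k : ℝ) ≤ (2 : ℝ) ^ (Nat.log 2 k + 1) := by
    exact_mod_cast (Nat.lt_pow_succ_log_self one_lt_two k).le
  have h2 := Real.log_le_log (by exact_mod_cast hk) h
  rw [Real.log_pow] at h2
  exact_mod_cast h2

lemma rpow_neg_delta_bounds {k : ℕ} (hk : 1 ≤ k) :
    (Real.exp 1 * Real.log 2 / 2) ^ Nat.log 2 k / 2 ≤ (k : ℝ) ^ (-delta) ∧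
      (k : ℝ) ^ (-delta) ≤ (Real.exp 1 * Real.log 2 / 2) ^ Nat.log 2 k := by
  have hk0 : (0 : ℝ) < k := by exact_mod_cast hk
  have h1 := log_mul_log_two_le hk
  have h2 := log_le_log_succ_mul_log_two hk
  have hd := delta_pos
  rw [Real.rpow_def_of_pos hk0]
  constructor
  · have h3 : (Real.exp 1 * Real.log 2 / 2) ^ (Nat.log 2 k + 1)
        ≤ Real.exp (Real.log k * -delta) := by
      rw [← exp_neg_delta, ← Real.exp_nat_mul, Real.exp_le_exp]
      push_cast
      nlinarith
    refine le_trans ?_ h3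
    rw [pow_succ, div_eq_mul_inv]
    have h4 := one_lt_exp_mul_log_two
    exact mul_le_mul_of_nonneg_left (by linarith) (by positivity)
  · rw [← exp_neg_delta, ← Real.exp_nat_mul, Real.exp_le_exp]
    nlinarith

lemma two_rpow_le : (2 : ℝ) ^ (3 / 2 : ℝ) ≤ 4 := by
  calc (2 : ℝ) ^ (3 / 2 : ℝ) ≤ 2 ^ (2 : ℝ) :=
        Real.rpow_le_rpow_of_exponent_le one_le_two (by norm_num)
    _ = 4 := by norm_num

lemma one_add_log_rpow_bounds {k : ℕ} (hk : 1 ≤ k) :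
    rho (Nat.log 2 k) / 4 ≤ (1 + Real.log k) ^ (-(3 / 2 : ℝ)) ∧
      (1 + Real.log k) ^ (-(3 / 2 : ℝ)) ≤ 4 * rho (Nat.log 2 k) := by
  have h1 := log_mul_log_two_le hk
  have h2 := log_le_log_succ_mul_log_two hk
  have h3 := log_two_bounds
  have h4 : (0 : ℝ) ≤ Nat.log 2 k := Nat.cast_nonneg _
  set x : ℝ := (Nat.log 2 k : ℝ) + 1 with hx
  have hx0 : 0 < x := by linarith
  have h5 : 1 + Real.log k ≤ 2 * x := by nlinarith
  have h6 : x / 2 ≤ 1 + Real.log k := by nlinarith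
  have h7 : rho (Nat.log 2 k) = x ^ (-(3 / 2) : ℝ) := rfl
  have hr := Real.rpow_pos_of_pos hx0 (-(3 / 2 : ℝ))
  have h8 := two_rpow_le
  have h9 : (0 : ℝ) < 2 ^ (3 / 2 : ℝ) := by positivity
  rw [h7]
  constructor
  · refine le_trans ?_ (Real.rpow_le_rpow_of_nonpos (by linarith) h5 (by norm_num))
    rw [Real.mul_rpow two_pos.le hx0.le, Real.rpow_neg two_pos.le, div_eq_mul_inv, mul_comm]
    exact mul_le_mul_of_nonneg_right (inv_anti₀ h9 h8) hr.le
  · refine (Real.rpow_le_rpow_of_nonpos (by linarith) h6 (by norm_num)).trans ?_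
    rw [Real.div_rpow hx0.le two_pos.le, Real.rpow_neg two_pos.le, div_inv_eq_mul, mul_comm]
    exact mul_le_mul_of_nonneg_right h8 hr.le

lemma rho_sub_le {T s : ℕ} (h : s ≤ T) : rho (T - s) ≤ ((s : ℝ) + 2) ^ 2 * rho T := by
  have h1 : (T : ℝ) + 1 ≤ ((s : ℝ) + 1) * (((T - s : ℕ) : ℝ) + 1) := by
    have : T + 1 ≤ (s + 1) * ((T - s) + 1) := by
      obtain ⟨d, rfl⟩ := Nat.exists_eq_add_of_le h
      rw [Nat.add_sub_cancel_left]
      nlinarith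
    exact_mod_cast this
  have h2 : (((s : ℝ) + 1) * (((T - s : ℕ) : ℝ) + 1)) ^ (-(3 / 2) : ℝ) ≤ rho T :=
    Real.rpow_le_rpow_of_nonpos (by positivity) h1 (by norm_num)
  rw [Real.mul_rpow (by positivity) (by positivity), Real.rpow_neg (by positivity)] at h2
  have h3 : ((s : ℝ) + 1) ^ (3 / 2 : ℝ) ≤ ((s : ℝ) + 2) ^ 2 := by
    calc ((s : ℝ) + 1) ^ (3 / 2 : ℝ) ≤ ((s : ℝ) + 1) ^ (2 : ℝ) :=
          Real.rpow_le_rpow_of_exponent_le (by linarith [s.cast_nonneg (α := ℝ)]) (by norm_num)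
      _ = ((s : ℝ) + 1) ^ 2 := by norm_num
      _ ≤ _ := by gcongr; norm_num
  have h4 : (0 : ℝ) < ((s : ℝ) + 1) ^ (3 / 2 : ℝ) := by positivity
  rw [inv_mul_le_iff₀ h4] at h2
  exact h2.trans (mul_le_mul_of_nonneg_right h3 (rho_pos T).le)

lemma sum_pow_mul_rho_le {x : ℝ} (hx : 1 < x) : ∃ K : ℝ, 0 < K ∧ ∀ T : ℕ,
    ∑ t ∈ Finset.range (T + 1), x ^ t * rho t ≤ K * (x ^ T * rho T) := by
  have hx0 : 0 < x := by linarith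
  obtain ⟨K, hK, h⟩ := sum_pow_mul_geometric_le 2 (t := x⁻¹) (by positivity)
    (inv_lt_one_of_one_lt₀ hx)
  refine ⟨K, hK, fun T => ?_⟩
  have hr := rho_pos T
  rw [← Finset.sum_range_reflect]
  refine le_trans ?_ (mul_le_mul_of_nonneg_right (h (T + 1)) (by positivity))
  rw [Finset.sum_mul]
  refine Finset.sum_le_sum fun s hs => ?_
  have hsT : s ≤ T := by
    rw [Finset.mem_range] at hs
    omega
  rw [show T + 1 - 1 - s = T - s by omega]
  refine (mul_le_mul_of_nonneg_left (rho_sub_le hsT) (by positivity)).trans (le_of_eq ?_)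
  rw [pow_sub₀ _ hx0.ne' hsT, inv_pow]
  ring

lemma iProp_le : ∃ C : ℝ, 0 < C ∧ ∀ n k : ℕ, 1 ≤ k → 2 * k ≤ n →
    iProp n k ≤ C * ((Real.exp 1 * Real.log 2 / 2) ^ Nat.log 2 k * rho (Nat.log 2 k)) := by
  obtain ⟨C, hC, hE⟩ := subsumMass_le
  obtain ⟨K, hK, hS⟩ := sum_pow_mul_rho_le one_lt_exp_mul_log_two
  set X := Real.exp 1 * Real.log 2 with hX
  have hX0 : 0 < X := by linarith [one_lt_exp_mul_log_two]
  refine ⟨12 * (C * (2 * X) * K), by positivity, fun n k hk hn => ?_⟩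
  set T := Nat.log 2 k with hT
  have hk0 : (0 : ℝ) < k := by exact_mod_cast hk
  have hr := rho_pos T
  refine le_of_mul_le_mul_left ((mul_iProp_le hk hn).trans ?_) hk0
  have h1 : ∑ t ∈ Finset.range (T + 1), ((2 : ℝ) ^ t)⁻¹ * subsumMass (2 ^ (t + 1)) n
      ≤ C * (2 * X) * ∑ t ∈ Finset.range (T + 1), X ^ t * rho t := by
    rw [Finset.mul_sum]
    refine Finset.sum_le_sum fun t _ => ?_
    have h2 : subsumMass (2 ^ (t + 1)) n ≤ C * ((2 * X) ^ (t + 1) * rho t) :=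
      (hE (t + 1) n).trans (by gcongr; exact rho_le_rho (Nat.le_succ t))
    refine (mul_le_mul_of_nonneg_left h2 (by positivity)).trans (le_of_eq ?_)
    rw [pow_succ, mul_pow]
    field_simp
  have h2 : (2 : ℝ) ^ T ≤ k := by exact_mod_cast Nat.pow_log_le_self 2 (by omega)
  calc 12 * ∑ t ∈ Finset.range (T + 1), ((2 : ℝ) ^ t)⁻¹ * subsumMass (2 ^ (t + 1)) n
      ≤ 12 * (C * (2 * X) * (K * (X ^ T * rho T))) := by
        refine mul_le_mul_of_nonneg_left (h1.trans ?_) (by norm_num)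
        exact mul_le_mul_of_nonneg_left (hS T) (by positivity)
    _ = 2 ^ T * (12 * (C * (2 * X) * K) * ((X / 2) ^ T * rho T)) := by
        rw [div_pow]
        field_simp
    _ ≤ k * (12 * (C * (2 * X) * K) * ((X / 2) ^ T * rho T)) :=
        mul_le_mul_of_nonneg_right h2 (by positivity)

lemma le_iProp : ∃ c : ℝ, 0 < c ∧ ∀ n k : ℕ, 1 ≤ k → 2 * k ≤ n →
    c * ((Real.exp 1 * Real.log 2 / 2) ^ Nat.log 2 k * rho (Nat.log 2 k)) ≤ iProp n k := by
  obtain ⟨c, hc, hE⟩ := le_subsumMass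
  set X := Real.exp 1 * Real.log 2 with hX
  have hX1 : 1 < X := one_lt_exp_mul_log_two
  have hX2 : X < 2 := exp_mul_log_two_lt
  refine ⟨c / 4096, by positivity, fun n k hk hn => ?_⟩
  set T := Nat.log 2 k with hT
  have hk0 : (1 : ℝ) ≤ k := by exact_mod_cast hk
  have hr := rho_pos T
  have hpow : 2 ^ T ≤ k := Nat.pow_log_le_self 2 (by omega)
  have hq : 2 ^ (T - 3) ≤ k / 8 + 1 := by
    rcases le_total 3 T with h | h
    · have : 2 ^ T = 2 ^ (T - 3) * 8 := by
        rw [show (8 : ℕ) = 2 ^ 3 by norm_num, ← pow_add, Nat.sub_add_cancel h]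
      omega
    · rw [Nat.sub_eq_zero_of_le h, pow_zero]
      omega
  have hTn : T - 3 ≤ n := by
    have : T ≤ k := Nat.log_le_self 2 k
    omega
  have h1 := (hE (T - 3) (k / 8) n hq hTn).trans (subsumMass_le_iProp n hk hn (Nat.mul_div_le k 8))
  have h2 : (2 * X) ^ T ≤ 64 * (2 * X) ^ (T - 3) := by
    have h3 : (2 * X) ^ T ≤ (2 * X) ^ (3 + (T - 3)) :=
      pow_le_pow_right₀ (by linarith) (by omega)
    rw [pow_add] at h3
    refine h3.trans (mul_le_mul_of_nonneg_right ?_ (by positivity))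
    calc (2 * X) ^ 3 ≤ 4 ^ 3 := pow_le_pow_left₀ (by positivity) (by linarith) 3
      _ = 64 := by norm_num
  have h3 : rho T ≤ rho (T - 3) := rho_le_rho (Nat.sub_le T 3)
  have h4 : (k : ℝ) ≤ 2 * 2 ^ T := by
    have h5 := (Nat.lt_pow_succ_log_self one_lt_two k).le
    rw [pow_succ, ← hT] at h5
    have : (k : ℝ) ≤ 2 ^ T * 2 := by exact_mod_cast h5
    linarith
  have hi : 0 ≤ iProp n k := by
    unfold iProp
    positivity
  have h5 : 8 * (k : ℝ) * (k + 1) ≤ 64 * 4 ^ T := by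
    have h6 : (4 : ℝ) ^ T = 2 ^ T * 2 ^ T := by rw [← mul_pow]; norm_num
    rw [h6]
    nlinarith
  have h6 : c * ((2 * X) ^ T * rho T) ≤ 64 * (64 * 4 ^ T * iProp n k) := by
    calc c * ((2 * X) ^ T * rho T) ≤ c * (64 * (2 * X) ^ (T - 3) * rho (T - 3)) := by gcongr
      _ = 64 * (c * ((2 * X) ^ (T - 3) * rho (T - 3))) := by ring
      _ ≤ 64 * (64 * 4 ^ T * iProp n k) := by
        refine mul_le_mul_of_nonneg_left (h1.trans ?_) (by norm_num)
        exact mul_le_mul_of_nonneg_right h5 hi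
  have h7 : (2 * X) ^ T = 4 ^ T * (X / 2) ^ T := by
    rw [← mul_pow]
    congr 1
    ring
  rw [h7] at h6
  have h8 : (0 : ℝ) < 4 ^ T := by positivity
  refine le_of_mul_le_mul_left ?_ h8
  linarith

theorem i_n_k_asymp :
    ∃ C1 C2 : ℝ, 0 < C1 ∧ 0 < C2 ∧
      ∀ n k : ℕ, 2 ≤ n → 1 ≤ k → 2 * k ≤ n →
        C1 * (k : ℝ) ^ (-delta) * (1 + Real.log k) ^ (-(3/2 : ℝ)) ≤ iProp n k ∧
        iProp n k ≤ C2 * (k : ℝ) ^ (-delta) * (1 + Real.log k) ^ (-(3/2 : ℝ)) := by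
  obtain ⟨c, hc, hlow⟩ := le_iProp
  obtain ⟨C, hC, hup⟩ := iProp_le
  refine ⟨c / 4, 8 * C, by positivity, by positivity, fun n k _ hk hn => ?_⟩
  obtain ⟨h1, h2⟩ := rpow_neg_delta_bounds hk
  obtain ⟨h3, h4⟩ := one_add_log_rpow_bounds hk
  have hr := rho_pos (Nat.log 2 k)
  have hX := one_lt_exp_mul_log_two
  have hp : 0 < (Real.exp 1 * Real.log 2 / 2) ^ Nat.log 2 k := pow_pos (by linarith) _
  have hlogk := Real.log_natCast_nonneg k
  constructor
  · refine le_trans ?_ (hlow n k hk hn)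
    have h5 := mul_le_mul h2 h4 (by positivity) hp.le
    have h6 := mul_le_mul_of_nonneg_left h5 hc.le
    linarith
  · refine (hup n k hk hn).trans ?_
    have h5 := mul_le_mul h1 h3 (by positivity) (by positivity)
    have h6 := mul_le_mul_of_nonneg_left h5 hC.le
    linarith
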